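/- (General stability) Fix q₀ > 0, M > 0, η > 0, θ ∈ (0, 1/4) and a positive integer m. Assume Ω satisfies the broken-line condition with parameter m and has the uniform interior cone property. There exist constants C₀ > 0 and C₁ > 0, depending only on n, Ω, A, q₀, M, η, m and θ, with the following property. Let q, q̃ : closure(Ω) → ℝ be Lipschitz with q ≥ q₀, q̃ ≥ q₀, ‖q‖_{W^{1,∞}} ≤ M, ‖q̃‖_{W^{1,∞}} ≤ M and q = q̃ on ∂Ω. Let u, ũ be twice continuously differentiable on closure(Ω), classical solutions of L_q u = 0 and L_{q̃} ũ = 0, with u = ũ on ∂Ω, |u(x)| ≥ η for all x ∈ ∂Ω, ‖u‖_{C²(closure(Ω))} ≤ M and ‖ũ‖_{C²(closure(Ω))} ≤ M. Set √I_q := √q·|u|, √I_{q̃} := √q̃·|ũ| and D := ‖√I_q − √I_{q̃}‖_{H¹(Ω)}^{θ}. If 0 < D < 1, then ‖q − q̃‖_{L^∞(Ω)} ≤ C₀ ( |ln(C₁ |ln D|)|^{−1} + D ). -/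

import Mathlib

open MeasureTheory Metric Set
open scoped RealInnerProductSpace

noncomputable section

/-- The `i`-th partial derivative of a real-valued function on `ℝⁿ`. -/
noncomputable def pd {n : ℕ} (i : Fin n) (f : EuclideanSpace ℝ (Fin n) → ℝ)
    (x : EuclideanSpace ℝ (Fin n)) : ℝ :=
  fderiv ℝ f x (EuclideanSpace.single i 1)

/-- `u` is a classical solution of `L_q u = ∑ᵢⱼ ∂ᵢ (aⁱʲ ∂ⱼ u) + q u = 0` pointwise in `Ω`. -/
def IsSolution {n : ℕ} (A : Fin n → Fin n → EuclideanSpace ℝ (Fin n) → ℝ)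
    (q u : EuclideanSpace ℝ (Fin n) → ℝ) (Ω : Set (EuclideanSpace ℝ (Fin n))) : Prop :=
  ∀ x ∈ Ω, (∑ i, ∑ j, pd i (fun y => A i j y * pd j u y) x) + q x * u x = 0

/-- The `H¹(D)` norm `(∫_D (w² + ‖∇w‖²))^{1/2}`. -/
noncomputable def H1Norm {n : ℕ} (D : Set (EuclideanSpace ℝ (Fin n)))
    (w : EuclideanSpace ℝ (Fin n) → ℝ) : ℝ :=
  (∫ x in D, ((w x) ^ 2 + ‖fderiv ℝ w x‖ ^ 2)) ^ (1 / 2 : ℝ)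

/-- `A = (aⁱʲ)` is symmetric, has `C¹` entries on `closure Ω`, and is uniformly elliptic. -/
def EllipticSym {n : ℕ} (Ω : Set (EuclideanSpace ℝ (Fin n)))
    (A : Fin n → Fin n → EuclideanSpace ℝ (Fin n) → ℝ) : Prop :=
  (∀ i j, ∀ x ∈ closure Ω, A i j x = A j i x) ∧
  (∀ i j, ContDiffOn ℝ 1 (A i j) (closure Ω)) ∧
  (∃ lam > 0, ∀ x ∈ Ω, ∀ ξ : EuclideanSpace ℝ (Fin n),
    lam * ‖ξ‖ ^ 2 ≤ ∑ i, ∑ j, A i j x * ξ i * ξ j)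

/-- `‖f‖_{W^{1,∞}(closure Ω)} = sup |f| + Lip(f) ≤ M`. -/
def W1InfBound {n : ℕ} (Ω : Set (EuclideanSpace ℝ (Fin n)))
    (f : EuclideanSpace ℝ (Fin n) → ℝ) (M : ℝ) : Prop :=
  ∃ K : NNReal, LipschitzOnWith K f (closure Ω) ∧ ∀ x ∈ closure Ω, |f x| + (K : ℝ) ≤ M

/-- `∂Ω` is of class `C^{1,1}`: near each boundary point, after choosing a direction `ν`,
`Ω` is the region on one side of the graph of a function with Lipschitz derivative. -/
def IsC11Boundary {n : ℕ} (Ω : Set (EuclideanSpace ℝ (Fin n))) : Prop :=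
  ∀ x ∈ frontier Ω, ∃ r > 0, ∃ ν : EuclideanSpace ℝ (Fin n), ‖ν‖ = 1 ∧
    ∃ φ : EuclideanSpace ℝ (Fin n) → ℝ, ∃ K : NNReal,
      Differentiable ℝ φ ∧ LipschitzWith K (fderiv ℝ φ) ∧
      ∀ y ∈ ball x r, (y ∈ Ω ↔ ⟪y, ν⟫ < φ (y - ⟪y, ν⟫ • ν))

/-- `u ∈ C²(closure Ω)` with `‖u‖_{C²(closure Ω)} ≤ M`. -/
def C2BoundOn {n : ℕ} (Ω : Set (EuclideanSpace ℝ (Fin n)))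
    (u : EuclideanSpace ℝ (Fin n) → ℝ) (M : ℝ) : Prop :=
  ContDiffOn ℝ 2 u (closure Ω) ∧ (∀ x ∈ closure Ω, |u x| ≤ M) ∧
    ∀ x ∈ Ω, ‖iteratedFDeriv ℝ 1 u x‖ ≤ M ∧ ‖iteratedFDeriv ℝ 2 u x‖ ≤ M

/-- Uniform interior cone property of `Ω`. -/
def UniformIntConeProperty {n : ℕ} (Ω : Set (EuclideanSpace ℝ (Fin n))) : Prop :=
  ∃ R > 0, ∃ θ₀ : ℝ, 0 < θ₀ ∧ θ₀ < Real.pi / 2 ∧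
    ∀ xt ∈ frontier Ω, ∃ ξ : EuclideanSpace ℝ (Fin n), ‖ξ‖ = 1 ∧
      {x : EuclideanSpace ℝ (Fin n) |
        ‖x - xt‖ < 2 * R ∧ ‖x - xt‖ * Real.cos θ₀ < ⟪x - xt, ξ⟫} ⊆ Ω

/-- Any two points of `D` can be joined by a broken line in `D` with at most `m` segments. -/
def BrokenLineCond {n : ℕ} (D : Set (EuclideanSpace ℝ (Fin n))) (m : ℕ) : Prop :=
  ∀ x ∈ D, ∀ y ∈ D, ∃ j ≤ m, ∃ z : ℕ → EuclideanSpace ℝ (Fin n),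
    z 0 = x ∧ z j = y ∧ ∀ i < j, segment ℝ (z i) (z (i + 1)) ⊆ D


/-- `f` is differentiable at `x` with partial derivatives `g k`. -/
def HG {n : ℕ} (f : EuclideanSpace ℝ (Fin n) → ℝ) (g : Fin n → ℝ)
    (x : EuclideanSpace ℝ (Fin n)) : Prop :=
  DifferentiableAt ℝ f x ∧ ∀ k, pd k f x = g k

section HGlemmas
variable {n : ℕ} {f f₂ : EuclideanSpace ℝ (Fin n) → ℝ} {g g₂ : Fin n → ℝ}
  {x : EuclideanSpace ℝ (Fin n)}

lemma HG.of_diff (h : DifferentiableAt ℝ f x) : HG f (fun k => pd k f x) x := ⟨h, fun _ => rfl⟩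

lemma HG.congr_grad (h : HG f g x) (e : ∀ k, g k = g₂ k) : HG f g₂ x :=
  ⟨h.1, fun k => (h.2 k).trans (e k)⟩

lemma HG.mul (h : HG f g x) (h₂ : HG f₂ g₂ x) :
    HG (fun y => f y * f₂ y) (fun k => g k * f₂ x + f x * g₂ k) x := by
  refine ⟨h.1.mul h₂.1, fun k => ?_⟩
  have := fderiv_fun_mul h.1 h₂.1
  simp only [pd, this]
  have e1 := h.2 k
  have e2 := h₂.2 k
  simp only [pd] at e1 e2
  simp [e1, e2]; ring

lemma HG.add (h : HG f g x) (h₂ : HG f₂ g₂ x) :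
    HG (fun y => f y + f₂ y) (fun k => g k + g₂ k) x := by
  refine ⟨h.1.add h₂.1, fun k => ?_⟩
  have := fderiv_fun_add h.1 h₂.1
  have e1 := h.2 k
  have e2 := h₂.2 k
  simp only [pd] at e1 e2
  simp [pd, this, e1, e2]

lemma HG.sub (h : HG f g x) (h₂ : HG f₂ g₂ x) :
    HG (fun y => f y - f₂ y) (fun k => g k - g₂ k) x := by
  refine ⟨h.1.sub h₂.1, fun k => ?_⟩
  have := fderiv_fun_sub h.1 h₂.1
  have e1 := h.2 k
  have e2 := h₂.2 k
  simp only [pd] at e1 e2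
  simp [pd, this, e1, e2]

lemma HG.const (c : ℝ) : HG (fun _ => c) (fun _ => 0) x := by
  refine ⟨differentiableAt_const c, fun k => ?_⟩
  simp [pd]

lemma HG.cmul (c : ℝ) (h : HG f g x) : HG (fun y => c * f y) (fun k => c * g k) x :=
  ((HG.const c).mul h).congr_grad (fun k => by ring)

lemma HG.sum {ι : Type*} (s : Finset ι) {F : ι → EuclideanSpace ℝ (Fin n) → ℝ}
    {G : ι → Fin n → ℝ} (h : ∀ i, HG (F i) (G i) x) :
    HG (fun y => ∑ i ∈ s, F i y) (fun k => ∑ i ∈ s, G i k) x := by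
  classical
  induction s using Finset.induction_on with
  | empty => simpa using HG.const 0
  | insert a s ha ih =>
    have := (h a).add ih
    simpa [Finset.sum_insert ha] using this

lemma HG.comp {φ : ℝ → ℝ} {φ' : ℝ} (hφ : HasDerivAt φ φ' (f x)) (h : HG f g x) :
    HG (fun y => φ (f y)) (fun k => φ' * g k) x := by
  have := hφ.comp_hasFDerivAt x h.1.hasFDerivAt
  refine ⟨this.differentiableAt, fun k => ?_⟩
  have e := h.2 k
  simp only [pd] at e ⊢
  have e3 : fderiv ℝ (fun y => φ (f y)) x = φ' • fderiv ℝ f x := this.fderiv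
  rw [e3]; simp [e]

lemma HG.coord (i : Fin n) (c : ℝ) :
    HG (fun y : EuclideanSpace ℝ (Fin n) => y i - c) (fun k => if k = i then 1 else 0) x := by
  have h1 : HasFDerivAt (fun y : EuclideanSpace ℝ (Fin n) => y i - c)
      (EuclideanSpace.proj i : EuclideanSpace ℝ (Fin n) →L[ℝ] ℝ) x := by
    have := (EuclideanSpace.proj i : EuclideanSpace ℝ (Fin n) →L[ℝ] ℝ).hasFDerivAt (x := x)
    exact this.sub_const c
  refine ⟨h1.differentiableAt, fun k => ?_⟩
  simp only [pd, h1.fderiv]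
  simp [eq_comm]

lemma HG.congr_fun (h : HG f g x) (e : f₂ =ᶠ[nhds x] f) : HG f₂ g x := by
  refine ⟨e.differentiableAt_iff.2 h.1, fun k => ?_⟩
  rw [← h.2 k]; simp only [pd, e.fderiv_eq]

lemma HG.pd_eq (h : HG f g x) (k : Fin n) : pd k f x = g k := h.2 k

end HGlemmas

lemma pd_contDiffOn {n : ℕ} {u : EuclideanSpace ℝ (Fin n) → ℝ}
    {U : Set (EuclideanSpace ℝ (Fin n))} (hU : IsOpen U) (hu : ContDiffOn ℝ 2 u U) (i : Fin n) :
    ContDiffOn ℝ 1 (pd i u) U := by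
  have := hu.fderiv_of_isOpen hU (m := 1) (by norm_num)
  exact this.clm_apply contDiffOn_const

lemma pd_symm {n : ℕ} {u : EuclideanSpace ℝ (Fin n) → ℝ}
    {U : Set (EuclideanSpace ℝ (Fin n))} (hU : IsOpen U) (hu : ContDiffOn ℝ 2 u U)
    {x : EuclideanSpace ℝ (Fin n)} (hx : x ∈ U) (i j : Fin n) :
    pd i (pd j u) x = pd j (pd i u) x := by
  have hc : ContDiffAt ℝ 2 u x := hu.contDiffAt (hU.mem_nhds hx)
  have hs : IsSymmSndFDerivAt ℝ u x := hc.isSymmSndFDerivAt (by simp)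
  have hd : DifferentiableAt ℝ (fderiv ℝ u) x :=
    (hc.fderiv_right (m := 1) (by norm_num)).differentiableAt (by norm_num)
  have key : ∀ i j : Fin n, pd i (pd j u) x =
      fderiv ℝ (fderiv ℝ u) x (EuclideanSpace.single i 1) (EuclideanSpace.single j 1) := by
    intro i j
    have h1 : HasFDerivAt (fun y => fderiv ℝ u y (EuclideanSpace.single j (1:ℝ)))
      ((fderiv ℝ (fderiv ℝ u) x).flip (EuclideanSpace.single j 1)) x := by
      have := hd.hasFDerivAt.clm_apply (hasFDerivAt_const (EuclideanSpace.single j (1:ℝ)) x)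
      simpa using this
    unfold pd
    rw [h1.fderiv]; rfl
  rw [key, key]
  exact hs _ _

lemma pd_pd_eq {n : ℕ} {u : EuclideanSpace ℝ (Fin n) → ℝ}
    {x : EuclideanSpace ℝ (Fin n)} (hc : ContDiffAt ℝ 2 u x) (i j : Fin n) :
    pd i (pd j u) x = 
      fderiv ℝ (fderiv ℝ u) x (EuclideanSpace.single i 1) (EuclideanSpace.single j 1) := by
  have hd : DifferentiableAt ℝ (fderiv ℝ u) x :=
    (hc.fderiv_right (m := 1) (by norm_num)).differentiableAt (by norm_num)
  have h1 : HasFDerivAt (fun y => fderiv ℝ u y (EuclideanSpace.single j (1:ℝ)))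
    ((fderiv ℝ (fderiv ℝ u) x).flip (EuclideanSpace.single j 1)) x := by
    have := hd.hasFDerivAt.clm_apply (hasFDerivAt_const (EuclideanSpace.single j (1:ℝ)) x)
    simpa using this
  unfold pd
  rw [h1.fderiv]; rfl

/-- Integral of a partial derivative of a compactly supported Lipschitz function. -/
lemma integral_pd_lip {n : ℕ} {F : EuclideanSpace ℝ (Fin n) → ℝ} {C : NNReal}
    (hF : LipschitzWith C F) (hc : HasCompactSupport F) (k : Fin n) :
    Integrable (pd k F) ∧ ∫ x, pd k F x = 0 := by
  have hae : (fun x => lineDeriv ℝ F x (EuclideanSpace.single k 1)) =ᵐ[volume] pd k F := by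
    filter_upwards [hF.ae_differentiableAt (μ := volume)] with x hx
    exact hx.lineDeriv_eq_fderiv
  constructor
  · have hm : MemLp (pd k F) ⊤ volume := 
      (memLp_congr_ae hae).1 (hF.memLp_lineDeriv (μ := volume) _)
    have h2 : HasCompactSupport (pd k F) := by
      have := hc.fderiv_apply ℝ (EuclideanSpace.single k (1:ℝ))
      exact this
    haveI : IsFiniteMeasure (volume.restrict (tsupport (pd k F))) :=
      ⟨by simpa using IsCompact.measure_lt_top h2⟩
    have h3 : IntegrableOn (pd k F) (tsupport (pd k F)) :=
      MemLp.integrable le_top (hm.restrict _)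
    exact (integrableOn_iff_integrable_of_support_subset (subset_tsupport _)).1 h3
  · have := LipschitzWith.integral_lineDeriv_mul_eq (μ := volume) (LipschitzWith.const (1:ℝ)) hF hc
      (-EuclideanSpace.single k (1:ℝ))
    simp only [neg_neg, mul_one] at this
    rw [← integral_congr_ae hae, ← this]
    simp [lineDeriv]

/-- A `C¹` function on open `U` vanishing outside compact `K ⊆ U` is globally `C¹`. -/
lemma contDiff_of_vanish {n : ℕ} {F : EuclideanSpace ℝ (Fin n) → ℝ} {m : ℕ∞}
    {U K : Set (EuclideanSpace ℝ (Fin n))} (hU : IsOpen U) (hK : IsCompact K) (hKU : K ⊆ U)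
    (hF : ContDiffOn ℝ m F U) (h0 : ∀ x, x ∉ K → F x = 0) : ContDiff ℝ m F := by
  rw [contDiff_iff_contDiffAt]
  intro x
  by_cases hx : x ∈ U
  · exact hF.contDiffAt (hU.mem_nhds hx)
  · have hx' : Kᶜ ∈ nhds x := hK.isClosed.isOpen_compl.mem_nhds (fun h => hx (hKU h))
    have : F =ᶠ[nhds x] fun _ => 0 := by
      filter_upwards [hx'] with y hy using h0 y hy
    exact contDiffAt_const.congr_of_eventuallyEq this

lemma integral_pd_C1 {n : ℕ} {F : EuclideanSpace ℝ (Fin n) → ℝ}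
    {U K : Set (EuclideanSpace ℝ (Fin n))} (hU : IsOpen U) (hK : IsCompact K) (hKU : K ⊆ U)
    (hF : ContDiffOn ℝ 1 F U) (h0 : ∀ x, x ∉ K → F x = 0) (k : Fin n) :
    Integrable (pd k F) ∧ ∫ x, pd k F x = 0 := by
  have h1 : ContDiff ℝ 1 F := contDiff_of_vanish (m := 1) hU hK hKU hF h0
  have hc : HasCompactSupport F := HasCompactSupport.intro hK (fun x hx => h0 x hx)
  obtain ⟨C, hC⟩ := h1.lipschitzWith_of_hasCompactSupport hc (by simp)
  exact integral_pd_lip hC hc k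

/-- The divergence-form operator `∑ᵢⱼ ∂ᵢ (aⁱʲ ∂ⱼ u)`. -/
def Pop {n : ℕ} (a : Fin n → Fin n → EuclideanSpace ℝ (Fin n) → ℝ)
    (u : EuclideanSpace ℝ (Fin n) → ℝ) (x : EuclideanSpace ℝ (Fin n)) : ℝ :=
  ∑ i, ∑ j, pd i (fun y => a i j y * pd j u y) x

/-- The vector field used in the Carleman identity. -/
def CF {n : ℕ} (τ : ℝ) (a : Fin n → Fin n → EuclideanSpace ℝ (Fin n) → ℝ)
    (X : Fin n → EuclideanSpace ℝ (Fin n) → ℝ) (G b v : EuclideanSpace ℝ (Fin n) → ℝ)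
    (k : Fin n) (y : EuclideanSpace ℝ (Fin n)) : ℝ :=
  τ * (2 * ((∑ i, X i y * pd i v y) * (∑ j, a k j y * pd j v y))
    - X k y * ∑ i, pd i v y * ∑ j, a i j y * pd j v y)
  + τ ^ 3 * (G y * X k y * (v y * v y)) + τ * (b y * v y * ∑ j, a k j y * pd j v y)

lemma num_identity {n : ℕ} (τ G b v : ℝ) (a : Fin n → Fin n → ℝ) (da : Fin n → Fin n → Fin n → ℝ)
    (X : Fin n → ℝ) (dX : Fin n → Fin n → ℝ) (dG db v1 : Fin n → ℝ) (H : Fin n → Fin n → ℝ)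
    (hsym : ∀ i j, a i j = a j i) (hH : ∀ i j, H i j = H j i) :
    ∑ k, (τ * (2 * ((∑ i, (dX i k * v1 i + X i * H i k)) * (∑ j, a k j * v1 j)
        + (∑ i, X i * v1 i) * ∑ j, (da k j k * v1 j + a k j * H j k))
      - (dX k k * (∑ i, v1 i * ∑ j, a i j * v1 j) + X k * ∑ i, (H i k * (∑ j, a i j * v1 j)
        + v1 i * ∑ j, (da i j k * v1 j + a i j * H j k))))
      + τ ^ 3 * ((dG k * X k + G * dX k k) * (v * v) + G * X k * (v1 k * v + v * v1 k))
      + τ * ((db k * v + b * v1 k) * (∑ j, a k j * v1 j)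
         + b * v * ∑ j, (da k j k * v1 j + a k j * H j k)))
    = -(((∑ k, ∑ j, (da k j k * v1 j + a k j * H j k)) + τ ^ 2 * G * v) *
        (-2 * τ * (∑ i, X i * v1 i) - τ * b * v))
      + τ * (2 * (∑ k, (∑ i, dX i k * v1 i) * (∑ j, a k j * v1 j))
        - (∑ k, X k * ∑ i, v1 i * ∑ j, da i j k * v1 j)
        + (b - ∑ k, dX k k) * (∑ i, v1 i * ∑ j, a i j * v1 j))
      + τ ^ 3 * (G * (∑ k, dX k k) + (∑ k, X k * dG k) - G * b) * v ^ 2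
      + τ * v * ∑ k, db k * ∑ j, a k j * v1 j := by
  set p : Fin n → ℝ := fun k => ∑ j, a k j * v1 j with hp
  set W : ℝ := ∑ i, v1 i * p i with hW
  set Pk : Fin n → ℝ := fun k => ∑ j, (da k j k * v1 j + a k j * H j k) with hPk
  set Xv : ℝ := ∑ i, X i * v1 i with hXv
  have hD : ∀ k, ∑ i, (H i k * p i + v1 i * ∑ j, (da i j k * v1 j + a i j * H j k))
      = (∑ i, v1 i * ∑ j, da i j k * v1 j) + 2 * ∑ i, H i k * p i := by
    intro k
    have e1 : ∑ i, v1 i * ∑ j, a i j * H j k = ∑ i, H i k * p i := by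
      simp only [hp, Finset.mul_sum]
      rw [Finset.sum_comm]
      refine Finset.sum_congr rfl fun i _ => Finset.sum_congr rfl fun j _ => ?_
      rw [hsym j i]; ring
    simp only [Finset.sum_add_distrib, mul_add]
    rw [e1]; ring
  have hS : ∀ k, ∑ i, (dX i k * v1 i + X i * H i k)
      = (∑ i, dX i k * v1 i) + ∑ i, X i * H i k := fun k => Finset.sum_add_distrib
  have hswap : ∑ k, X k * ∑ i, H i k * p i = ∑ k, (∑ i, X i * H i k) * p k := by
    simp only [Finset.mul_sum, Finset.sum_mul]
    rw [Finset.sum_comm]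
    refine Finset.sum_congr rfl fun i _ => Finset.sum_congr rfl fun j _ => ?_
    rw [hH i j]; ring
  have hterm : ∀ k, (τ * (2 * ((∑ i, (dX i k * v1 i + X i * H i k)) * p k
        + Xv * Pk k)
      - (dX k k * W + X k * ∑ i, (H i k * p i
        + v1 i * ∑ j, (da i j k * v1 j + a i j * H j k))))
      + τ ^ 3 * ((dG k * X k + G * dX k k) * (v * v) + G * X k * (v1 k * v + v * v1 k))
      + τ * ((db k * v + b * v1 k) * p k
         + b * v * Pk k)) =
      (2 * τ) * ((∑ i, dX i k * v1 i) * p k) + (2 * τ) * ((∑ i, X i * H i k) * p k)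
      + (2 * τ * Xv) * Pk k - (τ * W) * dX k k - τ * (X k * ∑ i, v1 i * ∑ j, da i j k * v1 j)
      - (2 * τ) * (X k * ∑ i, H i k * p i)
      + (τ ^ 3 * v ^ 2) * (X k * dG k) + (τ ^ 3 * G * v ^ 2) * dX k k
      + (2 * τ ^ 3 * G * v) * (X k * v1 k) + (τ * v) * (db k * p k) + (τ * b) * (v1 k * p k)
      + (τ * b * v) * Pk k := by
    intro k
    rw [hD, hS]; ring
  rw [Finset.sum_congr rfl fun k _ => hterm k]
  simp only [Finset.sum_add_distrib, Finset.sum_sub_distrib, ← Finset.mul_sum]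
  rw [hswap]
  rw [← hXv, ← hW]
  ring

lemma CF_div {n : ℕ} (τ : ℝ) {a : Fin n → Fin n → EuclideanSpace ℝ (Fin n) → ℝ}
    {X : Fin n → EuclideanSpace ℝ (Fin n) → ℝ} {G b v : EuclideanSpace ℝ (Fin n) → ℝ}
    {x : EuclideanSpace ℝ (Fin n)}
    {da : Fin n → Fin n → Fin n → ℝ} {dX : Fin n → Fin n → ℝ} {dG db : Fin n → ℝ}
    {H : Fin n → Fin n → ℝ}
    (ha : ∀ i j, HG (a i j) (da i j) x) (hX : ∀ i, HG (X i) (dX i) x) (hG : HG G dG x)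
    (hb : HG b db x) (hv : DifferentiableAt ℝ v x) (hv2 : ∀ j, HG (pd j v) (H j) x)
    (hsym : ∀ i j, a i j x = a j i x) (hH : ∀ i j, H i j = H j i) :
    ∑ k, pd k (CF τ a X G b v k) x
    = -((Pop a v x + τ ^ 2 * G x * v x) *
        (-2 * τ * (∑ i, X i x * pd i v x) - τ * b x * v x))
      + τ * (2 * (∑ k, (∑ i, dX i k * pd i v x) * (∑ j, a k j x * pd j v x))
        - (∑ k, X k x * ∑ i, pd i v x * ∑ j, da i j k * pd j v x)
        + (b x - ∑ k, dX k k) * (∑ i, pd i v x * ∑ j, a i j x * pd j v x))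
      + τ ^ 3 * (G x * (∑ k, dX k k) + (∑ k, X k x * dG k) - G x * b x) * (v x) ^ 2
      + τ * v x * ∑ k, db k * ∑ j, a k j x * pd j v x := by
  have hP : Pop a v x = ∑ k, ∑ j, (da k j k * pd j v x + a k j x * H j k) := by
    unfold Pop
    refine Finset.sum_congr rfl fun i _ => Finset.sum_congr rfl fun j _ => ?_
    exact ((ha i j).mul (hv2 j)).pd_eq i
  rw [hP, ← num_identity τ (G x) (b x) (v x) (fun i j => a i j x) da (fun i => X i x) dX dG db
    (fun k => pd k v x) H hsym hH]
  refine Finset.sum_congr rfl fun k _ => ?_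
  have hp : ∀ k, HG (fun y => ∑ j, a k j y * pd j v y) _ x := fun k =>
    HG.sum Finset.univ (fun j => (ha k j).mul (hv2 j))
  have hXv : HG (fun y => ∑ i, X i y * pd i v y) _ x :=
    HG.sum Finset.univ (fun i => (hX i).mul (hv2 i))
  have hW : HG (fun y => ∑ i, pd i v y * ∑ j, a i j y * pd j v y) _ x :=
    HG.sum Finset.univ (fun i => (hv2 i).mul (hp i))
  have hv1 := HG.of_diff hv
  have key := ((((hXv.mul (hp k)).cmul 2).sub ((hX k).mul hW)).cmul τ).add
    (((hG.mul (hX k)).mul (hv1.mul hv1)).cmul (τ ^ 3)) |>.add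
    (((hb.mul hv1).mul (hp k)).cmul τ)
  exact key.pd_eq k

set_option maxHeartbeats 1600000 in
lemma scalar_ineq (C g0 w0 : ℝ) (hC : 0 < C) (hg0 : 0 < g0) (hw0 : 0 < w0) :
    ∃ L : ℝ, 1 ≤ L ∧ ∀ φm : ℝ, 0 < φm → ∃ τ0 : ℝ, 1 ≤ τ0 ∧ ∃ c > 0, ∀ τ φ g W R1 R2 B dY N Yv v : ℝ,
      τ0 ≤ τ → φm ≤ φ → φ ≤ 1 → g0 ≤ g → g ≤ C → 0 ≤ N → w0 * N ^ 2 ≤ W → |R1| ≤ C * N ^ 2 →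
      |R2| ≤ C → |B| ≤ 2 * L ^ 2 * φ * (C * (1 + L)) * N → |dY| ≤ C →
      c * (τ * N ^ 2 + τ ^ 3 * v ^ 2) ≤
        4 * (τ * φ * (L ^ 2 * g * W + 2 * L ^ 2 * Yv ^ 2 + L * R1)
          + τ ^ 3 * φ ^ 3 * (L ^ 4 * g ^ 2 + L ^ 3 * R2) * v ^ 2 + τ * v * B)
        - 2 * τ ^ 2 * (L ^ 2 * φ * g - L * φ * dY) ^ 2 * v ^ 2 := by
  obtain ⟨L, hL1, hL2, hL3⟩ : ∃ L : ℝ, 1 ≤ L ∧ 2 * C ≤ L * (g0 * w0) ∧ 2 * C ≤ L * g0 ^ 2 := by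
    refine ⟨max 1 (max (2 * C / (g0 * w0)) (2 * C / g0 ^ 2)), le_max_left _ _, ?_, ?_⟩
    · rw [← div_le_iff₀ (by positivity)]
      exact (le_max_left _ _).trans (le_max_right _ _)
    · rw [← div_le_iff₀ (by positivity)]
      exact (le_max_right _ _).trans (le_max_right _ _)
  refine ⟨L, hL1, fun φm hφm => ?_⟩
  have hL : 0 < L := by linarith
  obtain ⟨α, hα⟩ : ∃ z : ℝ, z = 2 * φm * L ^ 2 * g0 * w0 := ⟨_, rfl⟩
  obtain ⟨γ, hγ⟩ : ∃ z : ℝ, z = 2 * φm ^ 3 * L ^ 4 * g0 ^ 2 := ⟨_, rfl⟩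
  obtain ⟨D1, hD1⟩ : ∃ z : ℝ, z = 8 * L ^ 2 * (C * (1 + L)) := ⟨_, rfl⟩
  obtain ⟨D2, hD2⟩ : ∃ z : ℝ, z = 2 * (L ^ 2 * C + L * C) ^ 2 := ⟨_, rfl⟩
  have hα0 : 0 < α := by rw [hα]; positivity
  have hγ0 : 0 < γ := by rw [hγ]; positivity
  have hD10 : 0 < D1 := by rw [hD1]; positivity
  have hD20 : 0 < D2 := by rw [hD2]; positivity
  refine ⟨max 1 (2 / γ * (D1 ^ 2 / (2 * α) + D2)), le_max_left _ _, min α γ / 2,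
    by positivity, ?_⟩
  intro τ φ g W R1 R2 B dY N Yv v hτ hφ hφ1 hg hgC hN hW hR1 hR2 hB hdY
  have hτ1 : 1 ≤ τ := (le_max_left _ _).trans hτ
  have hτ2 : D1 ^ 2 / (2 * α) + D2 ≤ γ / 2 * τ := by
    have := (le_max_right _ _).trans hτ
    calc D1 ^ 2 / (2 * α) + D2 = γ / 2 * (2 / γ * (D1 ^ 2 / (2 * α) + D2)) := by field_simp
      _ ≤ _ := by gcongr
  have hφ0 : 0 < φ := by linarith
  have hgp : 0 < g := by linarith
  have hτ0 : 0 < τ := by linarith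
  -- first block
  have h1 : (L ^ 2 * g0 * w0 / 2) * N ^ 2 ≤ L ^ 2 * g * W + 2 * L ^ 2 * Yv ^ 2 + L * R1 := by
    have a1 : L ^ 2 * g0 * (w0 * N ^ 2) ≤ L ^ 2 * g * W := by
      have : 0 ≤ w0 * N ^ 2 := by positivity
      gcongr
    have a2 : -(C * N ^ 2) ≤ R1 := (abs_le.1 hR1).1
    have a3 : 0 ≤ 2 * L ^ 2 * Yv ^ 2 := by positivity
    have a4 : L * (2 * C) * N ^ 2 ≤ L * (L * (g0 * w0)) * N ^ 2 := by gcongr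
    have a5 : L * (-(C * N ^ 2)) ≤ L * R1 := by gcongr
    linarith
  have h2 : L ^ 4 * g0 ^ 2 / 2 ≤ L ^ 4 * g ^ 2 + L ^ 3 * R2 := by
    have a1 : L ^ 4 * g0 ^ 2 ≤ L ^ 4 * g ^ 2 := by gcongr
    have a2 : -C ≤ R2 := (abs_le.1 hR2).1
    have a3 : L ^ 3 * (-C) ≤ L ^ 3 * R2 := by gcongr
    have a4 : L ^ 3 * (2 * C) ≤ L ^ 3 * (L * g0 ^ 2) := by gcongr
    linarith
  have h3 : α * τ * N ^ 2 ≤ 4 * (τ * φ * (L ^ 2 * g * W + 2 * L ^ 2 * Yv ^ 2 + L * R1)) := by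
    calc α * τ * N ^ 2 = 4 * (τ * φm * ((L ^ 2 * g0 * w0 / 2) * N ^ 2)) := by rw [hα]; ring
      _ ≤ 4 * (τ * φ * ((L ^ 2 * g0 * w0 / 2) * N ^ 2)) := by gcongr
      _ ≤ _ := by gcongr
  have h4 : γ * τ ^ 3 * v ^ 2 ≤ 4 * (τ ^ 3 * φ ^ 3 * (L ^ 4 * g ^ 2 + L ^ 3 * R2) * v ^ 2) := by
    calc γ * τ ^ 3 * v ^ 2 = 4 * (τ ^ 3 * φm ^ 3 * (L ^ 4 * g0 ^ 2 / 2) * v ^ 2) := by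
          rw [hγ]; ring
      _ ≤ 4 * (τ ^ 3 * φ ^ 3 * (L ^ 4 * g0 ^ 2 / 2) * v ^ 2) := by gcongr
      _ ≤ _ := by gcongr
  have h5 : -(τ * D1 * |v| * N) ≤ 4 * (τ * v * B) := by
    have b1 : |B| ≤ 2 * L ^ 2 * 1 * (C * (1 + L)) * N := by
      refine hB.trans ?_
      gcongr
    have b2 : |4 * (τ * v * B)| ≤ τ * D1 * |v| * N := by
      rw [abs_mul, abs_mul, abs_mul, abs_of_pos hτ0, abs_of_pos (by norm_num : (0:ℝ) < 4)]
      calc 4 * (τ * |v| * |B|) ≤ 4 * (τ * |v| * (2 * L ^ 2 * 1 * (C * (1 + L)) * N)) := by gcongr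
        _ = _ := by rw [hD1]; ring
    exact (abs_le.1 b2).1
  have h6 : 2 * τ ^ 2 * (L ^ 2 * φ * g - L * φ * dY) ^ 2 * v ^ 2 ≤ D2 * τ ^ 2 * v ^ 2 := by
    have c1 : |L ^ 2 * φ * g - L * φ * dY| ≤ L ^ 2 * C + L * C := by
      refine (abs_sub _ _).trans ?_
      have : |L ^ 2 * φ * g| ≤ L ^ 2 * C := by
        rw [abs_of_pos (by positivity)]
        calc L ^ 2 * φ * g ≤ L ^ 2 * 1 * C := by gcongr
          _ = _ := by ring
      have : |L * φ * dY| ≤ L * C := by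
        rw [abs_mul, abs_of_pos (by positivity)]
        calc L * φ * |dY| ≤ L * 1 * C := by gcongr
          _ = _ := by ring
      linarith
    have c2 : (L ^ 2 * φ * g - L * φ * dY) ^ 2 ≤ (L ^ 2 * C + L * C) ^ 2 := by
      rw [← sq_abs]; gcongr
    calc _ ≤ 2 * τ ^ 2 * (L ^ 2 * C + L * C) ^ 2 * v ^ 2 := by gcongr
      _ = _ := by rw [hD2]; ring
  have h7 : D1 * |v| * N ≤ α / 2 * N ^ 2 + D1 ^ 2 / (2 * α) * v ^ 2 := by
    have : 0 ≤ (α * N - D1 * |v|) ^ 2 / (2 * α) := by positivity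
    have e : (α * N - D1 * |v|) ^ 2 / (2 * α)
      = α / 2 * N ^ 2 + D1 ^ 2 / (2 * α) * v ^ 2 - D1 * |v| * N := by
      rw [← sq_abs v]; field_simp; ring
    linarith
  have h8 : τ * (D1 ^ 2 / (2 * α) * v ^ 2) + D2 * τ ^ 2 * v ^ 2 ≤ γ / 2 * τ ^ 3 * v ^ 2 := by
    have d1 : τ * (D1 ^ 2 / (2 * α)) ≤ τ ^ 2 * (D1 ^ 2 / (2 * α)) := by
      have : τ ≤ τ ^ 2 := by nlinarith
      gcongr
    have d2 : τ ^ 2 * (D1 ^ 2 / (2 * α) + D2) ≤ τ ^ 2 * (γ / 2 * τ) := by gcongr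
    have d3 : (τ * (D1 ^ 2 / (2 * α)) + D2 * τ ^ 2) * v ^ 2 ≤ (γ / 2 * τ ^ 3) * v ^ 2 := by
      gcongr
      linarith
    linarith
  have h9 : min α γ / 2 * (τ * N ^ 2 + τ ^ 3 * v ^ 2)
      ≤ α / 2 * (τ * N ^ 2) + γ / 2 * (τ ^ 3 * v ^ 2) := by
    have e1 : min α γ / 2 * (τ * N ^ 2) ≤ α / 2 * (τ * N ^ 2) := by
      gcongr; exact min_le_left _ _
    have e2 : min α γ / 2 * (τ ^ 3 * v ^ 2) ≤ γ / 2 * (τ ^ 3 * v ^ 2) := by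
      gcongr; exact min_le_right _ _
    linarith
  have h10 : τ * (D1 * |v| * N) ≤ τ * (α / 2 * N ^ 2 + D1 ^ 2 / (2 * α) * v ^ 2) := by gcongr
  linarith

lemma abs_sum_bd {n : ℕ} {f : Fin n → ℝ} {c : ℝ} (h : ∀ i, |f i| ≤ c) : |∑ i, f i| ≤ n * c := by
  refine (Finset.abs_sum_le_sum_abs _ _).trans ?_
  refine (Finset.sum_le_sum (fun i _ => h i)).trans ?_
  simp

lemma abs_mul_bd {x y c d : ℝ} (h : |x| ≤ c) (h' : |y| ≤ d) : |x * y| ≤ c * d := by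
  rw [abs_mul]
  exact mul_le_mul h h' (abs_nonneg _) ((abs_nonneg _).trans h)

lemma abs_add_bd {x y c d : ℝ} (h : |x| ≤ c) (h' : |y| ≤ d) : |x + y| ≤ c + d :=
  (abs_add_le _ _).trans (add_le_add h h')

lemma abs_sub_bd {x y c d : ℝ} (h : |x| ≤ c) (h' : |y| ≤ d) : |x - y| ≤ c + d :=
  (abs_sub _ _).trans (add_le_add h h')

/-- Explicit quantities appearing in the Carleman computation. -/
def nY {n : ℕ} (a : Fin n → Fin n → ℝ) (d : Fin n → ℝ) (i : Fin n) : ℝ := -∑ j, a i j * d j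
def ndY {n : ℕ} (a : Fin n → Fin n → ℝ) (da : Fin n → Fin n → Fin n → ℝ) (d : Fin n → ℝ)
    (i k : Fin n) : ℝ := -((∑ j, da i j k * d j) + a i k)
def ng {n : ℕ} (a : Fin n → Fin n → ℝ) (d : Fin n → ℝ) : ℝ := ∑ i, d i * ∑ j, a i j * d j
def ndg {n : ℕ} (a : Fin n → Fin n → ℝ) (da : Fin n → Fin n → Fin n → ℝ) (d : Fin n → ℝ)
    (k : Fin n) : ℝ := (∑ i, d i * ∑ j, da i j k * d j) + 2 * ∑ j, a k j * d j
def nR1 {n : ℕ} (a : Fin n → Fin n → ℝ) (da : Fin n → Fin n → Fin n → ℝ) (d v1 : Fin n → ℝ) : ℝ :=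
  2 * (∑ k, (∑ i, ndY a da d i k * v1 i) * (∑ j, a k j * v1 j))
    - (∑ k, nY a d k * ∑ i, v1 i * ∑ j, da i j k * v1 j)
    - (∑ k, ndY a da d k k) * (∑ i, v1 i * ∑ j, a i j * v1 j)
def nR2 {n : ℕ} (a : Fin n → Fin n → ℝ) (da : Fin n → Fin n → Fin n → ℝ) (d : Fin n → ℝ) : ℝ :=
  ng a d * (∑ k, ndY a da d k k) + ∑ k, nY a d k * ndg a da d k

lemma num_bounds (n : ℕ) (Λ : ℝ) (hΛ : 0 < Λ) : ∃ C > 0, ∀ (a : Fin n → Fin n → ℝ)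
    (da : Fin n → Fin n → Fin n → ℝ) (d v1 : Fin n → ℝ) (N : ℝ), 0 ≤ N → (∀ i j, |a i j| ≤ Λ) →
    (∀ i j k, |da i j k| ≤ Λ) → (∀ i, |d i| ≤ Λ) → (∀ i, |v1 i| ≤ N) →
    |nR1 a da d v1| ≤ C * N ^ 2 ∧ |nR2 a da d| ≤ C ∧ |∑ k, ndY a da d k k| ≤ C ∧ |ng a d| ≤ C ∧
    (∀ L, 0 ≤ L → |∑ k, (ndg a da d k - L * d k * ng a d) * ∑ j, a k j * v1 j| 
      ≤ C * (1 + L) * N) := by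
  set m : ℝ := (n : ℝ)
  set bY := m * (Λ * Λ)
  set bdY := m * (Λ * Λ) + Λ
  set bg := m * (Λ * (m * (Λ * Λ)))
  set bdg := m * (Λ * (m * (Λ * Λ))) + 2 * (m * (Λ * Λ))
  set c1 := 2 * (m * ((m * bdY) * (m * Λ))) + m * (bY * (m * (m * Λ))) + (m * bdY) * (m * (m * Λ))
  set c2 := bg * (m * bdY) + m * (bY * bdg)
  set c5 := m * ((bdg + Λ * bg) * (m * Λ))
  have hm : 0 ≤ m := by positivity
  refine ⟨1 + c1 + c2 + m * bdY + bg + c5, by positivity, ?_⟩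
  intro a da d v1 N hN ha hda hd hv
  have hpY : ∀ i, |nY a d i| ≤ bY := fun i => by
    unfold nY; rw [abs_neg]; exact abs_sum_bd fun j => abs_mul_bd (ha i j) (hd j)
  have hpdY : ∀ i k, |ndY a da d i k| ≤ bdY := fun i k => by
    unfold ndY; rw [abs_neg]
    exact abs_add_bd (abs_sum_bd fun j => abs_mul_bd (hda i j k) (hd j)) (ha i k)
  have hpg : |ng a d| ≤ bg :=
    abs_sum_bd fun i => abs_mul_bd (hd i) (abs_sum_bd fun j => abs_mul_bd (ha i j) (hd j))
  have h2 : |(2:ℝ)| ≤ 2 := by norm_num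
  have hpdg : ∀ k, |ndg a da d k| ≤ bdg := fun k =>
    abs_add_bd (abs_sum_bd fun i => abs_mul_bd (hd i) (abs_sum_bd fun j =>
      abs_mul_bd (hda i j k) (hd j))) (abs_mul_bd h2 (abs_sum_bd fun j =>
      abs_mul_bd (ha k j) (hd j)))
  have hp : ∀ k, |∑ j, a k j * v1 j| ≤ m * (Λ * N) := fun k =>
    abs_sum_bd fun j => abs_mul_bd (ha k j) (hv j)
  have hdiv : |∑ k, ndY a da d k k| ≤ m * bdY := abs_sum_bd fun k => hpdY k k
  have q1 : |nR1 a da d v1| ≤ c1 * N ^ 2 := by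
    have := abs_sub_bd (abs_sub_bd (abs_mul_bd h2 (abs_sum_bd fun k =>
      abs_mul_bd (abs_sum_bd fun i => abs_mul_bd (hpdY i k) (hv i)) (hp k)))
      (abs_sum_bd fun k => abs_mul_bd (hpY k) (abs_sum_bd fun i => abs_mul_bd (hv i)
        (abs_sum_bd fun j => abs_mul_bd (hda i j k) (hv j)))))
      (abs_mul_bd hdiv (abs_sum_bd fun i => abs_mul_bd (hv i) (hp i)))
    refine this.trans (le_of_eq ?_)
    simp only [c1]; ring
  have q2 : |nR2 a da d| ≤ c2 := abs_add_bd (abs_mul_bd hpg hdiv)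
    (abs_sum_bd fun k => abs_mul_bd (hpY k) (hpdg k))
  have z1 : 0 ≤ c1 := by positivity
  have z2 : 0 ≤ c2 := by positivity
  have z3 : 0 ≤ m * bdY := by positivity
  have z4 : 0 ≤ bg := by positivity
  have z5 : 0 ≤ c5 := by positivity
  refine ⟨q1.trans ?_, q2.trans ?_, hdiv.trans ?_, hpg.trans ?_, fun L hL => ?_⟩
  · gcongr; linarith
  · linarith
  · linarith
  · linarith
  · have := abs_sum_bd fun k => abs_mul_bd (abs_sub_bd (hpdg k) (abs_mul_bd (abs_mul_bd (le_of_eq (abs_of_nonneg hL)) (hd k)) hpg)) (hp k)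
    refine this.trans ?_
    calc m * ((bdg + L * Λ * bg) * (m * (Λ * N))) ≤ 
          m * (((1 + L) * (bdg + Λ * bg)) * (m * (Λ * N))) := by
          gcongr
          have : 0 ≤ bdg := by positivity
          have : 0 ≤ Λ * bg := by positivity
          nlinarith
      _ = c5 * (1 + L) * N := by simp only [c5]; ring
      _ ≤ _ := by gcongr; linarith

lemma num_Q {n : ℕ} (τ L φ v : ℝ) (a : Fin n → Fin n → ℝ) (da : Fin n → Fin n → Fin n → ℝ)
    (d v1 : Fin n → ℝ) (hsym : ∀ i j, a i j = a j i) :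
    τ * (2 * (∑ k, (∑ i, (L * φ * ndY a da d i k - L ^ 2 * φ * d k * nY a d i) * v1 i)
          * (∑ j, a k j * v1 j))
        - (∑ k, (L * φ * nY a d k) * ∑ i, v1 i * ∑ j, da i j k * v1 j)
        + (2 * L ^ 2 * φ * ng a d - ∑ k, (L * φ * ndY a da d k k - L ^ 2 * φ * d k * nY a d k))
          * (∑ i, v1 i * ∑ j, a i j * v1 j))
      + τ ^ 3 * (L ^ 2 * φ ^ 2 * ng a d *
          (∑ k, (L * φ * ndY a da d k k - L ^ 2 * φ * d k * nY a d k))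
        + (∑ k, (L * φ * nY a d k) * (L ^ 2 * φ ^ 2 * ndg a da d k
            - 2 * L ^ 3 * φ ^ 2 * d k * ng a d))
        - L ^ 2 * φ ^ 2 * ng a d * (2 * L ^ 2 * φ * ng a d)) * v ^ 2
      + τ * v * ∑ k, (2 * L ^ 2 * φ * (ndg a da d k - L * d k * ng a d)) * ∑ j, a k j * v1 j
    = (τ * φ * (L ^ 2 * ng a d * (∑ i, v1 i * ∑ j, a i j * v1 j)
        + 2 * L ^ 2 * (∑ i, nY a d i * v1 i) ^ 2 + L * nR1 a da d v1)
          + τ ^ 3 * φ ^ 3 * (L ^ 4 * (ng a d) ^ 2 + L ^ 3 * nR2 a da d) * v ^ 2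
          + τ * v * (2 * L ^ 2 * φ *
            ∑ k, (ndg a da d k - L * d k * ng a d) * ∑ j, a k j * v1 j)) := by
  set p : Fin n → ℝ := fun k => ∑ j, a k j * v1 j with hp
  have e1 : ∑ k, d k * p k = -∑ i, nY a d i * v1 i := by
    simp only [hp, nY, Finset.mul_sum, neg_mul, Finset.sum_neg_distrib, neg_neg, Finset.sum_mul]
    rw [Finset.sum_comm]
    refine Finset.sum_congr rfl fun i _ => Finset.sum_congr rfl fun j _ => ?_
    rw [hsym j i]; ring
  have e2 : ∑ k, d k * nY a d k = -ng a d := by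
    simp only [nY, ng, mul_neg, Finset.sum_neg_distrib]
  have e3 : ∑ k, (L * φ * ndY a da d k k - L ^ 2 * φ * d k * nY a d k)
      = L * φ * (∑ k, ndY a da d k k) + L ^ 2 * φ * ng a d := by
    rw [Finset.sum_sub_distrib, ← Finset.mul_sum]
    simp only [mul_assoc]
    simp only [← Finset.mul_sum]
    rw [e2]; ring
  have e4 : ∑ k, (∑ i, (L * φ * ndY a da d i k - L ^ 2 * φ * d k * nY a d i) * v1 i) * p k
      = L * φ * (∑ k, (∑ i, ndY a da d i k * v1 i) * p k)
        + L ^ 2 * φ * (∑ i, nY a d i * v1 i) ^ 2 := by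
    have : ∀ k, (∑ i, (L * φ * ndY a da d i k - L ^ 2 * φ * d k * nY a d i) * v1 i) * p k
      = L * φ * ((∑ i, ndY a da d i k * v1 i) * p k)
        - L ^ 2 * φ * (∑ i, nY a d i * v1 i) * (d k * p k) := by
      intro k
      have : ∑ i, (L * φ * ndY a da d i k - L ^ 2 * φ * d k * nY a d i) * v1 i
        = L * φ * (∑ i, ndY a da d i k * v1 i) - L ^ 2 * φ * d k * (∑ i, nY a d i * v1 i) := by
        rw [Finset.mul_sum, Finset.mul_sum, ← Finset.sum_sub_distrib]
        exact Finset.sum_congr rfl fun i _ => by ring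
      rw [this]; ring
    rw [Finset.sum_congr rfl fun k _ => this k, Finset.sum_sub_distrib, ← Finset.mul_sum,
      ← Finset.mul_sum, e1]; ring
  have e5 : ∑ k, (L * φ * nY a d k) * ∑ i, v1 i * ∑ j, da i j k * v1 j
      = L * φ * ∑ k, nY a d k * ∑ i, v1 i * ∑ j, da i j k * v1 j := by
    rw [Finset.mul_sum]; exact Finset.sum_congr rfl fun i _ => by ring
  have e6 : ∑ k, (L * φ * nY a d k) * (L ^ 2 * φ ^ 2 * ndg a da d k
            - 2 * L ^ 3 * φ ^ 2 * d k * ng a d)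
      = L ^ 3 * φ ^ 3 * (∑ k, nY a d k * ndg a da d k) + 2 * L ^ 4 * φ ^ 3 * (ng a d) ^ 2 := by
    have : ∀ k, (L * φ * nY a d k) * (L ^ 2 * φ ^ 2 * ndg a da d k
            - 2 * L ^ 3 * φ ^ 2 * d k * ng a d) = L ^ 3 * φ ^ 3 * (nY a d k * ndg a da d k)
            - 2 * L ^ 4 * φ ^ 3 * ng a d * (d k * nY a d k) := fun k => by ring
    rw [Finset.sum_congr rfl fun k _ => this k, Finset.sum_sub_distrib, ← Finset.mul_sum,
      ← Finset.mul_sum, e2]; ring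
  have e7 : ∑ k, (2 * L ^ 2 * φ * (ndg a da d k - L * d k * ng a d)) * p k
    = 2 * L ^ 2 * φ * ∑ k, (ndg a da d k - L * d k * ng a d) * p k := by
    rw [Finset.mul_sum]; exact Finset.sum_congr rfl fun i _ => by ring
  rw [e3, e4, e5, e6, e7]
  simp only [nR1, nR2]
  ring

section weights
variable {n : ℕ} (L : ℝ) (a : Fin n → Fin n → EuclideanSpace ℝ (Fin n) → ℝ)
  (y : EuclideanSpace ℝ (Fin n))

/-- Carleman weight. -/
def cphi (x : EuclideanSpace ℝ (Fin n)) : ℝ :=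
  Real.exp (-(L / 2) * ∑ i, (x i - y i) * (x i - y i))
def cY (i : Fin n) (x : EuclideanSpace ℝ (Fin n)) : ℝ := -∑ j, a i j x * (x j - y j)
def cg (x : EuclideanSpace ℝ (Fin n)) : ℝ := ∑ i, (x i - y i) * ∑ j, a i j x * (x j - y j)
def cX (i : Fin n) (x : EuclideanSpace ℝ (Fin n)) : ℝ := L * (cphi L y x * cY a y i x)
def cG (x : EuclideanSpace ℝ (Fin n)) : ℝ := L ^ 2 * ((cphi L y x * cphi L y x) * cg a y x)
def cb (x : EuclideanSpace ℝ (Fin n)) : ℝ := 2 * L ^ 2 * (cphi L y x * cg a y x)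

variable {L a y}
variable {x : EuclideanSpace ℝ (Fin n)} {da : Fin n → Fin n → Fin n → ℝ}

lemma HG_cphi : HG (cphi L y) (fun k => -L * cphi L y x * (x k - y k)) x := by
  have h := HG.sum (x := x) Finset.univ (fun i => (HG.coord (x := x) i (y i)).mul (HG.coord (x := x) i (y i)))
  have h2 := HG.comp (Real.hasDerivAt_exp _) (h.cmul (-(L / 2)))
  refine HG.congr_grad (f := cphi L y) h2 fun k => ?_
  simp only [cphi, ite_mul, one_mul, zero_mul, mul_ite, mul_one, mul_zero, Finset.sum_add_distrib,
    Finset.sum_ite_eq, Finset.mem_univ, if_true]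
  ring

lemma HG_cY (ha : ∀ i j, HG (a i j) (da i j) x) (i : Fin n) :
    HG (cY a y i) (fun k => ndY (fun i j => a i j x) da (fun i => x i - y i) i k) x := by
  have h := (HG.sum (x := x) Finset.univ (fun j => (ha i j).mul (HG.coord j (y j)))).cmul (-1)
  have h2 : HG (cY a y i) _ x := h.congr_fun (Filter.Eventually.of_forall fun z => by
    simp [cY])
  refine h2.congr_grad fun k => ?_
  simp [ndY, Finset.sum_add_distrib]

lemma HG_cg (ha : ∀ i j, HG (a i j) (da i j) x) (hsym : ∀ i j, a i j x = a j i x) :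
    HG (cg a y) (fun k => ndg (fun i j => a i j x) da (fun i => x i - y i) k) x := by
  have h := HG.sum (x := x) Finset.univ (fun i => (HG.coord (x := x) i (y i)).mul
    (HG.sum (x := x) Finset.univ (fun j => (ha i j).mul (HG.coord j (y j)))))
  refine HG.congr_grad (f := cg a y) h fun k => ?_
  simp only [ndg, ite_mul, one_mul, zero_mul, mul_ite, mul_one, mul_zero, Finset.sum_add_distrib,
    Finset.sum_ite_eq, Finset.mem_univ, if_true, mul_add]
  have : ∑ i, (x i - y i) * a i k x = ∑ j, a k j x * (x j - y j) :=
    Finset.sum_congr rfl fun i _ => by rw [hsym i k]; ring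
  rw [this]; ring

lemma HG_cX (ha : ∀ i j, HG (a i j) (da i j) x) (i : Fin n) :
    HG (cX L a y i) (fun k => L * cphi L y x * ndY (fun i j => a i j x) da (fun i => x i - y i) i k
      - L ^ 2 * cphi L y x * (x k - y k) * nY (fun i j => a i j x) (fun i => x i - y i) i) x := by
  refine HG.congr_grad (f := cX L a y i) ((HG_cphi.mul (HG_cY ha i)).cmul L) fun k => ?_
  simp only [cY, nY]; ring

lemma HG_cG (ha : ∀ i j, HG (a i j) (da i j) x) (hsym : ∀ i j, a i j x = a j i x) :
    HG (cG L a y) (fun k => L ^ 2 * (cphi L y x) ^ 2 *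
        ndg (fun i j => a i j x) da (fun i => x i - y i) k
      - 2 * L ^ 3 * (cphi L y x) ^ 2 * (x k - y k)
        * ng (fun i j => a i j x) (fun i => x i - y i)) x := by
  refine HG.congr_grad (f := cG L a y) (((HG_cphi.mul HG_cphi).mul (HG_cg ha hsym)).cmul (L ^ 2))
    fun k => ?_
  simp only [cg, ng]; ring

lemma HG_cb (ha : ∀ i j, HG (a i j) (da i j) x) (hsym : ∀ i j, a i j x = a j i x) :
    HG (cb L a y) (fun k => 2 * L ^ 2 * cphi L y x *
        (ndg (fun i j => a i j x) da (fun i => x i - y i) k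
      - L * (x k - y k) * ng (fun i j => a i j x) (fun i => x i - y i))) x := by
  refine HG.congr_grad (f := cb L a y) ((HG_cphi.mul (HG_cg ha hsym)).cmul (2 * L ^ 2))
    fun k => ?_
  simp only [cg, ng]; ring

end weights

set_option maxHeartbeats 1600000 in
/-- Pointwise Carleman inequality. -/
lemma carleman_pt (n : ℕ) (lam Λ : ℝ) (hlam : 0 < lam) (hΛ : 4 ≤ Λ) :
    ∃ L : ℝ, 1 ≤ L ∧ ∃ τ0 : ℝ, 1 ≤ τ0 ∧ ∃ c > 0,
    ∀ (a : Fin n → Fin n → EuclideanSpace ℝ (Fin n) → ℝ) (y x : EuclideanSpace ℝ (Fin n))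
      (v : EuclideanSpace ℝ (Fin n) → ℝ) (τ : ℝ), τ0 ≤ τ →
      (∀ i j, DifferentiableAt ℝ (a i j) x) → (∀ i j, a i j x = a j i x) →
      (∀ i j, |a i j x| ≤ Λ) → (∀ i j k, |pd k (a i j) x| ≤ Λ) →
      (∀ ξ : Fin n → ℝ, lam * ∑ i, ξ i ^ 2 ≤ ∑ i, ξ i * ∑ j, a i j x * ξ j) →
      1 / 4 ≤ ∑ i, (x i - y i) * (x i - y i) → ∑ i, (x i - y i) * (x i - y i) ≤ 16 →
      DifferentiableAt ℝ v x → (∀ j, DifferentiableAt ℝ (pd j v) x) →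
      (∀ i j, pd i (pd j v) x = pd j (pd i v) x) →
      c * (τ * (∑ i, (pd i v x) ^ 2) + τ ^ 3 * (v x) ^ 2) ≤
        2 * (Pop a v x - 2 * τ * (∑ i, cX L a y i x * pd i v x)
          - τ * (∑ k, pd k (cX L a y k) x) * v x + τ ^ 2 * cG L a y x * v x) ^ 2
        + 4 * ∑ k, pd k (CF τ a (cX L a y) (cG L a y) (cb L a y) v k) x := by
  obtain ⟨C, hC, hCb⟩ := num_bounds n Λ (by linarith)
  obtain ⟨L, hL, hL2⟩ := scalar_ineq C (lam / 4) lam hC (by positivity) hlam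
  obtain ⟨τ0, hτ0, c, hc, H⟩ := hL2 (Real.exp (-8 * L)) (Real.exp_pos _)
  refine ⟨L, hL, τ0, hτ0, c, hc, ?_⟩
  intro a y x v τ hτ hda hsym hab hdab hell hr1 hr2 hv hv2 hvs
  have ha : ∀ i j, HG (a i j) (fun k => pd k (a i j) x) x := fun i j => HG.of_diff (hda i j)
  set da : Fin n → Fin n → Fin n → ℝ := fun i j k => pd k (a i j) x with hdadef
  set a' : Fin n → Fin n → ℝ := fun i j => a i j x with ha'
  set d : Fin n → ℝ := fun i => x i - y i with hd
  set φ := cphi L y x with hφ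
  set v1 : Fin n → ℝ := fun i => pd i v x with hv1
  have hdiv := CF_div τ ha (HG_cX (L := L) (y := y) ha) (HG_cG (L := L) (y := y) ha hsym)
    (HG_cb (L := L) (y := y) ha hsym) hv (fun j => HG.of_diff (hv2 j)) hsym
    (fun i j => hvs j i)
  have hcX : ∀ i, cX L a y i x = L * φ * nY a' d i := fun i => by
    simp only [cX, cY, nY, hφ, ha', hd]; ring
  have hcG : cG L a y x = L ^ 2 * φ ^ 2 * ng a' d := by
    simp only [cG, cg, ng, hφ, ha', hd]; ring
  have hcb : cb L a y x = 2 * L ^ 2 * φ * ng a' d := by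
    simp only [cb, cg, ng, hφ, ha', hd]; ring
  have hQ := num_Q τ L φ (v x) a' da d v1 hsym
  have hpdX : ∀ k, pd k (cX L a y k) x = L * φ * ndY a' da d k k - L ^ 2 * φ * d k * nY a' d k :=
    fun k => (HG_cX ha k).pd_eq k
  have hsX : ∑ k, pd k (cX L a y k) x = L * φ * (∑ k, ndY a' da d k k) + L ^ 2 * φ * ng a' d := by
    rw [Finset.sum_congr rfl fun k _ => hpdX k, Finset.sum_sub_distrib, ← Finset.mul_sum]
    simp only [mul_assoc]
    simp only [← Finset.mul_sum, nY, ng, mul_neg, Finset.sum_neg_distrib]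
    ring
  set N := Real.sqrt (∑ i, v1 i ^ 2) with hN
  have hN2 : N ^ 2 = ∑ i, v1 i ^ 2 := Real.sq_sqrt (Finset.sum_nonneg fun i _ => sq_nonneg _)
  have hvN : ∀ i, |v1 i| ≤ N := fun i => by
    rw [← Real.sqrt_sq_eq_abs]
    exact Real.sqrt_le_sqrt (Finset.single_le_sum (f := fun i => v1 i ^ 2)
      (fun i _ => sq_nonneg _) (Finset.mem_univ i))
  have hdsum : ∑ i, d i ^ 2 = ∑ i, (x i - y i) * (x i - y i) :=
    Finset.sum_congr rfl fun i _ => by simp only [hd]; ring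
  have hdb : ∀ i, |d i| ≤ Λ := fun i => by
    have h1 : d i ^ 2 ≤ 16 := by
      refine le_trans (Finset.single_le_sum (f := fun i => d i ^ 2)
        (fun i _ => sq_nonneg _) (Finset.mem_univ i)) (by rw [hdsum]; exact hr2)
    exact (abs_le_of_sq_le_sq (by linarith : d i ^ 2 ≤ 4 ^ 2) (by norm_num)).trans hΛ |> fun h => h
  obtain ⟨b1, b2, b3, b4, b5⟩ := hCb a' da d v1 N (Real.sqrt_nonneg _) hab
    (fun i j k => hdab i j k) hdb hvN
  have hφ1 : φ ≤ 1 := by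
    simp only [hφ, cphi]
    rw [Real.exp_le_one_iff]
    nlinarith
  have hφm : Real.exp (-8 * L) ≤ φ := by
    simp only [hφ, cphi]
    rw [Real.exp_le_exp]
    nlinarith
  have hφ0 : 0 < φ := Real.exp_pos _
  have key := H τ φ (ng a' d) (∑ i, v1 i * ∑ j, a' i j * v1 j) (nR1 a' da d v1) (nR2 a' da d)
    (2 * L ^ 2 * φ * ∑ k, (ndg a' da d k - L * d k * ng a' d) * ∑ j, a' k j * v1 j)
    (∑ k, ndY a' da d k k) N (∑ i, nY a' d i * v1 i) (v x) hτ hφm hφ1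
    (by
      have := hell d
      rw [hdsum] at this
      refine le_trans ?_ this
      nlinarith) ((le_abs_self _).trans b4) (Real.sqrt_nonneg _)
    (by rw [hN2]; exact hell v1) b1 b2
    (by
      rw [abs_mul, abs_of_nonneg (by positivity : 0 ≤ 2 * L ^ 2 * φ)]
      have h5 := b5 L (by linarith)
      have h6 : 0 ≤ 2 * L ^ 2 * φ := by positivity
      have h7 := mul_le_mul_of_nonneg_left h5 h6
      refine h7.trans (le_of_eq (by ring))) b3
  rw [hN2] at key
  set Pv := Pop a v x
  have hXv : ∑ i, cX L a y i x * pd i v x = L * φ * ∑ i, nY a' d i * v1 i := by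
    rw [Finset.mul_sum]; exact Finset.sum_congr rfl fun i _ => by rw [hcX]; ring
  rw [hXv, hcG, hcb] at hdiv
  simp only [hcX] at hdiv
  rw [hXv, hcG, hsX]
  set Yv := ∑ i, nY a' d i * v1 i
  rw [← hQ] at key
  set g := ng a' d
  set dY := ∑ k, ndY a' da d k k
  have hfin : ∀ S Nn v β : ℝ, 4 * (S * Nn) - 2 * τ ^ 2 * β ^ 2 * v ^ 2 ≤ 2 * (S + Nn + τ * β * v) ^ 2 := by
    intro S Nn v β
    nlinarith [sq_nonneg (S - Nn), sq_nonneg (S + Nn + 2 * (τ * β * v))]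
  have h3 := hfin (Pv + τ ^ 2 * (L ^ 2 * φ ^ 2 * g) * v x)
    (-2 * τ * (L * φ * Yv) - τ * (2 * L ^ 2 * φ * g) * v x) (v x) (L ^ 2 * φ * g - L * φ * dY)
  have e : (Pv + τ ^ 2 * (L ^ 2 * φ ^ 2 * g) * v x) +
    (-2 * τ * (L * φ * Yv) - τ * (2 * L ^ 2 * φ * g) * v x) + τ * (L ^ 2 * φ * g - L * φ * dY) * v x
    = Pv - 2 * τ * (L * φ * Yv) - τ * (L * φ * dY + L ^ 2 * φ * g) * v x
      + τ ^ 2 * (L ^ 2 * φ ^ 2 * g) * v x := by ring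
  rw [e] at h3
  rw [hdiv]
  linarith

lemma conj_num {n : ℕ} (τ e w : ℝ) (a : Fin n → Fin n → ℝ) (da : Fin n → Fin n → Fin n → ℝ)
    (f w1 : Fin n → ℝ) (F K : Fin n → Fin n → ℝ) (hsym : ∀ i j, a i j = a j i) :
    (∑ i, ∑ j, (da i j i * (e * (w1 j + τ * (w * f j))) + a i j *
        ((τ * f i * e) * (w1 j + τ * (w * f j)) + e * (K j i + τ * (w1 i * f j + w * F j i)))))
      - 2 * τ * (∑ i, (∑ j, a i j * f j) * (e * (w1 i + τ * (w * f i))))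
      - τ * (∑ i, ∑ j, (da i j i * f j + a i j * F j i)) * (e * w)
      + τ ^ 2 * (∑ i, f i * ∑ j, a i j * f j) * (e * w)
    = e * ∑ i, ∑ j, (da i j i * w1 j + a i j * K j i) := by
  have anti : ∑ i, ∑ j, a i j * (f i * w1 j) = ∑ i, ∑ j, a i j * (f j * w1 i) := by
    rw [Finset.sum_comm]
    refine Finset.sum_congr rfl fun i _ => Finset.sum_congr rfl fun j _ => ?_
    rw [hsym j i]
  have h2 : ∑ i, ∑ j, (τ * e * (a i j * (f i * w1 j)) - τ * e * (a i j * (f j * w1 i))) = 0 := by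
    simp only [Finset.sum_sub_distrib, ← Finset.mul_sum]
    rw [anti]; ring
  rw [← sub_eq_zero, ← h2]
  simp only [Finset.mul_sum, Finset.sum_mul]
  simp only [← Finset.sum_sub_distrib, ← Finset.sum_add_distrib]
  refine Finset.sum_congr rfl fun i _ => Finset.sum_congr rfl fun j _ => ?_
  ring

/-- The conjugated function. -/
def cv {n : ℕ} (τ L : ℝ) (y : EuclideanSpace ℝ (Fin n)) (w : EuclideanSpace ℝ (Fin n) → ℝ)
    (x : EuclideanSpace ℝ (Fin n)) : ℝ := Real.exp (τ * cphi L y x) * w x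

section conj
variable {n : ℕ} {τ L : ℝ} {y x : EuclideanSpace ℝ (Fin n)} {w : EuclideanSpace ℝ (Fin n) → ℝ}
  {a : Fin n → Fin n → EuclideanSpace ℝ (Fin n) → ℝ}

lemma HG_exp : HG (fun z => Real.exp (τ * cphi L y z))
    (fun k => (τ * (-L * cphi L y x * (x k - y k))) * Real.exp (τ * cphi L y x)) x := by
  refine HG.congr_grad (HG.comp (Real.hasDerivAt_exp _) (HG_cphi.cmul τ)) fun k => by ring

lemma HG_cv (hw : DifferentiableAt ℝ w x) : HG (cv τ L y w)
    (fun k => Real.exp (τ * cphi L y x) *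
      (pd k w x + τ * (w x * (-L * cphi L y x * (x k - y k))))) x := by
  refine HG.congr_grad (f := cv τ L y w) (HG_exp.mul (HG.of_diff hw)) fun k => by ring

lemma conj_eq (ha : ∀ i j, DifferentiableAt ℝ (a i j) x) (hsym : ∀ i j, a i j x = a j i x)
    (hw : ∀ᶠ z in nhds x, DifferentiableAt ℝ w z) (hw2 : ∀ j, DifferentiableAt ℝ (pd j w) x) :
    Pop a (cv τ L y w) x - 2 * τ * (∑ i, cX L a y i x * pd i (cv τ L y w) x)
      - τ * (∑ k, pd k (cX L a y k) x) * cv τ L y w x + τ ^ 2 * cG L a y x * cv τ L y w x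
    = Real.exp (τ * cphi L y x) * Pop a w x := by
  obtain ⟨f, hf⟩ : ∃ f : Fin n → EuclideanSpace ℝ (Fin n) → ℝ,
    f = fun k z => -L * cphi L y z * (z k - y k) := ⟨_, rfl⟩
  have hfd : ∀ k, DifferentiableAt ℝ (f k) x := fun k => by
    rw [hf]
    exact ((HG_cphi (x := x)).cmul (-L) |>.mul (HG.coord k (y k))).1
  have hfH := fun k => HG.of_diff (hfd k)
  have hwx : DifferentiableAt ℝ w x := hw.self_of_nhds
  have hpv : ∀ j, pd j (cv τ L y w) =ᶠ[nhds x]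
      fun z => Real.exp (τ * cphi L y z) * (pd j w z + τ * (w z * f j z)) := fun j => by
    filter_upwards [hw] with z hz
    rw [(HG_cv hz).pd_eq j, hf]
  have hE : HG (fun z => Real.exp (τ * cphi L y z))
    (fun k => (τ * f k x * Real.exp (τ * cphi L y x))) x := by
    rw [hf]; exact HG_exp.congr_grad fun k => by ring
  have hpvH : ∀ j, HG (pd j (cv τ L y w)) _ x := fun j =>
    (hE.mul ((HG.of_diff (hw2 j)).add (((HG.of_diff hwx).mul (hfH j)).cmul τ))).congr_fun (hpv j)
  have haH := fun i j => HG.of_diff (ha i j)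
  have e1 : ∀ i, cX L a y i = fun z => ∑ j, a i j z * f j z := fun i => by
    funext z
    simp only [cX, cY, hf, Finset.mul_sum, mul_neg, ← Finset.sum_neg_distrib]
    refine Finset.sum_congr rfl fun j _ => by ring
  have e2 : cG L a y x = ∑ i, f i x * ∑ j, a i j x * f j x := by
    simp only [cG, cg, hf, Finset.mul_sum]
    refine Finset.sum_congr rfl fun i _ => Finset.sum_congr rfl fun j _ => by ring
  have e3 : ∀ k, pd k (cX L a y k) x = ∑ j, (pd k (a k j) x * f j x + a k j x * pd k (f j) x) := by
    intro k; rw [e1]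
    exact (HG.sum Finset.univ (fun j => (haH k j).mul (hfH j))).pd_eq k
  have e4 : Pop a (cv τ L y w) x = ∑ i, ∑ j, (pd i (a i j) x * (Real.exp (τ * cphi L y x) *
      (pd j w x + τ * (w x * f j x))) + a i j x * ((τ * f i x * Real.exp (τ * cphi L y x)) *
      (pd j w x + τ * (w x * f j x)) + Real.exp (τ * cphi L y x) *
        (pd i (pd j w) x + τ * (pd i w x * f j x + w x * pd i (f j) x)))) := by
    unfold Pop
    refine Finset.sum_congr rfl fun i _ => Finset.sum_congr rfl fun j _ => ?_
    rw [((haH i j).mul (hpvH j)).pd_eq i, (hpv j).self_of_nhds]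
  have e5 : Pop a w x = ∑ i, ∑ j, (pd i (a i j) x * pd j w x + a i j x * pd i (pd j w) x) := by
    unfold Pop
    refine Finset.sum_congr rfl fun i _ => Finset.sum_congr rfl fun j _ => ?_
    rw [((haH i j).mul (HG.of_diff (hw2 j))).pd_eq i]
  have e6 : ∑ i, cX L a y i x * pd i (cv τ L y w) x = ∑ i, (∑ j, a i j x * f j x) *
      (Real.exp (τ * cphi L y x) * (pd i w x + τ * (w x * f i x))) :=
    Finset.sum_congr rfl fun i _ => by rw [e1, (hpv i).self_of_nhds]
  rw [e4, e5, e2, Finset.sum_congr rfl fun k _ => e3 k, e6]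
  exact conj_num τ (Real.exp (τ * cphi L y x)) (w x) (fun i j => a i j x)
    (fun i j k => pd k (a i j) x) (fun j => f j x) (fun j => pd j w x) (fun j i => pd i (f j) x)
    (fun j i => pd i (pd j w) x) hsym

/-- Leibniz rule for the operator. -/
lemma Pop_mul {χ u : EuclideanSpace ℝ (Fin n) → ℝ}
    (ha : ∀ i j, DifferentiableAt ℝ (a i j) x) (hsym : ∀ i j, a i j x = a j i x)
    (hχ : ∀ᶠ z in nhds x, DifferentiableAt ℝ χ z) (hχ2 : ∀ j, DifferentiableAt ℝ (pd j χ) x)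
    (hw : ∀ᶠ z in nhds x, DifferentiableAt ℝ u z) (hw2 : ∀ j, DifferentiableAt ℝ (pd j u) x) :
    Pop a (fun z => χ z * u z) x = χ x * Pop a u x
      + ∑ i, ∑ j, 2 * (a i j x * (pd i χ x * pd j u x))
      + u x * ∑ i, ∑ j, (pd i (a i j) x * pd j χ x + a i j x * pd i (pd j χ) x) := by
  have hux : DifferentiableAt ℝ u x := hw.self_of_nhds
  have hχx : DifferentiableAt ℝ χ x := hχ.self_of_nhds
  have hpv : ∀ j, pd j (fun z => χ z * u z) =ᶠ[nhds x]
      fun z => pd j χ z * u z + χ z * pd j u z := fun j => by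
    filter_upwards [hw, hχ] with z hz hz2
    rw [((HG.of_diff hz2).mul (HG.of_diff hz)).pd_eq j]
  have hpvH : ∀ j, HG (pd j (fun z => χ z * u z)) _ x := fun j =>
    (((HG.of_diff (hχ2 j)).mul (HG.of_diff hux)).add ((HG.of_diff hχx).mul (HG.of_diff (hw2 j)))).congr_fun (hpv j)
  have haH := fun i j => HG.of_diff (ha i j)
  have e4 : Pop a (fun z => χ z * u z) x = ∑ i, ∑ j, (pd i (a i j) x * (pd j χ x * u x + χ x * pd j u x)
      + a i j x * ((pd i (pd j χ) x * u x + pd j χ x * pd i u x) + (pd i χ x * pd j u x + χ x * pd i (pd j u) x))) := by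
    unfold Pop
    refine Finset.sum_congr rfl fun i _ => Finset.sum_congr rfl fun j _ => ?_
    rw [((haH i j).mul (hpvH j)).pd_eq i, (hpv j).self_of_nhds]
  have e5 : Pop a u x = ∑ i, ∑ j, (pd i (a i j) x * pd j u x + a i j x * pd i (pd j u) x) := by
    unfold Pop
    refine Finset.sum_congr rfl fun i _ => Finset.sum_congr rfl fun j _ => ?_
    rw [((haH i j).mul (HG.of_diff (hw2 j))).pd_eq i]
  have anti : ∑ i, ∑ j, a i j x * (pd j χ x * pd i u x) = ∑ i, ∑ j, a i j x * (pd i χ x * pd j u x) := by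
    rw [Finset.sum_comm]
    refine Finset.sum_congr rfl fun i _ => Finset.sum_congr rfl fun j _ => ?_
    rw [hsym j i]
  have h2 : ∑ i, ∑ j, (a i j x * (pd j χ x * pd i u x) - (a i j x * (pd i χ x * pd j u x))) = 0 := by
    simp only [Finset.sum_sub_distrib]
    rw [anti]; ring
  rw [e4, e5, ← sub_eq_zero, ← h2]
  simp only [Finset.mul_sum]
  simp only [← Finset.sum_sub_distrib, ← Finset.sum_add_distrib]
  refine Finset.sum_congr rfl fun i _ => Finset.sum_congr rfl fun j _ => ?_
  ring
end conj

lemma exists_bound_pd {n : ℕ} {χ : EuclideanSpace ℝ (Fin n) → ℝ} (h : ContDiff ℝ 2 χ)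
    (hc : HasCompactSupport χ) : ∃ B : ℝ, 1 ≤ B ∧ (∀ z, |χ z| ≤ B) ∧ (∀ i z, |pd i χ z| ≤ B) ∧
      ∀ i j z, |pd i (pd j χ) z| ≤ B := by
  have h1 : ∀ j, ContDiff ℝ 1 (pd j χ) := fun j => by
    have := pd_contDiffOn isOpen_univ h.contDiffOn j
    exact contDiffOn_univ.1 this
  have c1 : ∀ j, HasCompactSupport (pd j χ) := fun j =>
    hc.fderiv_apply ℝ (EuclideanSpace.single j (1:ℝ))
  have h2 : ∀ i j, Continuous (pd i (pd j χ)) := fun i j => by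
    have := ((h1 j).continuous_fderiv (by norm_num))
    exact this.clm_apply continuous_const
  have c2 : ∀ i j, HasCompactSupport (pd i (pd j χ)) := fun i j =>
    (c1 j).fderiv_apply ℝ (EuclideanSpace.single i (1:ℝ))
  obtain ⟨B0, hB0⟩ := h.continuous.bounded_above_of_compact_support hc
  choose B1 hB1 using fun j => (h1 j).continuous.bounded_above_of_compact_support (c1 j)
  choose B2 hB2 using fun i j => (h2 i j).bounded_above_of_compact_support (c2 i j)
  refine ⟨1 + |B0| + ∑ j, |B1 j| + ∑ i, ∑ j, |B2 i j|, ?_, ?_, ?_, ?_⟩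
  · have : 0 ≤ ∑ j, |B1 j| := Finset.sum_nonneg fun _ _ => abs_nonneg _
    have : 0 ≤ ∑ i, ∑ j, |B2 i j| := Finset.sum_nonneg fun _ _ => Finset.sum_nonneg fun _ _ => abs_nonneg _
    have := abs_nonneg B0
    linarith
  · intro z
    have : 0 ≤ ∑ j, |B1 j| := Finset.sum_nonneg fun _ _ => abs_nonneg _
    have : 0 ≤ ∑ i, ∑ j, |B2 i j| := Finset.sum_nonneg fun _ _ => Finset.sum_nonneg fun _ _ => abs_nonneg _
    have := (hB0 z).trans (le_abs_self _)
    rw [Real.norm_eq_abs] at this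
    linarith
  · intro i z
    have h3 : |B1 i| ≤ ∑ j, |B1 j| := Finset.single_le_sum (f := fun j => |B1 j|) (fun _ _ => abs_nonneg _) (Finset.mem_univ i)
    have : 0 ≤ ∑ i, ∑ j, |B2 i j| := Finset.sum_nonneg fun _ _ => Finset.sum_nonneg fun _ _ => abs_nonneg _
    have := (hB1 i z).trans (le_abs_self _)
    rw [Real.norm_eq_abs] at this
    have := abs_nonneg B0
    linarith
  · intro i j z
    have h3 : |B2 i j| ≤ ∑ j, |B2 i j| := Finset.single_le_sum (f := fun j => |B2 i j|) (fun _ _ => abs_nonneg _) (Finset.mem_univ j)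
    have h4 : ∑ j, |B2 i j| ≤ ∑ i, ∑ j, |B2 i j| := Finset.single_le_sum (f := fun i => ∑ j, |B2 i j|) (fun _ _ => Finset.sum_nonneg fun _ _ => abs_nonneg _) (Finset.mem_univ i)
    have : 0 ≤ ∑ j, |B1 j| := Finset.sum_nonneg fun _ _ => abs_nonneg _
    have := (hB2 i j z).trans (le_abs_self _)
    rw [Real.norm_eq_abs] at this
    have := abs_nonneg B0
    linarith

lemma pd_translate {n : ℕ} (χ : EuclideanSpace ℝ (Fin n) → ℝ) (y : EuclideanSpace ℝ (Fin n))
    (i : Fin n) : pd i (fun x => χ (x - y)) = fun x => pd i χ (x - y) := by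
  funext x
  simp only [pd, fderiv_comp_sub]

/-- Annular cutoff functions with uniform bounds. -/
lemma exists_annulus (n : ℕ) : ∃ B : ℝ, 1 ≤ B ∧ ∀ y : EuclideanSpace ℝ (Fin n),
    ∃ χ : EuclideanSpace ℝ (Fin n) → ℝ, ContDiff ℝ 2 χ ∧
      (∀ x, dist x y ≤ 1 / 2 → χ x = 0) ∧ (∀ x, 7 / 2 ≤ dist x y → χ x = 0) ∧
      (∀ x, 3 / 4 < dist x y → dist x y < 3 → χ x = 1) ∧
      (∀ z, |χ z| ≤ B) ∧ (∀ i z, |pd i χ z| ≤ B) ∧ ∀ i j z, |pd i (pd j χ) z| ≤ B := by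
  let b1 : ContDiffBump (0 : EuclideanSpace ℝ (Fin n)) := ⟨1/2, 3/4, by norm_num, by norm_num⟩
  let b2 : ContDiffBump (0 : EuclideanSpace ℝ (Fin n)) := ⟨3, 7/2, by norm_num, by norm_num⟩
  let χ : EuclideanSpace ℝ (Fin n) → ℝ := fun z => b2 z * (1 - b1 z)
  have h : ContDiff ℝ 2 χ := b2.contDiff.mul (contDiff_const.sub b1.contDiff)
  have hc : HasCompactSupport χ := b2.hasCompactSupport.mul_right
  obtain ⟨B, hB, h0, h1, h2⟩ := exists_bound_pd h hc
  refine ⟨B, hB, fun y => ⟨fun x => χ (x - y), h.comp (contDiff_id.sub contDiff_const), ?_, ?_, ?_,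
    fun z => h0 _, fun i z => ?_, fun i j z => ?_⟩⟩
  · intro x hx
    have : b1 (x - y) = 1 := b1.one_of_mem_closedBall (by simpa [b1, dist_eq_norm] using hx)
    simp [χ, this]
  · intro x hx
    have : b2 (x - y) = 0 := b2.zero_of_le_dist (by simpa [b2, dist_eq_norm] using hx)
    simp [χ, this]
  · intro x hx hx2
    have e1 : b1 (x - y) = 0 := b1.zero_of_le_dist (by simpa [b1, dist_eq_norm] using hx.le)
    have e2 : b2 (x - y) = 1 := b2.one_of_mem_closedBall (by simpa [b2, dist_eq_norm] using hx2.le)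
    simp [χ, e1, e2]
  · rw [pd_translate]; exact h1 i _
  · rw [pd_translate, pd_translate]; exact h2 i j _

/-- Unit-scale hypotheses. -/
structure UAdm {n : ℕ} (lam Λ : ℝ) (a : Fin n → Fin n → EuclideanSpace ℝ (Fin n) → ℝ)
    (u : EuclideanSpace ℝ (Fin n) → ℝ) (U : Set (EuclideanSpace ℝ (Fin n))) : Prop where
  hU : IsOpen U
  ha : ∀ i j, ContDiffOn ℝ 1 (a i j) U
  hu : ContDiffOn ℝ 2 u U
  sym : ∀ x ∈ U, ∀ i j, a i j x = a j i x
  bd : ∀ x ∈ U, ∀ i j, |a i j x| ≤ Λ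
  dbd : ∀ x ∈ U, ∀ i j k, |pd k (a i j) x| ≤ Λ
  ell : ∀ x ∈ U, ∀ ξ : Fin n → ℝ, lam * ∑ i, ξ i ^ 2 ≤ ∑ i, ξ i * ∑ j, a i j x * ξ j
  eqn : ∀ x ∈ U, |Pop a u x| ≤ Λ * |u x|

/-- Energy density. -/
def en {n : ℕ} (u : EuclideanSpace ℝ (Fin n) → ℝ) (x : EuclideanSpace ℝ (Fin n)) : ℝ :=
  (u x) ^ 2 + ∑ i, (pd i u x) ^ 2

lemma en_nonneg {n : ℕ} (u : EuclideanSpace ℝ (Fin n) → ℝ) (x) : 0 ≤ en u x :=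
  add_nonneg (sq_nonneg _) (Finset.sum_nonneg fun _ _ => sq_nonneg _)

lemma en_contOn {n : ℕ} {u : EuclideanSpace ℝ (Fin n) → ℝ} {U} (hU : IsOpen U)
    (hu : ContDiffOn ℝ 2 u U) : ContinuousOn (en u) U := by
  unfold en
  refine (hu.continuousOn.pow 2).add (continuousOn_finsetSum _ fun i _ => ?_)
  exact (pd_contDiffOn hU hu i).continuousOn.pow 2

lemma dist_sq_eq {n : ℕ} (x y : EuclideanSpace ℝ (Fin n)) :
    ∑ i, (x i - y i) * (x i - y i) = dist x y ^ 2 := by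
  rw [EuclideanSpace.dist_eq, Real.sq_sqrt (Finset.sum_nonneg fun _ _ => sq_nonneg _)]
  refine Finset.sum_congr rfl fun i _ => ?_
  rw [Real.dist_eq, sq_abs]; ring

lemma cphi_eq {n : ℕ} (L : ℝ) (x y : EuclideanSpace ℝ (Fin n)) :
    cphi L y x = Real.exp (-(L / 2) * dist x y ^ 2) := by
  rw [cphi, dist_sq_eq]

lemma cphi_contDiff {n : ℕ} (L : ℝ) (y : EuclideanSpace ℝ (Fin n)) {m : WithTop ℕ∞} :
    ContDiff ℝ m (cphi L y) := by
  have hc : ∀ i : Fin n, ContDiff ℝ m (fun x : EuclideanSpace ℝ (Fin n) => x i) := fun i =>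
    (EuclideanSpace.proj i : EuclideanSpace ℝ (Fin n) →L[ℝ] ℝ).contDiff
  unfold cphi
  refine Real.contDiff_exp.comp (contDiff_const.mul (ContDiff.sum fun i _ => ?_))
  exact ((hc i).sub contDiff_const).mul ((hc i).sub contDiff_const)

section
variable {n : ℕ} {lam Λ : ℝ} {a : Fin n → Fin n → EuclideanSpace ℝ (Fin n) → ℝ}
    {u v : EuclideanSpace ℝ (Fin n) → ℝ} {U : Set (EuclideanSpace ℝ (Fin n))}

lemma CF_contDiffOn (hU : IsOpen U) (ha : ∀ i j, ContDiffOn ℝ 1 (a i j) U)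
    (hv : ContDiffOn ℝ 2 v U) (τ L : ℝ) (y : EuclideanSpace ℝ (Fin n)) (k : Fin n) :
    ContDiffOn ℝ 1 (CF τ a (cX L a y) (cG L a y) (cb L a y) v k) U := by
  have hc : ∀ i : Fin n, ContDiffOn ℝ 1 (fun x : EuclideanSpace ℝ (Fin n) => x i - y i) U := fun i =>
    (((EuclideanSpace.proj i : EuclideanSpace ℝ (Fin n) →L[ℝ] ℝ).contDiff).sub contDiff_const).contDiffOn
  have hφ : ContDiffOn ℝ 1 (cphi L y) U := (cphi_contDiff L y).contDiffOn
  have hpv := pd_contDiffOn hU hv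
  have hv1 : ContDiffOn ℝ 1 v U := hv.of_le (by norm_num)
  have hs : ∀ i, ContDiffOn ℝ 1 (fun x => ∑ j, a i j x * (x j - y j)) U := fun i =>
    ContDiffOn.sum fun j _ => (ha i j).mul (hc j)
  have hg : ContDiffOn ℝ 1 (cg a y) U := ContDiffOn.sum fun i _ => (hc i).mul (hs i)
  have hX : ∀ i, ContDiffOn ℝ 1 (cX L a y i) U := fun i =>
    contDiffOn_const.mul (hφ.mul (hs i).neg)
  have hG : ContDiffOn ℝ 1 (cG L a y) U := contDiffOn_const.mul ((hφ.mul hφ).mul hg)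
  have hb : ContDiffOn ℝ 1 (cb L a y) U := contDiffOn_const.mul (hφ.mul hg)
  have hp : ∀ i, ContDiffOn ℝ 1 (fun x => ∑ j, a i j x * pd j v x) U := fun i =>
    ContDiffOn.sum fun j _ => (ha i j).mul (hpv j)
  have hXv : ContDiffOn ℝ 1 (fun x => ∑ i, cX L a y i x * pd i v x) U :=
    ContDiffOn.sum fun i _ => (hX i).mul (hpv i)
  have hW : ContDiffOn ℝ 1 (fun x => ∑ i, pd i v x * ∑ j, a i j x * pd j v x) U :=
    ContDiffOn.sum fun i _ => (hpv i).mul (hp i)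
  unfold CF
  exact ((contDiffOn_const.mul ((contDiffOn_const.mul (hXv.mul (hp k))).sub ((hX k).mul hW))).add
    (contDiffOn_const.mul ((hG.mul (hX k)).mul (hv1.mul hv1)))).add
    (contDiffOn_const.mul ((hb.mul hv1).mul (hp k)))
end

lemma abs_le_sqrt_en {n : ℕ} (u : EuclideanSpace ℝ (Fin n) → ℝ) (x) :
    |u x| ≤ Real.sqrt (en u x) ∧ ∀ j, |pd j u x| ≤ Real.sqrt (en u x) := by
  have h : 0 ≤ ∑ i, (pd i u x) ^ 2 := Finset.sum_nonneg fun _ _ => sq_nonneg _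
  constructor
  · refine Real.abs_le_sqrt ?_
    simp only [en]; linarith
  · intro j
    refine Real.abs_le_sqrt ?_
    have := Finset.single_le_sum (f := fun i => (pd i u x) ^ 2) (fun _ _ => sq_nonneg _) (Finset.mem_univ j)
    have := sq_nonneg (u x)
    simp only [en]; linarith

set_option maxHeartbeats 1000000 in
lemma threeball_pt (n : ℕ) (lam Λ B : ℝ) (hlam : 0 < lam) (hΛ : 4 ≤ Λ) (hB : 1 ≤ B) :
    ∃ L : ℝ, 1 ≤ L ∧ ∃ τ0 : ℝ, 1 ≤ τ0 ∧ ∃ κ > 0, ∃ C > 0,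
    ∀ (a : Fin n → Fin n → EuclideanSpace ℝ (Fin n) → ℝ) (u : EuclideanSpace ℝ (Fin n) → ℝ)
      (U : Set (EuclideanSpace ℝ (Fin n))) (y : EuclideanSpace ℝ (Fin n))
      (χ : EuclideanSpace ℝ (Fin n) → ℝ), UAdm lam Λ a u U →
      ContDiff ℝ 2 χ → 
      (∀ x, 3 / 4 < dist x y → dist x y < 3 → χ x = 1) →
      (∀ z, |χ z| ≤ B) → (∀ i z, |pd i χ z| ≤ B) → (∀ i j z, |pd i (pd j χ) z| ≤ B) →
      ∀ τ x, τ0 ≤ τ → x ∈ U → 1 / 2 ≤ dist x y → dist x y ≤ 7 / 2 →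
      (1 ≤ dist x y → dist x y < 3 → κ * (Real.exp (2 * (τ * cphi L y x)) * en u x) ≤
        ∑ k, pd k (CF τ a (cX L a y) (cG L a y) (cb L a y) (cv τ L y (fun z => χ z * u z)) k) x) ∧
      0 ≤ C * (Real.exp (2 * (τ * cphi L y x)) * en u x) +
        ∑ k, pd k (CF τ a (cX L a y) (cG L a y) (cb L a y) (cv τ L y (fun z => χ z * u z)) k) x := by
  obtain ⟨L, hL, τ0, hτ0, c, hc, H⟩ := carleman_pt n lam Λ hlam hΛ
  obtain ⟨C3, hC3⟩ : ∃ C3 : ℝ, C3 = 2 * (32 * n * L ^ 2 + 1) := ⟨_, rfl⟩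
  have hC3p : 2 ≤ C3 := by rw [hC3]; have : 0 ≤ 32 * (n:ℝ) * L ^ 2 := by positivity
                           linarith
  obtain ⟨C2, hC2⟩ : ∃ C2 : ℝ, C2 = B * Λ + n * (n * (2 * (Λ * B))) + n * (n * (Λ * B + Λ * B)) := ⟨_, rfl⟩
  have hC2p : 0 < C2 := by rw [hC2]; positivity
  refine ⟨L, hL, max τ0 (4 * Λ ^ 2 / c), le_max_of_le_left hτ0, c / (4 * C3), by positivity,
    C2 ^ 2 / 2, by positivity, ?_⟩
  intro a u U y χ hA hχ hχ1 hb0 hb1 hb2 τ x hτ hx hd1 hd2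
  have hτ1 : τ0 ≤ τ := (le_max_left _ _).trans hτ
  have hτ2 : 4 * Λ ^ 2 ≤ c * τ := by
    have := (le_max_right _ _).trans hτ
    rw [div_le_iff₀ hc] at this
    linarith
  have hτp : 1 ≤ τ := hτ0.trans hτ1
  obtain ⟨w, hw⟩ : ∃ w : EuclideanSpace ℝ (Fin n) → ℝ, w = fun z => χ z * u z := ⟨_, rfl⟩
  rw [← hw]
  have hU := hA.hU.mem_nhds hx
  have hda : ∀ i j, DifferentiableAt ℝ (a i j) x := fun i j =>
    ((hA.ha i j).contDiffAt hU).differentiableAt (by norm_num)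
  have hwC : ContDiffOn ℝ 2 w U := by rw [hw]; exact hχ.contDiffOn.mul hA.hu
  have hvC : ContDiffOn ℝ 2 (cv τ L y w) U := by
    unfold cv
    exact (Real.contDiff_exp.comp (contDiff_const.mul (cphi_contDiff L y))).contDiffOn.mul hwC
  have dif : ∀ f : EuclideanSpace ℝ (Fin n) → ℝ, ContDiffOn ℝ 2 f U →
      (∀ᶠ z in nhds x, DifferentiableAt ℝ f z) ∧ ∀ j, DifferentiableAt ℝ (pd j f) x := by
    intro f hf
    constructor
    · filter_upwards [hU] with z hz
      exact (hf.contDiffAt (hA.hU.mem_nhds hz)).differentiableAt (by norm_num)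
    · intro j
      exact ((pd_contDiffOn hA.hU hf j).contDiffAt hU).differentiableAt (by norm_num)
  have key := H a y x (cv τ L y w) τ hτ1 hda (hA.sym x hx) (hA.bd x hx) (hA.dbd x hx) (hA.ell x hx)
    (by rw [dist_sq_eq]; nlinarith) (by rw [dist_sq_eq]; nlinarith)
    (dif _ hvC).1.self_of_nhds (dif _ hvC).2 (pd_symm hA.hU hvC hx)
  rw [conj_eq hda (hA.sym x hx) (dif _ hwC).1 (dif _ hwC).2] at key
  obtain ⟨S, hS⟩ : ∃ S, S = ∑ k, pd k (CF τ a (cX L a y) (cG L a y) (cb L a y) (cv τ L y w) k) x :=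
    ⟨_, rfl⟩
  obtain ⟨e, he⟩ : ∃ e, e = Real.exp (τ * cphi L y x) := ⟨_, rfl⟩
  have he2 : Real.exp (2 * (τ * cphi L y x)) = e ^ 2 := by
    rw [he, ← Real.exp_nat_mul]; norm_num
  rw [← hS, ← he] at key
  rw [← hS, he2]
  have hs1 : 0 ≤ ∑ i, (pd i (cv τ L y w) x) ^ 2 := Finset.sum_nonneg fun _ _ => sq_nonneg _
  constructor
  · intro h1 h3
    have hloc : w =ᶠ[nhds x] u := by
      have ho : IsOpen {z | 3 / 4 < dist z y ∧ dist z y < 3} :=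
        (isOpen_lt continuous_const (continuous_id.dist continuous_const)).inter
          (isOpen_lt (continuous_id.dist continuous_const) continuous_const)
      filter_upwards [ho.mem_nhds (⟨by linarith, h3⟩ : x ∈ {z | 3 / 4 < dist z y ∧ dist z y < 3})] with z hz
      rw [hw]; simp only [hχ1 z hz.1 hz.2, one_mul]
    have hpl : ∀ j, pd j w =ᶠ[nhds x] pd j u := fun j => by
      filter_upwards [hloc.eventuallyEq_nhds] with z hz
      simp only [pd, hz.fderiv_eq]
    have hPop : Pop a w x = Pop a u x := by
      unfold Pop
      refine Finset.sum_congr rfl fun i _ => Finset.sum_congr rfl fun j _ => ?_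
      have : (fun z => a i j z * pd j w z) =ᶠ[nhds x] (fun z => a i j z * pd j u z) := by
        filter_upwards [hpl j] with z hz
        rw [hz]
      simp only [pd] at this ⊢
      rw [this.fderiv_eq]
    have hwx : w x = u x := hloc.self_of_nhds
    have hvx : cv τ L y w x = e * u x := by rw [cv, hwx, he]
    rw [hPop] at key
    have hP2 : (Pop a u x) ^ 2 ≤ Λ ^ 2 * (u x) ^ 2 := by
      have := hA.eqn x hx
      rw [← sq_abs, ← sq_abs (u x), ← mul_pow]
      exact pow_le_pow_left₀ (abs_nonneg _) this 2
    obtain ⟨v, hv⟩ : ∃ v, v = cv τ L y w x := ⟨_, rfl⟩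
    have hv2 : v ^ 2 = e ^ 2 * (u x) ^ 2 := by rw [hv, hvx]; ring
    rw [← hv] at key
    have h5 : 2 * (e * Pop a u x) ^ 2 ≤ c * τ ^ 3 * v ^ 2 / 2 := by
      have h6 : 2 * (e * Pop a u x) ^ 2 ≤ 2 * Λ ^ 2 * v ^ 2 := by
        rw [hv2, mul_pow]
        have := mul_le_mul_of_nonneg_left hP2 (sq_nonneg e)
        linarith
      have h7 : c * τ ≤ c * τ ^ 3 := by
        have : τ ≤ τ ^ 3 := le_self_pow₀ hτp (by norm_num)
        exact mul_le_mul_of_nonneg_left this hc.le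
      have h8 : 4 * Λ ^ 2 * v ^ 2 ≤ c * τ ^ 3 * v ^ 2 :=
        mul_le_mul_of_nonneg_right (hτ2.trans h7) (sq_nonneg v)
      linarith
    have hgrad : ∀ k, e ^ 2 * (pd k u x) ^ 2 ≤ 2 * (pd k (cv τ L y w) x) ^ 2 + 32 * L ^ 2 * (τ ^ 2 * v ^ 2) := by
      intro k
      have hpv := (HG_cv (τ := τ) (L := L) (y := y) (dif _ hwC).1.self_of_nhds).pd_eq k
      rw [(hpl k).self_of_nhds, ← he, hwx] at hpv
      obtain ⟨f, hf⟩ : ∃ f, f = -L * cphi L y x * (x k - y k) := ⟨_, rfl⟩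
      rw [← hf] at hpv
      have hf2 : f ^ 2 ≤ 16 * L ^ 2 := by
        have hφ1 : cphi L y x ≤ 1 := by
          rw [cphi_eq, Real.exp_le_one_iff]; nlinarith [sq_nonneg (dist x y)]
        have hφ0 : 0 ≤ cphi L y x := (Real.exp_pos _).le
        have hdk : (x k - y k) ^ 2 ≤ 16 := by
          have h1 := Finset.single_le_sum (f := fun i => (x i - y i) * (x i - y i))
            (fun _ _ => mul_self_nonneg _) (Finset.mem_univ k)
          rw [dist_sq_eq] at h1
          nlinarith
        have h2 : (cphi L y x) ^ 2 ≤ 1 := pow_le_one₀ hφ0 hφ1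
        calc f ^ 2 = L ^ 2 * ((cphi L y x) ^ 2 * (x k - y k) ^ 2) := by rw [hf]; ring
          _ ≤ L ^ 2 * (1 * 16) := by gcongr
          _ = _ := by ring
      have e1 : e * pd k u x = pd k (cv τ L y w) x - τ * v * f := by
        rw [hpv, hv, hvx]; ring
      have h9 : (τ * v * f) ^ 2 ≤ 16 * L ^ 2 * (τ ^ 2 * v ^ 2) := by
        have := mul_le_mul_of_nonneg_right hf2 (by positivity : 0 ≤ τ ^ 2 * v ^ 2)
        calc _ = f ^ 2 * (τ ^ 2 * v ^ 2) := by ring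
          _ ≤ _ := this
      rw [← mul_pow, e1]
      have := sq_nonneg (pd k (cv τ L y w) x + τ * v * f)
      linarith [this, h9, add_sq (pd k (cv τ L y w) x) (τ * v * f), sub_sq (pd k (cv τ L y w) x) (τ * v * f)]
    have hsum : e ^ 2 * en u x ≤ 2 * (∑ i, (pd i (cv τ L y w) x) ^ 2) + (32 * n * L ^ 2 + 1) * (τ ^ 2 * v ^ 2) := by
      have h1 := Finset.sum_le_sum fun k (_ : k ∈ Finset.univ) => hgrad k
      rw [← Finset.mul_sum, Finset.sum_add_distrib, ← Finset.mul_sum] at h1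
      simp only [Finset.sum_const, Finset.card_univ, Fintype.card_fin, nsmul_eq_mul] at h1
      have h2 : v ^ 2 ≤ τ ^ 2 * v ^ 2 := le_mul_of_one_le_left (sq_nonneg _) (one_le_pow₀ hτp)
      simp only [en, mul_add]
      rw [← hv2]
      linarith
    obtain ⟨T, hT⟩ : ∃ T, T = ∑ i, (pd i (cv τ L y w) x) ^ 2 := ⟨_, rfl⟩
    rw [← hT] at key hsum hs1
    have h10 : c * (τ * T + τ ^ 3 * v ^ 2 / 2) ≤ 4 * S := by linarith
    have h11 : e ^ 2 * en u x ≤ C3 * (τ * T + τ ^ 3 * v ^ 2 / 2) := by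
      have h12 : T ≤ τ * T := le_mul_of_one_le_left hs1 hτp
      have h13 : 2 * T ≤ C3 * (τ * T) := mul_le_mul hC3p h12 hs1 (by linarith)
      have h14 : τ ^ 2 * v ^ 2 ≤ τ ^ 3 * v ^ 2 :=
        mul_le_mul_of_nonneg_right (pow_le_pow_right₀ hτp (by norm_num)) (sq_nonneg _)
      have h15 : (32 * n * L ^ 2 + 1) * (τ ^ 2 * v ^ 2) ≤ (32 * n * L ^ 2 + 1) * (τ ^ 3 * v ^ 2) :=
        mul_le_mul_of_nonneg_left h14 (by positivity)
      rw [hC3] at h13 ⊢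
      linarith
    rw [div_mul_eq_mul_div, div_le_iff₀ (by positivity)]
    have h16 := mul_le_mul_of_nonneg_left h11 hc.le
    have h17 := mul_le_mul_of_nonneg_left h10 (by linarith : 0 ≤ C3)
    linarith
  · have hP := Pop_mul (a := a) hda (hA.sym x hx) (dif _ hχ.contDiffOn).1 (dif _ hχ.contDiffOn).2
      (dif _ hA.hu).1 (dif _ hA.hu).2
    rw [← hw] at hP
    obtain ⟨s, hs⟩ : ∃ s, s = Real.sqrt (en u x) := ⟨_, rfl⟩
    have hs2 : s ^ 2 = en u x := by rw [hs]; exact Real.sq_sqrt (en_nonneg u x)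
    have hu := (abs_le_sqrt_en u x).1
    have hpu := (abs_le_sqrt_en u x).2
    rw [← hs] at hu hpu
    have hs0 : 0 ≤ s := by rw [hs]; exact Real.sqrt_nonneg _
    have b1 : |χ x * Pop a u x| ≤ B * (Λ * s) :=
      abs_mul_bd (hb0 x) ((hA.eqn x hx).trans (by gcongr))
    have b2 : |∑ i, ∑ j, 2 * (a i j x * (pd i χ x * pd j u x))| ≤ n * (n * (2 * (Λ * (B * s)))) :=
      abs_sum_bd fun i => abs_sum_bd fun j => abs_mul_bd (by norm_num) (abs_mul_bd (hA.bd x hx i j)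
        (abs_mul_bd (hb1 i x) (hpu j)))
    have b3 : |u x * ∑ i, ∑ j, (pd i (a i j) x * pd j χ x + a i j x * pd i (pd j χ) x)|
        ≤ s * (n * (n * (Λ * B + Λ * B))) :=
      abs_mul_bd hu (abs_sum_bd fun i => abs_sum_bd fun j => abs_add_bd
        (abs_mul_bd (hA.dbd x hx i j i) (hb1 j x)) (abs_mul_bd (hA.bd x hx i j) (hb2 i j x)))
    have b4 : |Pop a w x| ≤ C2 * s := by
      rw [hP, hC2]
      refine (abs_add_bd (abs_add_bd b1 b2) b3).trans (le_of_eq (by ring))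
    have b5 : (Pop a w x) ^ 2 ≤ C2 ^ 2 * en u x := by
      rw [← hs2, ← mul_pow, ← sq_abs]
      exact pow_le_pow_left₀ (abs_nonneg _) b4 2
    have h0 : 0 ≤ c * (τ * (∑ i, (pd i (cv τ L y w) x) ^ 2) + τ ^ 3 * (cv τ L y w x) ^ 2) := by positivity
    have b6 := mul_le_mul_of_nonneg_left b5 (sq_nonneg e)
    rw [mul_pow] at key
    linarith

lemma threeball (n : ℕ) (lam Λ : ℝ) (hlam : 0 < lam) (hΛ : 4 ≤ Λ) :
    ∃ C > 0, ∃ c1 > 0, ∃ c2 > 0, ∃ τ0 : ℝ, 1 ≤ τ0 ∧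
    ∀ (a : Fin n → Fin n → EuclideanSpace ℝ (Fin n) → ℝ) (u : EuclideanSpace ℝ (Fin n) → ℝ)
      (U : Set (EuclideanSpace ℝ (Fin n))) (y : EuclideanSpace ℝ (Fin n)),
      UAdm lam Λ a u U → closedBall y 4 ⊆ U → ∀ τ, τ0 ≤ τ →
      ∫ x in ball y 2, en u x ≤ C * (Real.exp (c1 * τ) * (∫ x in ball y 1, en u x)
        + Real.exp (-c2 * τ) * ∫ x in ball y 4, en u x) := by
  obtain ⟨B, hB, hcut⟩ := exists_annulus n
  obtain ⟨L, hL, τ0, hτ0, κ, hκ, C, hC, H⟩ := threeball_pt n lam Λ B hlam hΛ hB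
  have hφ32 : Real.exp (-(L / 2) * 9) < Real.exp (-(L / 2) * 4) := by
    rw [Real.exp_lt_exp]; linarith
  obtain ⟨φ2, hφ2⟩ : ∃ z, z = Real.exp (-(L / 2) * 4) := ⟨_, rfl⟩
  obtain ⟨φ3, hφ3⟩ : ∃ z, z = Real.exp (-(L / 2) * 9) := ⟨_, rfl⟩
  rw [← hφ2, ← hφ3] at hφ32
  have hφ2p : 0 < φ2 := by rw [hφ2]; exact Real.exp_pos _
  refine ⟨1 + C / κ, by positivity, 2, by norm_num, 2 * (φ2 - φ3), by linarith, τ0, hτ0, ?_⟩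
  intro a u U y hA hyU τ hτ
  have hτp : 1 ≤ τ := hτ0.trans hτ
  obtain ⟨χ, hχ, hχin, hχout, hχ1, hb0, hb1, hb2⟩ := hcut y
  obtain ⟨v, hv⟩ : ∃ v, v = cv τ L y (fun z => χ z * u z) := ⟨_, rfl⟩
  obtain ⟨F, hF⟩ : ∃ F, F = CF τ a (cX L a y) (cG L a y) (cb L a y) v := ⟨_, rfl⟩
  obtain ⟨K, hK⟩ : ∃ K : Set (EuclideanSpace ℝ (Fin n)), K = {x | 1 / 2 ≤ dist x y ∧ dist x y ≤ 7 / 2} := ⟨_, rfl⟩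
  have hKc : IsClosed K := by
    rw [hK]
    exact (isClosed_le continuous_const (continuous_id.dist continuous_const)).inter
          (isClosed_le (continuous_id.dist continuous_const) continuous_const)
  have hKcp : IsCompact K := by
    refine (isCompact_closedBall y (7/2)).of_isClosed_subset hKc ?_
    intro x hx; rw [hK] at hx; exact hx.2
  have hKU : K ⊆ U := by
    intro x hx; rw [hK] at hx
    exact hyU (mem_closedBall.2 (by linarith [hx.2]))
  have hvC : ContDiffOn ℝ 2 v U := by
    rw [hv]; unfold cv
    exact (Real.contDiff_exp.comp (contDiff_const.mul (cphi_contDiff L y))).contDiffOn.mul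
      (hχ.contDiffOn.mul hA.hu)
  have hv0 : ∀ x, x ∉ K → v x = 0 := by
    intro x hx
    have : χ x = 0 := by
      by_contra h
      apply hx; rw [hK]
      constructor
      · by_contra h'; exact h (hχin x (by linarith))
      · by_contra h'; exact h (hχout x (by linarith))
    rw [hv]; simp [cv, this]
  have vanish : ∀ f : EuclideanSpace ℝ (Fin n) → ℝ, (∀ x, x ∉ K → f x = 0) →
      ∀ i x, x ∉ K → pd i f x = 0 := by
    intro f hf i x hx
    have : f =ᶠ[nhds x] fun _ => 0 := by
      filter_upwards [hKc.isOpen_compl.mem_nhds hx] with z hz using hf z hz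
    simp [pd, this.fderiv_eq]
  have hF0 : ∀ k x, x ∉ K → F k x = 0 := by
    intro k x hx
    rw [hF]
    simp [CF, hv0 x hx, vanish v hv0 _ x hx]
  have hFi : ∀ k, Integrable (pd k (F k)) ∧ ∫ x, pd k (F k) x = 0 := fun k =>
    integral_pd_C1 hA.hU hKcp hKU (by rw [hF]; exact CF_contDiffOn hA.hU hA.ha hvC τ L y k) (hF0 k) k
  have hSi : Integrable (fun x => ∑ k, pd k (F k) x) := integrable_finsetSum _ fun k _ => (hFi k).1
  have hS0 : ∫ x, ∑ k, pd k (F k) x = 0 := by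
    rw [integral_finsetSum _ fun k _ => (hFi k).1]
    exact Finset.sum_eq_zero fun k _ => (hFi k).2
  have hint4 : IntegrableOn (en u) (ball y 4) :=
    (((en_contOn hA.hU hA.hu).mono hyU).integrableOn_compact (isCompact_closedBall y 4)).mono_set
      ball_subset_closedBall
  have hint2 : IntegrableOn (en u) (ball y 2) := hint4.mono_set (ball_subset_ball (by norm_num))
  have hint1 : IntegrableOn (en u) (ball y 1) := hint4.mono_set (ball_subset_ball (by norm_num))
  have hintR : IntegrableOn (en u) (ball y 2 \ ball y 1) := hint2.mono_set sdiff_subset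
  have hpt : ∀ x, (κ * Real.exp (2 * τ * φ2)) * (ball y 2 \ ball y 1).indicator (en u) x ≤
      (C * Real.exp (2 * τ)) * (ball y 1).indicator (en u) x
      + (C * Real.exp (2 * τ * φ3)) * (ball y 4).indicator (en u) x + ∑ k, pd k (F k) x := by
    intro x
    have hen := en_nonneg u x
    have hg1 : 0 ≤ (C * Real.exp (2 * τ)) * (ball y 1).indicator (en u) x :=
      mul_nonneg (by positivity) (indicator_nonneg (fun z _ => en_nonneg u z) x)
    have hg4 : 0 ≤ (C * Real.exp (2 * τ * φ3)) * (ball y 4).indicator (en u) x :=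
      mul_nonneg (by positivity) (indicator_nonneg (fun z _ => en_nonneg u z) x)
    by_cases hx : x ∈ K
    · have hxU := hKU hx
      rw [hK] at hx
      obtain ⟨h1, h2⟩ := H a u U y χ hA hχ hχ1 hb0 hb1 hb2 τ x hτ hxU hx.1 hx.2
      rw [← hv, ← hF] at h1 h2
      rw [cphi_eq] at h1 h2
      have hd0 : 0 ≤ dist x y := dist_nonneg
      rcases lt_or_ge (dist x y) 1 with h | h
      · have e1 : (ball y 2 \ ball y 1).indicator (en u) x = 0 :=
          indicator_of_notMem (fun h' => h'.2 (mem_ball.2 h)) _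
        have e2 : (ball y 1).indicator (en u) x = en u x := indicator_of_mem (mem_ball.2 h) _
        rw [e1, e2] at *
        have hE : Real.exp (2 * (τ * Real.exp (-(L / 2) * dist x y ^ 2))) ≤ Real.exp (2 * τ) := by
          rw [Real.exp_le_exp]
          have : Real.exp (-(L / 2) * dist x y ^ 2) ≤ 1 := by
            rw [Real.exp_le_one_iff]; nlinarith [sq_nonneg (dist x y)]
          have := mul_le_mul_of_nonneg_left this (by linarith : 0 ≤ τ)
          linarith
        have := mul_le_mul_of_nonneg_left (mul_le_mul_of_nonneg_right hE hen) hC.le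
        linarith
      · rcases lt_or_ge (dist x y) 3 with h3 | h3
        · have h1 := h1 h h3
          rcases lt_or_ge (dist x y) 2 with h22 | h22
          · have hm : x ∈ ball y 2 \ ball y 1 :=
              ⟨mem_ball.2 h22, fun h' => absurd (mem_ball.1 h') (by linarith)⟩
            have e1 : (ball y 2 \ ball y 1).indicator (en u) x = en u x := indicator_of_mem hm _
            rw [e1]
            have hE : Real.exp (2 * τ * φ2) ≤ Real.exp (2 * (τ * Real.exp (-(L / 2) * dist x y ^ 2))) := by
              rw [Real.exp_le_exp]
              have : φ2 ≤ Real.exp (-(L / 2) * dist x y ^ 2) := by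
                rw [hφ2, Real.exp_le_exp]
                have hd4 : dist x y ^ 2 ≤ 4 := by nlinarith
                have := mul_le_mul_of_nonneg_left hd4 (by linarith : 0 ≤ L / 2)
                linarith
              have := mul_le_mul_of_nonneg_left this (by linarith : 0 ≤ τ)
              linarith
            have := mul_le_mul_of_nonneg_left (mul_le_mul_of_nonneg_right hE hen) hκ.le
            linarith
          · have e1 : (ball y 2 \ ball y 1).indicator (en u) x = 0 :=
              indicator_of_notMem (fun h' => by linarith [mem_ball.1 h'.1]) _
            rw [e1]
            have : 0 ≤ κ * (Real.exp (2 * (τ * Real.exp (-(L / 2) * dist x y ^ 2))) * en u x) := by positivity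
            linarith
        · have e1 : (ball y 2 \ ball y 1).indicator (en u) x = 0 :=
            indicator_of_notMem (fun h' => by linarith [mem_ball.1 h'.1]) _
          have e2 : (ball y 4).indicator (en u) x = en u x :=
            indicator_of_mem (mem_ball.2 (by linarith [hx.2])) _
          rw [e2] at hg4
          rw [e1, e2]
          have hE : Real.exp (2 * (τ * Real.exp (-(L / 2) * dist x y ^ 2))) ≤ Real.exp (2 * τ * φ3) := by
            rw [Real.exp_le_exp]
            have : Real.exp (-(L / 2) * dist x y ^ 2) ≤ φ3 := by
              rw [hφ3, Real.exp_le_exp]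
              have hd4 : 9 ≤ dist x y ^ 2 := by nlinarith
              have := mul_le_mul_of_nonneg_left hd4 (by linarith : 0 ≤ L / 2)
              linarith
            have := mul_le_mul_of_nonneg_left this (by linarith : 0 ≤ τ)
            linarith
          have := mul_le_mul_of_nonneg_left (mul_le_mul_of_nonneg_right hE hen) hC.le
          linarith
    · have e0 : ∑ k, pd k (F k) x = 0 := Finset.sum_eq_zero fun k _ => vanish _ (hF0 k) k x hx
      have e1 : (ball y 2 \ ball y 1).indicator (en u) x = 0 :=
        indicator_of_notMem (fun h' => hx (by
          rw [hK]
          have h1 := mem_ball.1 h'.1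
          have h2 : 1 ≤ dist x y := by
            by_contra h3; exact h'.2 (mem_ball.2 (by linarith))
          constructor <;> linarith)) _
      rw [e0, e1]; linarith
  have mR : MeasurableSet (ball y 2 \ ball y 1) := measurableSet_ball.diff measurableSet_ball
  have j1 : Integrable (fun x => (C * Real.exp (2 * τ)) * (ball y 1).indicator (en u) x) :=
    (hint1.integrable_indicator measurableSet_ball).const_mul _
  have j4 : Integrable (fun x => (C * Real.exp (2 * τ * φ3)) * (ball y 4).indicator (en u) x) :=
    (hint4.integrable_indicator measurableSet_ball).const_mul _
  have j14 : Integrable (fun x => (C * Real.exp (2 * τ)) * (ball y 1).indicator (en u) x +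
    (C * Real.exp (2 * τ * φ3)) * (ball y 4).indicator (en u) x) := j1.add j4
  have hmono := integral_mono ((hintR.integrable_indicator mR).const_mul (κ * Real.exp (2 * τ * φ2)))
    (j14.add hSi) hpt
  rw [integral_add' j14 hSi, integral_add j1 j4,
    hS0, integral_const_mul, integral_const_mul, integral_const_mul, integral_indicator mR,
    integral_indicator measurableSet_ball, integral_indicator measurableSet_ball] at hmono
  have hsplit : ∫ x in ball y 2, en u x = (∫ x in ball y 1, en u x) + ∫ x in ball y 2 \ ball y 1, en u x := by
    rw [setIntegral_sdiff₀ measurableSet_ball.nullMeasurableSet hint2 (ball_subset_ball (by norm_num))]; ring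
  have hI1 : 0 ≤ ∫ x in ball y 1, en u x := integral_nonneg fun z => en_nonneg u z
  have hI4 : 0 ≤ ∫ x in ball y 4, en u x := integral_nonneg fun z => en_nonneg u z
  obtain ⟨I1, hI1'⟩ : ∃ z, z = ∫ x in ball y 1, en u x := ⟨_, rfl⟩
  obtain ⟨I4, hI4'⟩ : ∃ z, z = ∫ x in ball y 4, en u x := ⟨_, rfl⟩
  obtain ⟨IR, hIR'⟩ : ∃ z, z = ∫ x in ball y 2 \ ball y 1, en u x := ⟨_, rfl⟩
  rw [hsplit]
  rw [← hI1'] at hI1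
  rw [← hI4'] at hI4
  rw [← hI1', ← hI4', ← hIR'] at hmono
  rw [← hI1', ← hI4', ← hIR']
  have hE2 : 1 ≤ Real.exp (2 * τ * φ2) := Real.one_le_exp (by positivity)
  have hE1 : 1 ≤ Real.exp (2 * τ) := Real.one_le_exp (by positivity)
  have hE3 : Real.exp (2 * τ * φ3) = Real.exp (2 * τ * φ2) * Real.exp (-(2 * (φ2 - φ3)) * τ) := by
    rw [← Real.exp_add]; congr 1; ring
  rw [hE3] at hmono
  obtain ⟨P, hP⟩ : ∃ z, z = Real.exp (2 * τ * φ2) := ⟨_, rfl⟩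
  obtain ⟨Q, hQ⟩ : ∃ z, z = Real.exp (2 * τ) := ⟨_, rfl⟩
  obtain ⟨T, hT⟩ : ∃ z, z = Real.exp (-(2 * (φ2 - φ3)) * τ) := ⟨_, rfl⟩
  have hTp : 0 < T := by rw [hT]; exact Real.exp_pos _
  rw [← hP] at hE2
  rw [← hQ] at hE1
  rw [← hP, ← hQ, ← hT] at hmono
  rw [← hQ, ← hT]
  have h1 : κ * IR ≤ C * (Q * I1 + T * I4) := by
    have hPp : 0 < P := by linarith
    have h2 : P * (κ * IR) ≤ P * (C * (Q * I1 + T * I4)) := by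
      have h3 : C * Q * I1 ≤ P * (C * Q * I1) := le_mul_of_one_le_left (by positivity) hE2
      linarith
    exact le_of_mul_le_mul_left h2 hPp
  have h2 : IR ≤ C / κ * (Q * I1 + T * I4) := by
    rw [div_mul_eq_mul_div, le_div_iff₀ hκ]; linarith
  have h3 : I1 ≤ Q * I1 := le_mul_of_one_le_left hI1 hE1
  have h4 : 0 ≤ T * I4 := by positivity
  linarith

lemma propagate (n : ℕ) (lam Λ K0 : ℝ) (hlam : 0 < lam) (hΛ : 4 ≤ Λ) (hK0 : 1 ≤ K0) :
    ∃ b : ℝ, 1 ≤ b ∧ ∃ s0 : ℝ, 1 ≤ s0 ∧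
    ∀ (a : Fin n → Fin n → EuclideanSpace ℝ (Fin n) → ℝ) (u : EuclideanSpace ℝ (Fin n) → ℝ)
      (U : Set (EuclideanSpace ℝ (Fin n))) (y : EuclideanSpace ℝ (Fin n)),
      UAdm lam Λ a u U → closedBall y 4 ⊆ U → ∫ x in ball y 4, en u x ≤ K0 → ∀ s, s0 ≤ s →
      Real.exp (-s) ≤ ∫ x in ball y 2, en u x →
      Real.exp (-(b * s)) ≤ ∫ x in ball y 1, en u x := by
  obtain ⟨C, hC, c1, hc1, c2, hc2, τ0, hτ0, H⟩ := threeball n lam Λ hlam hΛ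
  obtain ⟨l, hl⟩ : ∃ l, l = Real.log (2 * C * K0) := ⟨_, rfl⟩
  have hl' : Real.exp l = 2 * C * K0 := by rw [hl]; exact Real.exp_log (by positivity)
  obtain ⟨l2, hl2⟩ : ∃ l, l = Real.log (2 * C) := ⟨_, rfl⟩
  have hl2' : Real.exp l2 = 2 * C := by rw [hl2]; exact Real.exp_log (by positivity)
  obtain ⟨m0, hm0⟩ : ∃ m0, m0 = |l2 + c1 / c2 * l| := ⟨_, rfl⟩
  refine ⟨2 + c1 / c2, by linarith [div_pos hc1 hc2], max 1 (max m0 (c2 * τ0 - l)), le_max_left _ _, ?_⟩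
  intro a u U y hA hyU hK s hs hE
  have hs1 : m0 ≤ s := (le_max_left _ _).trans ((le_max_right _ _).trans hs)
  have hs2 : c2 * τ0 - l ≤ s := (le_max_right _ _).trans ((le_max_right _ _).trans hs)
  have hτ : τ0 ≤ (s + l) / c2 := by rw [le_div_iff₀ hc2]; linarith
  have h := H a u U y hA hyU ((s + l) / c2) hτ
  have e1 : -c2 * ((s + l) / c2) = -s - l := by field_simp; ring
  rw [e1, Real.exp_sub, hl'] at h
  obtain ⟨I1, hI1⟩ : ∃ z, z = ∫ x in ball y 1, en u x := ⟨_, rfl⟩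
  rw [← hI1] at h ⊢
  have h2 : C * (Real.exp (-s) / (2 * C * K0) * ∫ x in ball y 4, en u x) ≤ Real.exp (-s) / 2 := by
    have hp : 0 ≤ Real.exp (-s) / (2 * C * K0) := by positivity
    have := mul_le_mul_of_nonneg_left (mul_le_mul_of_nonneg_left hK hp) hC.le
    refine this.trans (le_of_eq ?_)
    field_simp
  have h3 : Real.exp (-s) ≤ Real.exp (l2 + c1 * ((s + l) / c2)) * I1 := by
    rw [Real.exp_add, hl2']
    linarith
  have h4 : Real.exp (-s - (l2 + c1 * ((s + l) / c2))) ≤ I1 := by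
    rw [Real.exp_sub, div_le_iff₀ (Real.exp_pos _)]; linarith
  refine le_trans (Real.exp_le_exp.2 ?_) h4
  have h5 : l2 + c1 / c2 * l ≤ s := (le_abs_self _).trans (hm0 ▸ hs1)
  have e2 : c1 * ((s + l) / c2) = c1 / c2 * s + c1 / c2 * l := by ring
  rw [e2]; linarith

lemma pd_scale {n : ℕ} (f : EuclideanSpace ℝ (Fin n) → ℝ) (ρ : ℝ) (k : Fin n) :
    pd k (fun z => f (ρ • z)) = fun z => ρ * pd k f (ρ • z) := by
  funext z
  simp only [pd]
  rw [fderiv_comp_smul]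
  simp

lemma bound_C1 {n : ℕ} {Ω : Set (EuclideanSpace ℝ (Fin n))} (hΩ : IsOpen Ω)
    (hb : Bornology.IsBounded Ω) {f : EuclideanSpace ℝ (Fin n) → ℝ}
    (hf : ContDiffOn ℝ 1 f (closure Ω)) :
    ∃ C, ∀ x ∈ Ω, |f x| ≤ C ∧ ∀ k, |pd k f x| ≤ C := by
  have hK : IsCompact (closure Ω) := hb.isCompact_closure
  have h1 : ∃ C, ∀ x ∈ closure Ω ∩ Ω, ‖fderiv ℝ f x‖ ≤ C := by
    refine hK.induction_on (p := fun s => ∃ C, ∀ x ∈ s ∩ Ω, ‖fderiv ℝ f x‖ ≤ C) ⟨0, by simp⟩ ?_ ?_ ?_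
    · rintro s t hst ⟨C, hC⟩
      exact ⟨C, fun x hx => hC x ⟨hst hx.1, hx.2⟩⟩
    · rintro s t ⟨C, hC⟩ ⟨D, hD⟩
      refine ⟨max C D, fun x hx => ?_⟩
      rcases hx.1 with h | h
      · exact (hC x ⟨h, hx.2⟩).trans (le_max_left _ _)
      · exact (hD x ⟨h, hx.2⟩).trans (le_max_right _ _)
    · intro x hx
      have hfx := hf x hx
      have hfx' : ContDiffWithinAt ℝ (0 + 1) f (closure Ω) x := by simpa using hfx
      obtain ⟨v, hv, -, f', hf', hc⟩ := (contDiffWithinAt_succ_iff_hasFDerivWithinAt (by simp)).1 hfx'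
      rw [insert_eq_of_mem hx] at hv
      have hcc : ContinuousWithinAt f' v x := hc.continuousWithinAt
      have hbd : ∀ᶠ z in nhdsWithin x v, ‖f' z‖ < ‖f' x‖ + 1 :=
        (hcc.norm).eventually_lt_const (by linarith)
      obtain ⟨W, hWo, hxW, hW⟩ := mem_nhdsWithin.1 hv
      obtain ⟨W2, hW2o, hxW2, hW2⟩ := mem_nhdsWithin.1 hbd
      refine ⟨W ∩ W2, mem_nhdsWithin_of_mem_nhds ((hWo.inter hW2o).mem_nhds ⟨hxW, hxW2⟩),
        ‖f' x‖ + 1, ?_⟩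
      rintro z ⟨⟨hz1, hz2⟩, hzΩ⟩
      have hzv : v ∈ nhds z := by
        refine Filter.mem_of_superset ((hWo.inter hΩ).mem_nhds ⟨hz1, hzΩ⟩) ?_
        rintro t ⟨ht1, ht2⟩
        exact hW ⟨ht1, subset_closure ht2⟩
      have hzv' : z ∈ v := mem_of_mem_nhds hzv
      have := (hf' z hzv').hasFDerivAt hzv
      rw [this.fderiv]
      exact (hW2 ⟨hz2, hzv'⟩).le
  obtain ⟨C, hC⟩ := h1
  obtain ⟨D, hD⟩ := hK.exists_bound_of_continuousOn hf.continuousOn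
  refine ⟨max C D, fun x hx => ⟨(hD x (subset_closure hx)).trans (le_max_right _ _), fun k => ?_⟩⟩
  have h3 : |pd k f x| ≤ ‖fderiv ℝ f x‖ := by
    have := (fderiv ℝ f x).le_opNorm (EuclideanSpace.single k (1:ℝ))
    simpa [pd] using this
  exact h3.trans ((hC x ⟨subset_closure hx, hx⟩).trans (le_max_left _ _))

lemma pd_le_fderiv {n : ℕ} (f : EuclideanSpace ℝ (Fin n) → ℝ) (x) (k : Fin n) :
    |pd k f x| ≤ ‖fderiv ℝ f x‖ := by
  have := (fderiv ℝ f x).le_opNorm (EuclideanSpace.single k (1:ℝ))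
  simpa [pd] using this

/-- Scaled admissibility. -/
lemma scaled_adm {n : ℕ} {Ω : Set (EuclideanSpace ℝ (Fin n))} (hΩ : IsOpen Ω)
    {A : Fin n → Fin n → EuclideanSpace ℝ (Fin n) → ℝ} {q u : EuclideanSpace ℝ (Fin n) → ℝ}
    {lam Λ M ρ : ℝ} (hA1 : ∀ i j, ContDiffOn ℝ 1 (A i j) Ω) (hsym : ∀ i j, ∀ x ∈ Ω, A i j x = A j i x)
    (hbd : ∀ i j, ∀ x ∈ Ω, |A i j x| ≤ Λ ∧ ∀ k, |pd k (A i j) x| ≤ Λ)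
    (hell : ∀ x ∈ Ω, ∀ ξ : EuclideanSpace ℝ (Fin n),
      lam * ‖ξ‖ ^ 2 ≤ ∑ i, ∑ j, A i j x * ξ i * ξ j)
    (hu : ContDiffOn ℝ 2 u Ω) (hq : ∀ x ∈ Ω, |q x| ≤ M) (hM : M ≤ Λ) (hsol : IsSolution A q u Ω)
    (hρ : 0 < ρ) (hρ1 : ρ ≤ 1) :
    UAdm lam Λ (fun i j z => A i j (ρ • z)) (fun z => u (ρ • z)) ((fun z => ρ • z) ⁻¹' Ω) := by
  have hcs : ContDiff ℝ 2 (fun z : EuclideanSpace ℝ (Fin n) => ρ • z) := contDiff_const_smul ρ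
  refine ⟨hΩ.preimage (continuous_const_smul ρ), fun i j => ?_, ?_, fun x hx i j => hsym i j _ hx,
    fun x hx i j => (hbd i j _ hx).1, fun x hx i j k => ?_, fun x hx ξ => ?_, fun x hx => ?_⟩
  · exact (hA1 i j).comp (contDiff_const_smul ρ).contDiffOn (fun x hx => hx)
  · exact hu.comp hcs.contDiffOn (fun x hx => hx)
  · rw [pd_scale]
    simp only
    rw [abs_mul, abs_of_pos hρ]
    have := (hbd i j _ hx).2 k
    calc _ ≤ 1 * |pd k (A i j) (ρ • x)| := by gcongr
      _ ≤ Λ := by linarith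
  · have := hell _ hx (WithLp.toLp 2 ξ)
    rw [EuclideanSpace.norm_sq_eq] at this
    simp only [Real.norm_eq_abs, sq_abs] at this
    refine this.trans (le_of_eq ?_)
    refine Finset.sum_congr rfl fun i _ => ?_
    rw [Finset.mul_sum]
    exact Finset.sum_congr rfl fun j _ => by ring
  · have hP : Pop (fun i j z => A i j (ρ • z)) (fun z => u (ρ • z)) x = ρ ^ 2 * Pop A u (ρ • x) := by
      unfold Pop
      rw [Finset.mul_sum]
      refine Finset.sum_congr rfl fun i _ => ?_
      rw [Finset.mul_sum]
      refine Finset.sum_congr rfl fun j _ => ?_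
      rw [pd_scale u]
      have e : (fun y => A i j (ρ • y) * (ρ * pd j u (ρ • y))) =
        fun y => (fun z => ρ * (A i j z * pd j u z)) (ρ • y) := by funext y; ring
      rw [e, pd_scale (fun z => ρ * (A i j z * pd j u z))]
      have hd : DifferentiableAt ℝ (fun z => A i j z * pd j u z) (ρ • x) := by
        have h1 := ((hA1 i j).contDiffAt (hΩ.mem_nhds hx)).differentiableAt (by norm_num)
        have h2 := ((pd_contDiffOn hΩ hu j).contDiffAt (hΩ.mem_nhds hx)).differentiableAt (by norm_num)
        exact h1.mul h2
      have := ((HG.of_diff hd).cmul ρ).pd_eq i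
      simp only [this]; ring
    have hs : Pop A u (ρ • x) = - (q (ρ • x) * u (ρ • x)) := by
      have := hsol _ hx
      unfold Pop; linarith
    rw [hP, hs, abs_mul, abs_neg, abs_mul, abs_of_nonneg (sq_nonneg ρ)]
    have h1 : ρ ^ 2 ≤ 1 := pow_le_one₀ hρ.le hρ1
    have h2 := hq _ hx
    calc ρ ^ 2 * (|q (ρ • x)| * |u (ρ • x)|) ≤ 1 * (Λ * |u (ρ • x)|) := by
          gcongr; exact h2.trans hM
      _ = _ := one_mul _

/-- Chains of points of `S` with steps of length at most `ρ`. -/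
inductive Ch {n : ℕ} (S : Set (EuclideanSpace ℝ (Fin n))) (ρ : ℝ) :
    ℕ → EuclideanSpace ℝ (Fin n) → EuclideanSpace ℝ (Fin n) → Prop
  | refl (x) : Ch S ρ 0 x x
  | step {N x y z} : Ch S ρ N x y → z ∈ S → dist z y ≤ ρ → Ch S ρ (N + 1) x z

/-- Broken lines in `S`. -/
inductive Pl {n : ℕ} (S : Set (EuclideanSpace ℝ (Fin n))) :
    ℕ → EuclideanSpace ℝ (Fin n) → EuclideanSpace ℝ (Fin n) → Prop
  | refl (x) : Pl S 0 x x
  | step {N x y z} : Pl S N x y → segment ℝ y z ⊆ S → Pl S (N + 1) x z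

lemma Ch.trans {n : ℕ} {S : Set (EuclideanSpace ℝ (Fin n))} {ρ : ℝ} {N N' x y z}
    (h : Ch S ρ N x y) (h' : Ch S ρ N' y z) : Ch S ρ (N + N') x z := by
  induction h' with
  | refl => exact h
  | step _ hz hd ih => exact Ch.step (ih h) hz hd

lemma seg_ch {n : ℕ} {S : Set (EuclideanSpace ℝ (Fin n))} {ρ : ℝ} {N : ℕ} {x y}
    (hs : segment ℝ x y ⊆ S) (hd : dist x y ≤ N * ρ) : Ch S ρ N x y := by
  rcases Nat.eq_zero_or_pos N with rfl | hN
  · have : x = y := by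
      have : dist x y ≤ 0 := by simpa using hd
      exact dist_le_zero.1 this
    rw [this]; exact Ch.refl _
  have hN' : (0:ℝ) < N := by exact_mod_cast hN
  have key : ∀ k : ℕ, k ≤ N → Ch S ρ k x (AffineMap.lineMap x y ((k:ℝ) / N)) := by
    intro k
    induction k with
    | zero => intro _; simpa using Ch.refl x
    | succ k ih =>
      intro hk
      refine Ch.step (ih (by omega)) (hs ?_) ?_
      · rw [segment_eq_image_lineMap]
        refine ⟨_, ⟨by positivity, ?_⟩, rfl⟩
        rw [div_le_one hN']; exact_mod_cast hk
      · rw [dist_lineMap_lineMap, Real.dist_eq]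
        have : (((k + 1 : ℕ) : ℝ) / N - k / N) = 1 / N := by push_cast; ring
        rw [this, abs_of_pos (by positivity), div_mul_eq_mul_div, one_mul, div_le_iff₀ hN']
        linarith
  have := key N le_rfl
  rwa [div_self hN'.ne', AffineMap.lineMap_apply_one] at this

lemma pl_ch {n : ℕ} {S : Set (EuclideanSpace ℝ (Fin n))} {ρ : ℝ} {N j : ℕ} {x y}
    (h : Pl S j x y) (hd : ∀ a ∈ S, ∀ b ∈ S, dist a b ≤ N * ρ) : Ch S ρ (j * N) x y := by
  induction h with
  | refl => rw [zero_mul]; exact Ch.refl _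
  | step _ hs ih =>
    rw [Nat.succ_mul]
    exact ih.trans (seg_ch hs (hd _ (hs (left_mem_segment ..)) _ (hs (right_mem_segment ..))))

/-- Points at depth at least `r`. -/
def Dp {n : ℕ} (Ω : Set (EuclideanSpace ℝ (Fin n))) (r : ℝ) : Set (EuclideanSpace ℝ (Fin n)) :=
  {x | ball x r ⊆ Ω}

lemma local_int {n : ℕ} {Ω : Set (EuclideanSpace ℝ (Fin n))} (hΩ : IsOpen Ω) {m : ℕ}
    (hbl : BrokenLineCond Ω m) {z0 p : EuclideanSpace ℝ (Fin n)} (hz0 : z0 ∈ Ω) (hp : p ∈ Ω) :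
    ∃ V ∈ nhds p, ∃ J : ℕ, ∃ rs > 0, ∀ r, 0 < r → r ≤ rs → ∀ x ∈ V, x ∈ Dp Ω r →
      ∃ j ≤ J, Pl (Dp Ω r) j z0 x := by
  obtain ⟨j, -, z, h0, hj, hseg⟩ := hbl z0 hz0 p hp
  have hK : IsCompact (⋃ i ∈ Finset.range j, segment ℝ (z i) (z (i+1))) := by
    refine (Finset.range j).isCompact_biUnion fun i _ => ?_
    rw [segment_eq_image_lineMap]
    exact isCompact_Icc.image (AffineMap.lineMap_continuous)
  have hKΩ : (⋃ i ∈ Finset.range j, segment ℝ (z i) (z (i+1))) ⊆ Ω := by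
    refine iUnion₂_subset fun i hi => hseg i (Finset.mem_range.1 hi)
  obtain ⟨δ, hδ, hth⟩ := hK.exists_thickening_subset_open hΩ hKΩ
  obtain ⟨δ', hδ', hb⟩ := Metric.isOpen_iff.1 hΩ p hp
  refine ⟨ball p (δ'/2), ball_mem_nhds _ (by positivity), j + 1, min δ (δ'/2), by positivity, ?_⟩
  intro r hr hrs x hx _
  have hrδ : r ≤ δ := hrs.trans (min_le_left _ _)
  have hrδ' : r ≤ δ'/2 := hrs.trans (min_le_right _ _)
  have key : ∀ k : ℕ, k ≤ j → Pl (Dp Ω r) k z0 (z k) := by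
    intro k
    induction k with
    | zero => intro _; rw [h0]; exact Pl.refl _
    | succ k ih =>
      intro hk
      refine Pl.step (ih (by omega)) fun y hy w hw => hth ?_
      rw [mem_thickening_iff]
      refine ⟨y, ?_, lt_of_lt_of_le hw hrδ⟩
      exact mem_biUnion (Finset.mem_coe.2 (Finset.mem_range.2 (by omega : k < j))) hy
  refine ⟨j + 1, le_rfl, Pl.step (key j le_rfl) ?_⟩
  rw [hj]
  intro y hy w hw
  have hy' : y ∈ ball p (δ'/2) :=
    (convex_ball p (δ'/2)).segment_subset (mem_ball_self (by positivity)) hx hy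
  apply hb
  rw [mem_ball] at *
  linarith [dist_triangle w y p]

lemma front_le {n : ℕ} {Ω : Set (EuclideanSpace ℝ (Fin n))} {p ν : EuclideanSpace ℝ (Fin n)}
    {φ : EuclideanSpace ℝ (Fin n) → ℝ} {rc : ℝ} (hrc : 0 < rc) (hφ : Continuous φ)
    (hp : p ∈ closure Ω)
    (hch : ∀ y ∈ ball p rc, (y ∈ Ω ↔ ⟪y, ν⟫ < φ (y - ⟪y, ν⟫ • ν))) :
    ⟪p, ν⟫ ≤ φ (p - ⟪p, ν⟫ • ν) := by
  by_contra hlt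
  push Not at hlt
  have hopen : IsOpen {y : EuclideanSpace ℝ (Fin n) | φ (y - ⟪y, ν⟫ • ν) < ⟪y, ν⟫} := by
    refine isOpen_lt ?_ ?_
    · fun_prop
    · fun_prop
  obtain ⟨y, hy, hyΩ⟩ := _root_.mem_closure_iff.1 hp _ (hopen.inter (isOpen_ball : IsOpen (ball p rc)))
    ⟨hlt, mem_ball_self hrc⟩
  exact absurd ((hch y hy.2).1 hyΩ) (not_lt.2 (le_of_lt hy.1))

lemma proj_shift {n : ℕ} {ν : EuclideanSpace ℝ (Fin n)} (hν : ‖ν‖ = 1)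
    (y : EuclideanSpace ℝ (Fin n)) (t : ℝ) :
    ⟪y - t • ν, ν⟫ = ⟪y, ν⟫ - t ∧
    (y - t • ν) - ⟪y - t • ν, ν⟫ • ν = y - ⟪y, ν⟫ • ν := by
  have h1 : ⟪y - t • ν, ν⟫ = ⟪y, ν⟫ - t := by
    rw [inner_sub_left, inner_smul_left, real_inner_self_eq_norm_sq, hν]; simp
  refine ⟨h1, ?_⟩
  rw [h1, sub_smul]; abel

lemma front_shift {n : ℕ} {Ω : Set (EuclideanSpace ℝ (Fin n))} {p ν : EuclideanSpace ℝ (Fin n)}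
    {φ : EuclideanSpace ℝ (Fin n) → ℝ} {rc : ℝ} (hrc : 0 < rc) (hφ : Continuous φ)
    (hν : ‖ν‖ = 1) (hp : p ∈ closure Ω)
    (hch : ∀ y ∈ ball p rc, (y ∈ Ω ↔ ⟪y, ν⟫ < φ (y - ⟪y, ν⟫ • ν))) {t : ℝ} (ht : 0 < t)
    (ht' : t < rc) : p - t • ν ∈ Ω := by
  have hle := front_le hrc hφ hp hch
  obtain ⟨h1, h2⟩ := proj_shift hν p t
  rw [hch, h2, h1]
  · linarith
  · rw [mem_ball, dist_eq_norm]
    have : p - t • ν - p = - (t • ν) := by abel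
    rw [this, norm_neg, norm_smul, hν, Real.norm_eq_abs, abs_of_pos ht]; linarith

lemma local_front {n : ℕ} {Ω : Set (EuclideanSpace ℝ (Fin n))} (hΩ : IsOpen Ω) {m : ℕ}
    (hbl : BrokenLineCond Ω m) (hreg : IsC11Boundary Ω)
    {z0 p : EuclideanSpace ℝ (Fin n)} (hz0 : z0 ∈ Ω) (hp : p ∈ frontier Ω) :
    ∃ V ∈ nhds p, ∃ J : ℕ, ∃ rs > 0, ∀ r, 0 < r → r ≤ rs → ∀ x ∈ V, x ∈ Dp Ω r →
      ∃ j ≤ J, Pl (Dp Ω r) j z0 x := by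
  obtain ⟨rc, hrc, ν, hν, φ, K, hφ, -, hch⟩ := hreg p hp
  have hp' : p - (rc/4) • ν ∈ Ω :=
    front_shift hrc hφ.continuous hν (frontier_subset_closure hp) hch (by positivity) (by linarith)
  obtain ⟨V, hV, J, rs, hrs, H⟩ := local_int hΩ hbl hz0 hp'
  refine ⟨ball p (rc/4) ∩ (fun x => x - (rc/4) • ν) ⁻¹' V, ?_, J + 1, min rs (rc/4), by positivity, ?_⟩
  · refine Filter.inter_mem (ball_mem_nhds _ (by positivity)) ?_
    have hc : Continuous (fun x : EuclideanSpace ℝ (Fin n) => x - (rc/4) • ν) := by fun_prop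
    exact hc.continuousAt.preimage_mem_nhds hV
  intro r hr hrr x hx hxr
  have hr1 : r ≤ rs := hrr.trans (min_le_left _ _)
  have hr2 : r ≤ rc/4 := hrr.trans (min_le_right _ _)
  have key : ∀ t, 0 ≤ t → t ≤ rc/4 → x - t • ν ∈ Dp Ω r := by
    intro t ht ht' w hw
    have hxp : dist x p < rc/4 := hx.1
    have htn : ‖t • ν‖ = t := by rw [norm_smul, hν, Real.norm_eq_abs, abs_of_nonneg ht, mul_one]
    have hw1 : dist (w + t • ν) x < r := by
      have : dist w (x - t • ν) < r := hw
      rw [dist_eq_norm] at this ⊢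
      convert this using 2; abel
    have hw2 : w + t • ν ∈ Ω := hxr hw1
    have hw3 : dist (w + t • ν) p < rc := by linarith [dist_triangle (w + t • ν) x p]
    have hw4 : dist w (w + t • ν) = t := by
      rw [dist_eq_norm]
      have : w - (w + t • ν) = -(t • ν) := by abel
      rw [this, norm_neg, htn]
    have hw5 : w ∈ ball p rc := by
      rw [mem_ball]
      linarith [dist_triangle w (w + t • ν) p, dist_triangle (w + t • ν) x p]
    have := (hch _ hw3).1 hw2
    obtain ⟨e1, e2⟩ := proj_shift hν (w + t • ν) t
    rw [add_sub_cancel_right] at e1 e2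
    rw [hch _ hw5, e2]
    linarith
  obtain ⟨j, hj, hPl⟩ := H r hr hr1 _ hx.2 (key (rc/4) (by positivity) le_rfl)
  refine ⟨j + 1, by omega, Pl.step hPl ?_⟩
  rintro y hy
  rw [segment_symm, segment_eq_image_lineMap] at hy
  obtain ⟨s, ⟨hs0, hs1⟩, rfl⟩ := hy
  have : AffineMap.lineMap x (x - (rc/4) • ν) s = x - (s * (rc/4)) • ν := by
    rw [AffineMap.lineMap_apply, vsub_eq_sub, vadd_eq_add, mul_smul]
    rw [sub_sub_cancel_left, smul_neg]; abel
  rw [this]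
  exact key _ (by positivity) (by nlinarith)

lemma chains {n : ℕ} {Ω : Set (EuclideanSpace ℝ (Fin n))} (hΩ : IsOpen Ω)
    (hb : Bornology.IsBounded Ω) {m : ℕ}
    (hbl : BrokenLineCond Ω m) (hreg : IsC11Boundary Ω)
    {z0 : EuclideanSpace ℝ (Fin n)} (hz0 : z0 ∈ Ω) :
    ∃ L0 > 0, ∃ rs > 0, rs ≤ 1 ∧ ∀ r, 0 < r → r ≤ rs → ∀ x, ball x r ⊆ Ω →
      ∃ N : ℕ, (N : ℝ) ≤ L0 / r ∧ Ch (Dp Ω r) (r / 8) N z0 x := by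
  have hloc : ∀ p ∈ closure Ω, ∃ V ∈ nhds p, ∃ J : ℕ, ∃ rs > 0, ∀ r, 0 < r → r ≤ rs → ∀ x ∈ V,
      x ∈ Dp Ω r → ∃ j ≤ J, Pl (Dp Ω r) j z0 x := by
    intro p hp
    by_cases h : p ∈ Ω
    · exact local_int hΩ hbl hz0 h
    · refine local_front hΩ hbl hreg hz0 ⟨hp, ?_⟩
      rwa [hΩ.interior_eq]
  have hK : IsCompact (closure Ω) := hb.isCompact_closure
  have h1 : ∃ J : ℕ, ∃ rs > 0, ∀ r, 0 < r → r ≤ rs → ∀ x ∈ closure Ω,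
      x ∈ Dp Ω r → ∃ j ≤ J, Pl (Dp Ω r) j z0 x := by
    refine hK.induction_on (p := fun s => ∃ J : ℕ, ∃ rs > 0, ∀ r, 0 < r → r ≤ rs → ∀ x ∈ s,
      x ∈ Dp Ω r → ∃ j ≤ J, Pl (Dp Ω r) j z0 x) ⟨0, 1, one_pos, by simp⟩ ?_ ?_ ?_
    · rintro s t hst ⟨J, rs, hrs, H⟩
      exact ⟨J, rs, hrs, fun r hr hr' x hx => H r hr hr' x (hst hx)⟩
    · rintro s t ⟨J, rs, hrs, H⟩ ⟨J', rs', hrs', H'⟩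
      refine ⟨max J J', min rs rs', lt_min hrs hrs', fun r hr hr' x hx hxD => ?_⟩
      rcases hx with hx | hx
      · obtain ⟨j, hj, h⟩ := H r hr (hr'.trans (min_le_left _ _)) x hx hxD
        exact ⟨j, hj.trans (le_max_left _ _), h⟩
      · obtain ⟨j, hj, h⟩ := H' r hr (hr'.trans (min_le_right _ _)) x hx hxD
        exact ⟨j, hj.trans (le_max_right _ _), h⟩
    · intro p hp
      obtain ⟨V, hV, h⟩ := hloc p hp
      exact ⟨V, mem_nhdsWithin_of_mem_nhds hV, h⟩
  obtain ⟨J, rs, hrs, H⟩ := h1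
  obtain ⟨Dm, hDm⟩ := Metric.isBounded_iff.1 hb
  have hD0 : 0 ≤ Dm := by have := hDm hz0 hz0; simpa using this
  refine ⟨J * (8 * Dm + 1) + 1, by positivity, min rs 1, by positivity, min_le_right _ _, ?_⟩
  intro r hr hrr x hx
  have hr1 : r ≤ 1 := hrr.trans (min_le_right _ _)
  obtain ⟨j, hj, hPl⟩ := H r hr (hrr.trans (min_le_left _ _)) x (subset_closure (hx (mem_ball_self hr))) hx
  have hsub : ∀ a ∈ Dp Ω r, a ∈ Ω := fun a ha => ha (mem_ball_self hr)
  refine ⟨j * ⌈8 * Dm / r⌉₊, ?_, pl_ch hPl ?_⟩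
  · push_cast
    have h3 : ((⌈8 * Dm / r⌉₊ : ℕ) : ℝ) ≤ (8 * Dm + 1) / r := by
      have := (Nat.ceil_lt_add_one (a := 8 * Dm / r) (by positivity)).le
      have h4 : 1 ≤ 1 / r := by rw [le_div_iff₀ hr]; linarith
      rw [add_div]; linarith
    have h4 : (j : ℝ) ≤ J := by exact_mod_cast hj
    calc (j : ℝ) * ⌈8 * Dm / r⌉₊ ≤ J * ((8 * Dm + 1) / r) := by gcongr
      _ = J * (8 * Dm + 1) / r := by ring
      _ ≤ (J * (8 * Dm + 1) + 1) / r := by gcongr; linarith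
  · intro a ha b hb'
    have h3 := Nat.le_ceil (8 * Dm / r)
    have h4 := hDm (hsub a ha) (hsub b hb')
    have h5 : Dm = 8 * Dm / r * (r / 8) := by field_simp
    calc dist a b ≤ Dm := h4
      _ = 8 * Dm / r * (r / 8) := h5
      _ ≤ _ := by gcongr

lemma start_pt {n : ℕ} (hn : 0 < n) {Ω : Set (EuclideanSpace ℝ (Fin n))} (hΩ : IsOpen Ω)
    (hb : Bornology.IsBounded Ω) (hne : Ω.Nonempty) (hreg : IsC11Boundary Ω) {ε : ℝ} (hε : 0 < ε) :
    ∃ p0 ∈ frontier Ω, ∃ ν : EuclideanSpace ℝ (Fin n), ‖ν‖ = 1 ∧ ∃ t > 0, t ≤ ε ∧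
      ∀ s, 0 < s → s ≤ t → p0 - s • ν ∈ Ω := by
  haveI : Nonempty (Fin n) := ⟨⟨0, hn⟩⟩
  have hfr : (frontier Ω).Nonempty := by
    rw [nonempty_iff_ne_empty]
    intro h
    have hcl : IsClopen Ω := isClopen_iff_frontier_eq_empty.2 h
    rcases isClopen_iff.1 hcl with h | h
    · exact hne.ne_empty h
    · rw [h] at hb
      exact NormedSpace.unbounded_univ ℝ (EuclideanSpace ℝ (Fin n)) hb
  obtain ⟨p, hp⟩ := hfr
  obtain ⟨rc, hrc, ν, hν, φ, K, hφ, -, hch⟩ := hreg p hp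
  refine ⟨p, hp, ν, hν, min (rc/2) ε, by positivity, min_le_right _ _, fun s hs hs' => ?_⟩
  have := hs'.trans (min_le_left _ _)
  exact front_shift hrc hφ.continuous hν (frontier_subset_closure hp) hch hs (by linarith)

lemma fderiv_le_of_C2 {n : ℕ} {Ω : Set (EuclideanSpace ℝ (Fin n))} {u : EuclideanSpace ℝ (Fin n) → ℝ}
    {M : ℝ} (hu : C2BoundOn Ω u M) {x} (hx : x ∈ Ω) : ‖fderiv ℝ u x‖ ≤ M := by
  rw [← norm_iteratedFDeriv_one]; exact (hu.2.2 x hx).1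

lemma C2_on {n : ℕ} {Ω : Set (EuclideanSpace ℝ (Fin n))} {u : EuclideanSpace ℝ (Fin n) → ℝ}
    {M : ℝ} (hu : C2BoundOn Ω u M) : ContDiffOn ℝ 2 u Ω := hu.1.mono subset_closure

lemma C2_diff {n : ℕ} {Ω : Set (EuclideanSpace ℝ (Fin n))} (hΩ : IsOpen Ω) {u : EuclideanSpace ℝ (Fin n) → ℝ}
    {M : ℝ} (hu : C2BoundOn Ω u M) {x} (hx : x ∈ Ω) : DifferentiableAt ℝ u x :=
  ((C2_on hu).contDiffAt (hΩ.mem_nhds hx)).differentiableAt (by norm_num)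

lemma grad_small {n : ℕ} {Ω : Set (EuclideanSpace ℝ (Fin n))} (hΩ : IsOpen Ω)
    {u : EuclideanSpace ℝ (Fin n) → ℝ} {M : ℝ} (hu : C2BoundOn Ω u M) {z} {t Y : ℝ} (ht : 0 < t)
    (hz : closedBall z t ⊆ Ω) (hY : ∀ y ∈ closedBall z t, |u y| ≤ Y) (k : Fin n) :
    |pd k u z| ≤ 2 * Y / t + M * t := by
  have hzz : z ∈ closedBall z t := mem_closedBall_self ht.le
  have hM0 : 0 ≤ M := (norm_nonneg _).trans (fderiv_le_of_C2 hu (hz hzz))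
  have hCd : ∀ y ∈ closedBall z t, ContDiffAt ℝ 2 u y := fun y hy =>
    (C2_on hu).contDiffAt (hΩ.mem_nhds (hz hy))
  have h1 : ∀ y ∈ closedBall z t, ‖fderiv ℝ u y - fderiv ℝ u z‖ ≤ M * t := by
    intro y hy
    have := (convex_closedBall z t).norm_image_sub_le_of_norm_fderiv_le (𝕜 := ℝ) (f := fderiv ℝ u) (C := M)
      (fun w hw => ((hCd w hw).fderiv_right (m := 1) (by norm_num)).differentiableAt (by norm_num))
      (fun w hw => by
        rw [← norm_iteratedFDeriv_one, norm_iteratedFDeriv_fderiv]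
        exact (hu.2.2 w (hz hw)).2) hzz hy
    refine this.trans ?_
    gcongr
    rw [← dist_eq_norm]; exact hy
  have hyk : z + t • EuclideanSpace.single k (1:ℝ) ∈ closedBall z t := by
    rw [mem_closedBall, dist_eq_norm]
    simp [norm_smul, abs_of_pos ht]
  have h2 := (convex_closedBall z t).norm_image_sub_le_of_norm_fderiv_le' (𝕜 := ℝ) (f := u)
    (φ := fderiv ℝ u z) (C := M * t) (fun w hw => (hCd w hw).differentiableAt (by norm_num)) h1 hzz hyk
  rw [add_sub_cancel_left] at h2
  have h3 : ‖t • EuclideanSpace.single k (1:ℝ)‖ = t := by simp [norm_smul, abs_of_pos ht]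
  rw [h3, map_smul, smul_eq_mul] at h2
  change |u _ - u z - t * pd k u z| ≤ _ at h2
  have h4 := hY _ hyk
  have h5 := hY _ hzz
  have h6 : t * |pd k u z| ≤ 2 * Y + M * t * t := by
    have e : t * |pd k u z| = |t * pd k u z| := by rw [abs_mul, abs_of_pos ht]
    rw [e]
    rw [abs_le] at h2 h4 h5 ⊢
    constructor <;> linarith [h2.1, h2.2, h4.1, h4.2, h5.1, h5.2]
  have h7 : 2 * Y / t + M * t = (2 * Y + M * t * t) / t := by field_simp
  rw [h7, le_div_iff₀ ht]; linarith

lemma en_scale {n : ℕ} (u : EuclideanSpace ℝ (Fin n) → ℝ) (ρ : ℝ) (z) :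
    en (fun z => u (ρ • z)) z = u (ρ • z) ^ 2 + ∑ i, (ρ * pd i u (ρ • z)) ^ 2 := by
  unfold en
  simp only [pd_scale]

lemma en_scale_le {n : ℕ} (u : EuclideanSpace ℝ (Fin n) → ℝ) {ρ : ℝ} (hρ : 0 ≤ ρ) (hρ1 : ρ ≤ 1) {z} {P Q : ℝ}
    (h1 : |u (ρ • z)| ≤ P) (h2 : ∀ i, |pd i u (ρ • z)| ≤ Q) :
    en (fun z => u (ρ • z)) z ≤ P ^ 2 + n * Q ^ 2 := by
  rw [en_scale]
  have : ∑ i, (ρ * pd i u (ρ • z)) ^ 2 ≤ ∑ i : Fin n, Q ^ 2 := by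
    refine Finset.sum_le_sum fun i _ => ?_
    rw [← sq_abs]
    refine pow_le_pow_left₀ (abs_nonneg _) ?_ 2
    rw [abs_mul, abs_of_nonneg hρ]
    calc _ ≤ 1 * |pd i u (ρ • z)| := by gcongr
      _ ≤ Q := by linarith [h2 i]
  rw [Finset.sum_const, Finset.card_univ, Fintype.card_fin, nsmul_eq_mul] at this
  have h3 : u (ρ • z) ^ 2 ≤ P ^ 2 := by
    rw [← sq_abs]; exact pow_le_pow_left₀ (abs_nonneg _) h1 2
  linarith

lemma vol_ball_real {n : ℕ} (y : EuclideanSpace ℝ (Fin n)) (r : ℝ) :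
    volume.real (ball y r) = volume.real (ball (0 : EuclideanSpace ℝ (Fin n)) r) := by
  simp only [measureReal_def]
  rw [Measure.addHaar_ball_center]

lemma int_ball_le {n : ℕ} {f : EuclideanSpace ℝ (Fin n) → ℝ} {y : EuclideanSpace ℝ (Fin n)} {r C : ℝ}
    (h0 : ∀ z ∈ ball y r, 0 ≤ f z) (h : ∀ z ∈ ball y r, f z ≤ C) :
    ∫ z in ball y r, f z ≤ C * volume.real (ball (0 : EuclideanSpace ℝ (Fin n)) r) := by
  have := norm_setIntegral_le_of_norm_le_const (μ := volume) (s := ball y r) (f := f) (C := C)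
    measure_ball_lt_top (fun z hz => by rw [Real.norm_eq_abs, abs_of_nonneg (h0 z hz)]; exact h z hz)
  rw [vol_ball_real] at this
  exact (le_abs_self _).trans this

lemma le_int_ball {n : ℕ} {f : EuclideanSpace ℝ (Fin n) → ℝ} {y : EuclideanSpace ℝ (Fin n)} {r C : ℝ}
    (hi : IntegrableOn f (ball y r)) (h : ∀ z ∈ ball y r, C ≤ f z) :
    C * volume.real (ball (0 : EuclideanSpace ℝ (Fin n)) r) ≤ ∫ z in ball y r, f z := by
  have := setIntegral_mono_on (μ := volume) (s := ball y r) (f := fun _ => C) (g := f)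
    (integrableOn_const (measure_ball_lt_top.ne)) hi measurableSet_ball h
  rw [setIntegral_const, vol_ball_real, smul_eq_mul] at this
  linarith

lemma scale_mem {n : ℕ} {ρ : ℝ} (hρ : 0 < ρ) {x z : EuclideanSpace ℝ (Fin n)} :
    dist (ρ • z) x = ρ * dist z (ρ⁻¹ • x) := by
  have : x = ρ • ρ⁻¹ • x := by rw [smul_smul, mul_inv_cancel₀ hρ.ne', one_smul]
  conv_lhs => rw [this]
  rw [dist_smul₀, Real.norm_eq_abs, abs_of_pos hρ]

/-- The chain argument: propagation of a lower bound for the local energy. -/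
lemma chain_energy (n : ℕ) (lam Λ M : ℝ) (hlam : 0 < lam) (hΛ : 4 ≤ Λ) (hMΛ : M ≤ Λ) :
    ∃ b : ℝ, 1 ≤ b ∧ ∃ s0 : ℝ, 1 ≤ s0 ∧
    ∀ (Ω : Set (EuclideanSpace ℝ (Fin n))) (A : Fin n → Fin n → EuclideanSpace ℝ (Fin n) → ℝ)
      (q u : EuclideanSpace ℝ (Fin n) → ℝ), IsOpen Ω → (∀ i j, ContDiffOn ℝ 1 (A i j) Ω) →
      (∀ i j, ∀ x ∈ Ω, A i j x = A j i x) →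
      (∀ i j, ∀ x ∈ Ω, |A i j x| ≤ Λ ∧ ∀ k, |pd k (A i j) x| ≤ Λ) →
      (∀ x ∈ Ω, ∀ ξ : EuclideanSpace ℝ (Fin n), lam * ‖ξ‖ ^ 2 ≤ ∑ i, ∑ j, A i j x * ξ i * ξ j) →
      C2BoundOn Ω u M → (∀ x ∈ Ω, |q x| ≤ M) → IsSolution A q u Ω →
      ∀ r ρ, ρ = r/8 → 0 < r → r ≤ 1 → ∀ s, s0 ≤ s → ∀ N z0 x, Ch (Dp Ω r) ρ N z0 x → z0 ∈ Dp Ω r →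
      Real.exp (-s) ≤ ∫ z in ball (ρ⁻¹ • z0) 1, en (fun z => u (ρ • z)) z →
      Real.exp (-(b ^ N * s)) ≤ ∫ z in ball (ρ⁻¹ • x) 1, en (fun z => u (ρ • z)) z := by
  obtain ⟨b, hb, s0, hs0, H⟩ := propagate n lam Λ
    (max 1 ((M ^ 2 + n * M ^ 2) * volume.real (ball (0 : EuclideanSpace ℝ (Fin n)) 4))) hlam hΛ (le_max_left _ _)
  refine ⟨b, hb, s0, hs0, ?_⟩
  intro Ω A q u hΩ hA1 hsym hbd hell hu hq hsol r ρ hρe hr hr1 s hs N z0 x hch hz0 hE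
  have hadm := scaled_adm hΩ hA1 hsym hbd hell (C2_on hu) hq hMΛ hsol (ρ := ρ) (by rw [hρe]; positivity) (by linarith)
  have hρ : 0 < ρ := by rw [hρe]; positivity
  have hsub4 : ∀ x', x' ∈ Dp Ω r → closedBall (ρ⁻¹ • x') 4 ⊆ (fun z => ρ • z) ⁻¹' Ω := by
    intro x' hx' z hz
    apply hx'
    change dist (ρ • z) x' < r
    rw [scale_mem hρ]
    have : dist z (ρ⁻¹ • x') ≤ 4 := hz
    nlinarith
  induction hch with
  | refl => simpa using hE
  | @step N y y' z' hch' hz' hd ih =>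
    have h1 := ih hz0 hE
    have hK : ∫ x in ball (ρ⁻¹ • z') 4, en (fun z => u (ρ • z)) x ≤
        max 1 ((M ^ 2 + n * M ^ 2) * volume.real (ball (0 : EuclideanSpace ℝ (Fin n)) 4)) := by
      refine le_trans (int_ball_le (fun z _ => en_nonneg _ _) ?_) (le_max_right _ _)
      intro z hz
      have hzΩ := hsub4 z' hz' (ball_subset_closedBall hz)
      exact en_scale_le u hρ.le (by linarith) (hu.2.1 _ (subset_closure hzΩ))
        (fun i => (pd_le_fderiv u _ i).trans (fderiv_le_of_C2 hu hzΩ))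
    have hbN : 1 ≤ b ^ N := one_le_pow₀ hb
    have hs' : s0 ≤ b ^ N * s := by nlinarith
    have h2 := H _ _ _ (ρ⁻¹ • z') hadm (hsub4 z' hz') hK (b ^ N * s) hs' ?_
    · rw [pow_succ]
      convert h2 using 3; ring
    · refine h1.trans ?_
      refine setIntegral_mono_set ?_ ?_ ?_
      · refine (ContinuousOn.integrableOn_compact (isCompact_closedBall (ρ⁻¹ • z') 4) ?_).mono_set
          (ball_subset_closedBall.trans (closedBall_subset_closedBall (by norm_num)))
        exact (en_contOn hadm.hU hadm.hu).mono (hsub4 z' hz')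
      · exact Filter.Eventually.of_forall fun z => en_nonneg _ _
      · refine Filter.Eventually.of_forall ?_
        refine fun z hz => ?_
        have hz1 : dist z (ρ⁻¹ • y') < 1 := hz
        have hz2 : dist (ρ⁻¹ • z') (ρ⁻¹ • y') ≤ 1 := by
          rw [dist_smul₀, Real.norm_eq_abs, abs_of_pos (by positivity)]
          calc ρ⁻¹ * dist z' y' ≤ ρ⁻¹ * ρ := by gcongr
            _ = 1 := inv_mul_cancel₀ hρ.ne'
        change dist z (ρ⁻¹ • z') < 2
        have := dist_triangle_right z (ρ⁻¹ • z') (ρ⁻¹ • y')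
        linarith

lemma start_val {n : ℕ} {Ω : Set (EuclideanSpace ℝ (Fin n))} (hΩ : IsOpen Ω)
    {u : EuclideanSpace ℝ (Fin n) → ℝ} {M η : ℝ} (hM : 0 < M) (hu : C2BoundOn Ω u M)
    {p0 ν : EuclideanSpace ℝ (Fin n)} (hp0 : p0 ∈ frontier Ω) (hν : ‖ν‖ = 1) {t : ℝ} (ht : 0 < t)
    (ht' : t ≤ η / (2 * M)) (hseg : ∀ s, 0 < s → s ≤ t → p0 - s • ν ∈ Ω) (hη : η ≤ |u p0|) :
    η / 2 ≤ |u (p0 - t • ν)| := by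
  have hcont : ContinuousOn (fun s => u (p0 - s • ν)) (Icc 0 t) := by
    refine hu.1.continuousOn.comp (by fun_prop) ?_
    intro s hs
    rcases eq_or_lt_of_le hs.1 with h | h
    · rw [← h]; simpa using frontier_subset_closure hp0
    · exact subset_closure (hseg s h hs.2)
  have hder : ∀ s ∈ Ioo 0 t, HasDerivAt (fun s => u (p0 - s • ν)) (fderiv ℝ u (p0 - s • ν) (-ν)) s := by
    intro s hs
    have h1 := (C2_diff hΩ hu (hseg s hs.1 hs.2.le)).hasFDerivAt
    have h2 : HasDerivAt (fun s : ℝ => p0 - s • ν) (-ν) s := by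
      have := ((hasDerivAt_id s).smul_const ν).const_sub p0
      simpa using this
    exact h1.comp_hasDerivAt s h2
  obtain ⟨c, hc, hc'⟩ := exists_hasDerivAt_eq_slope (fun s => u (p0 - s • ν))
    (fun s => fderiv ℝ u (p0 - s • ν) (-ν)) ht hcont hder
  have h1 : |fderiv ℝ u (p0 - c • ν) (-ν)| ≤ M := by
    have := (fderiv ℝ u (p0 - c • ν)).le_opNorm (-ν)
    rw [norm_neg, hν, mul_one] at this
    exact this.trans (fderiv_le_of_C2 hu (hseg c hc.1 hc.2.le))
  simp only [zero_smul, sub_zero] at hc'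
  rw [hc', abs_div, abs_of_pos ht, div_le_iff₀ ht] at h1
  have h2 : M * t ≤ η / 2 := by
    have := mul_le_mul_of_nonneg_left ht' hM.le
    refine this.trans (le_of_eq ?_)
    field_simp
  have h3 := abs_sub_abs_le_abs_sub (u p0) (u (p0 - t • ν))
  rw [abs_sub_comm] at h3
  linarith

lemma Y_bounds {L s1 r C4 : ℝ} (hr : 0 < r) (hr1 : r ≤ 1) (hL : 0 ≤ L) (hs1 : 1 ≤ s1) (hC4 : 0 < C4) {B : ℝ}
    (hB : B ≤ Real.exp (L / r)) (hB1 : 1 ≤ B) {c : ℝ}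
    (hc : c = L + Real.log (s1 + |Real.log C4| + 1) + 16) :
    √(Real.exp (-Real.exp (c / r))) ≤ r / 8 ∧
    C4 * Real.exp (-Real.exp (c / r)) < Real.exp (-(B * s1)) := by
  have hpos : 1 ≤ s1 + |Real.log C4| + 1 := by linarith [abs_nonneg (Real.log C4)]
  have hlog : 0 ≤ Real.log (s1 + |Real.log C4| + 1) := Real.log_nonneg hpos
  constructor
  · rw [← Real.exp_half]
    have h1 : 16 / r ≤ c / r := by gcongr; linarith
    have h2 : c / r + 1 ≤ Real.exp (c / r) := Real.add_one_le_exp _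
    have h3 : -Real.exp (c / r) / 2 ≤ -(8 / r) := by
      have : 16 / r = 2 * (8 / r) := by ring
      linarith
    refine (Real.exp_le_exp.2 h3).trans ?_
    rw [Real.exp_neg]
    have h4 : 8 / r ≤ Real.exp (8 / r) := by linarith [Real.add_one_le_exp (8 / r)]
    calc (Real.exp (8/r))⁻¹ ≤ (8/r)⁻¹ := by gcongr
      _ = r / 8 := by rw [inv_div]
  · have h1 : Real.log C4 + B * s1 < Real.exp (c / r) := by
      have e : c / r = L / r + (Real.log (s1 + |Real.log C4| + 1) + 16) / r := by rw [hc]; ring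
      have h2 : Real.log (s1 + |Real.log C4| + 1) ≤ (Real.log (s1 + |Real.log C4| + 1) + 16) / r := by
        rw [le_div_iff₀ hr]; nlinarith
      have h3 : s1 + |Real.log C4| + 1 ≤ Real.exp ((Real.log (s1 + |Real.log C4| + 1) + 16) / r) := by
        refine le_trans (le_of_eq ?_) (Real.exp_le_exp.2 h2)
        rw [Real.exp_log (by linarith)]
      rw [e, Real.exp_add]
      have h4 : B * (s1 + |Real.log C4| + 1) ≤
          Real.exp (L / r) * Real.exp ((Real.log (s1 + |Real.log C4| + 1) + 16) / r) := by
        gcongr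
      have h5 : Real.log C4 ≤ B * |Real.log C4| := by
        have := le_abs_self (Real.log C4)
        have h0 := abs_nonneg (Real.log C4)
        nlinarith
      linarith
    calc C4 * Real.exp (-Real.exp (c / r)) = Real.exp (Real.log C4 - Real.exp (c / r)) := by
          rw [Real.exp_sub, Real.exp_log hC4, Real.exp_neg]; rfl
      _ < _ := Real.exp_lt_exp.2 (by linarith)

set_option maxHeartbeats 800000 in
lemma lower_bound {n : ℕ} (hn : 0 < n) {Ω : Set (EuclideanSpace ℝ (Fin n))}
    (hΩo : IsOpen Ω) (hΩb : Bornology.IsBounded Ω) (hne : Ω.Nonempty)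
    (hΩreg : IsC11Boundary Ω) {m : ℕ} (hbl : BrokenLineCond Ω m)
    {A : Fin n → Fin n → EuclideanSpace ℝ (Fin n) → ℝ} (hA : EllipticSym Ω A)
    {M η : ℝ} (hM : 0 < M) (hη : 0 < η) :
    ∃ c > 0, ∃ rs > 0, rs ≤ 1 ∧ ∀ q u : EuclideanSpace ℝ (Fin n) → ℝ,
      (∀ x ∈ Ω, |q x| ≤ M) → C2BoundOn Ω u M → IsSolution A q u Ω →
      (∀ x ∈ frontier Ω, η ≤ |u x|) → ∀ r, 0 < r → r ≤ rs → ∀ x, ball x r ⊆ Ω →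
      ∃ z ∈ ball x (r / 2), Real.exp (-Real.exp (c / r)) ≤ |u z| := by
  obtain ⟨hsym, hA1, lam, hlam, hell⟩ := hA
  have hB : ∃ Λ0, ∀ i j, ∀ x ∈ Ω, |A i j x| ≤ Λ0 ∧ ∀ k, |pd k (A i j) x| ≤ Λ0 := by
    choose C hC using fun i j => bound_C1 hΩo hΩb (hA1 i j)
    have hle : ∀ i j, C i j ≤ ∑ i, ∑ j, |C i j| := by
      intro i j
      calc C i j ≤ |C i j| := le_abs_self _
        _ ≤ ∑ j, |C i j| := Finset.single_le_sum (f := fun j => |C i j|) (fun _ _ => abs_nonneg _) (Finset.mem_univ j)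
        _ ≤ _ := Finset.single_le_sum (f := fun i => ∑ j, |C i j|)
          (fun _ _ => Finset.sum_nonneg fun _ _ => abs_nonneg _) (Finset.mem_univ i)
    exact ⟨_, fun i j x hx => ⟨(hC i j x hx).1.trans (hle i j), fun k => ((hC i j x hx).2 k).trans (hle i j)⟩⟩
  obtain ⟨Λ0, hΛ0⟩ := hB
  obtain ⟨b, hb, s0, hs0, HE⟩ := chain_energy n lam (max 4 (max M Λ0)) M hlam (le_max_left _ _)
    ((le_max_left _ _).trans (le_max_right _ _))
  obtain ⟨p0, hp0, ν, hν, t, ht, ht', hseg⟩ := start_pt hn hΩo hΩb hne hΩreg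
    (ε := η / (2 * M)) (by positivity)
  have hz0 : p0 - t • ν ∈ Ω := hseg t ht le_rfl
  obtain ⟨z0, hz0e⟩ : ∃ z0, z0 = p0 - t • ν := ⟨_, rfl⟩
  rw [← hz0e] at hz0
  obtain ⟨L0, hL0, rs, hrs, hrs1, Hch⟩ := chains hΩo hΩb hbl hΩreg hz0
  obtain ⟨δ0, hδ0, hball0⟩ := Metric.isOpen_iff.1 hΩo z0 hz0
  obtain ⟨v1, hv1⟩ : ∃ v1, v1 = volume.real (ball (0 : EuclideanSpace ℝ (Fin n)) 1) := ⟨_, rfl⟩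
  have hv1p : 0 < v1 := by
    rw [hv1, measureReal_def]
    exact ENNReal.toReal_pos (measure_ball_pos _ _ one_pos).ne' measure_ball_lt_top.ne
  obtain ⟨s1, hs1e⟩ : ∃ s1, s1 = max s0 (-Real.log ((η/4)^2 * v1)) := ⟨_, rfl⟩
  have hs1 : s0 ≤ s1 := by rw [hs1e]; exact le_max_left _ _
  have hs1' : Real.exp (-s1) ≤ (η/4)^2 * v1 := by
    have : -Real.log ((η/4)^2 * v1) ≤ s1 := by rw [hs1e]; exact le_max_right _ _
    calc Real.exp (-s1) ≤ Real.exp (Real.log ((η/4)^2 * v1)) := Real.exp_le_exp.2 (by linarith)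
      _ = _ := Real.exp_log (by positivity)
  obtain ⟨C4, hC4⟩ : ∃ C4, C4 = (1 + n * (2 + M)^2) * v1 := ⟨_, rfl⟩
  have hC4p : 0 < C4 := by rw [hC4]; positivity
  have hlb : 0 ≤ Real.log b := Real.log_nonneg hb
  obtain ⟨c, hc⟩ : ∃ c, c = L0 * Real.log b + Real.log (s1 + |Real.log C4| + 1) + 16 := ⟨_, rfl⟩
  have hcp : 0 < c := by
    have : 0 ≤ Real.log (s1 + |Real.log C4| + 1) :=
      Real.log_nonneg (by linarith [abs_nonneg (Real.log C4)])
    rw [hc]; positivity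
  refine ⟨c, hcp, min rs (min δ0 (η / (4 * M))), by positivity, (min_le_left _ _).trans hrs1, ?_⟩
  intro q u hq hu hsol hub r hr hrr x hx
  have hr1 : r ≤ rs := hrr.trans (min_le_left _ _)
  have hr2 : r ≤ δ0 := hrr.trans ((min_le_right _ _).trans (min_le_left _ _))
  have hr3 : r ≤ η / (4 * M) := hrr.trans ((min_le_right _ _).trans (min_le_right _ _))
  obtain ⟨N, hN, hch⟩ := Hch r hr hr1 x hx
  obtain ⟨ρ, hρe⟩ : ∃ ρ, ρ = r / 8 := ⟨_, rfl⟩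
  rw [← hρe] at hch
  have hρ : 0 < ρ := by rw [hρe]; positivity
  have hball : ball z0 r ⊆ Ω := (ball_subset_ball hr2).trans hball0
  have hdiff := fun y (hy : y ∈ Ω) => C2_diff hΩo hu hy
  have hu0 : η / 2 ≤ |u z0| := by
    rw [hz0e]; exact start_val hΩo hM hu hp0 hν ht ht' hseg (hub p0 hp0)
  have hnear : ∀ y ∈ ball z0 r, η / 4 ≤ |u y| := by
    intro y hy
    have := (convex_ball z0 r).norm_image_sub_le_of_norm_fderiv_le (𝕜 := ℝ) (f := u) (C := M)
      (fun w hw => hdiff w (hball hw)) (fun w hw => fderiv_le_of_C2 hu (hball hw)) hy (mem_ball_self hr)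
    have h2 : ‖z0 - y‖ ≤ r := by rw [← dist_eq_norm, dist_comm]; exact (le_of_lt hy)
    have h3 : M * ‖z0 - y‖ ≤ η / 4 := by
      calc M * ‖z0 - y‖ ≤ M * (η / (4 * M)) := by gcongr; linarith
        _ = η / 4 := by field_simp
    have h4 := abs_sub_abs_le_abs_sub (u z0) (u y)
    rw [Real.norm_eq_abs] at this
    linarith
  have hcont : ∀ y, ball y r ⊆ Ω → IntegrableOn (en (fun z => u (ρ • z))) (ball (ρ⁻¹ • y) 1) := by
    intro y hy
    have hsub : closedBall (ρ⁻¹ • y) 1 ⊆ (fun z => ρ • z) ⁻¹' Ω := by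
      intro z hz
      apply hy
      change dist (ρ • z) y < r
      rw [scale_mem hρ]
      have : dist z (ρ⁻¹ • y) ≤ 1 := hz
      nlinarith
    refine (ContinuousOn.integrableOn_compact (isCompact_closedBall (ρ⁻¹ • y) 1) ?_).mono_set
      ball_subset_closedBall
    refine (en_contOn (hΩo.preimage (continuous_const_smul ρ)) ?_).mono hsub
    exact (C2_on hu).comp (contDiff_const_smul ρ).contDiffOn (fun x hx => hx)
  have hmem : ∀ y z : EuclideanSpace ℝ (Fin n), z ∈ ball (ρ⁻¹ • y) 1 → dist (ρ • z) y < ρ := by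
    intro y z hz
    rw [scale_mem hρ]
    have : dist z (ρ⁻¹ • y) < 1 := hz
    nlinarith
  have hstart : Real.exp (-s1) ≤ ∫ z in ball (ρ⁻¹ • z0) 1, en (fun z => u (ρ • z)) z := by
    refine hs1'.trans ?_
    rw [hv1]
    refine le_int_ball (hcont z0 hball) fun z hz => ?_
    have h1 : ρ • z ∈ ball z0 r := by
      have := hmem z0 z hz
      rw [mem_ball]; linarith
    have h2 := hnear _ h1
    rw [en_scale]
    have h3 : (η/4)^2 ≤ u (ρ • z) ^ 2 := by
      rw [← sq_abs (u _)]; exact pow_le_pow_left₀ (by positivity) h2 2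
    have h4 : 0 ≤ ∑ i, (ρ * pd i u (ρ • z)) ^ 2 := Finset.sum_nonneg fun _ _ => sq_nonneg _
    linarith
  have hend := HE Ω A q u hΩo (fun i j => (hA1 i j).mono subset_closure)
    (fun i j x hx => hsym i j x (subset_closure hx))
    (fun i j x hx => ⟨(hΛ0 i j x hx).1.trans ((le_max_right _ _).trans (le_max_right _ _)),
      fun k => ((hΛ0 i j x hx).2 k).trans ((le_max_right _ _).trans (le_max_right _ _))⟩)
    hell hu hq hsol r ρ hρe hr (hr1.trans hrs1) s1 hs1 N z0 x hch hball hstart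
  by_contra hcon
  push Not at hcon
  obtain ⟨Y, hY⟩ : ∃ Y, Y = Real.exp (-Real.exp (c / r)) := ⟨_, rfl⟩
  have hbN : b ^ N ≤ Real.exp (L0 * Real.log b / r) := by
    have : b ^ N = Real.exp (N * Real.log b) := by
      rw [← Real.log_pow, Real.exp_log (by positivity)]
    rw [this]
    refine Real.exp_le_exp.2 ?_
    calc N * Real.log b ≤ L0 / r * Real.log b := by gcongr
      _ = _ := by ring
  obtain ⟨hY1, hY2⟩ := Y_bounds (C4 := C4) (s1 := s1) hr (hr1.trans hrs1) (by positivity : 0 ≤ L0 * Real.log b)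
    (hs0.trans hs1) hC4p hbN (one_le_pow₀ hb) hc
  rw [← hY] at hY1 hY2 hcon
  have hYp : 0 < Y := by rw [hY]; exact Real.exp_pos _
  have hYle : Y ≤ 1 := by rw [hY]; exact Real.exp_le_one_iff.2 (by linarith [Real.exp_pos (c/r)])
  have hsq : √Y * √Y = Y := Real.mul_self_sqrt hYp.le
  have hsp : 0 < √Y := Real.sqrt_pos.2 hYp
  refine absurd (hend.trans ?_) (not_le.2 hY2)
  have hgoal : C4 * Y = (1 + n * (2 + M)^2) * Y * volume.real (ball (0 : EuclideanSpace ℝ (Fin n)) 1) := by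
    rw [hC4, hv1]; ring
  rw [hgoal]
  refine int_ball_le (fun z _ => en_nonneg _ _) fun z hz => ?_
  have hzx := hmem x z hz
  have hcb : closedBall (ρ • z) (√Y) ⊆ ball x (r/2) := by
    intro w hw
    have : dist w (ρ • z) ≤ √Y := hw
    rw [mem_ball]
    linarith [dist_triangle w (ρ • z) x]
  have hr2' : ball x (r/2) ⊆ Ω := (ball_subset_ball (by linarith)).trans hx
  have hg : ∀ i, |pd i u (ρ • z)| ≤ (2 + M) * √Y := by
    intro i
    have := grad_small hΩo hu hsp (hcb.trans hr2') (fun y hy => (hcon y (hcb hy)).le) i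
    refine this.trans (le_of_eq ?_)
    have : 2 * Y / √Y = 2 * √Y := by
      rw [div_eq_iff hsp.ne']; linarith
    rw [this]; ring
  have := en_scale_le u hρ.le (by linarith) (hcon _ (hcb (mem_closedBall_self hsp.le))).le hg
  refine this.trans ?_
  have h5 : ((2 + M) * √Y)^2 = (2+M)^2 * Y := by rw [mul_pow, sq (√Y), hsq]
  rw [h5]
  have h6 : Y ^ 2 ≤ Y := by
    rw [sq]; exact mul_le_of_le_one_left hYp.le hYle
  linarith

lemma E_dec {u v uk vk q Q qk Qk α β σ τ w wk : ℝ} (hα : 0 < α) (hβ : 0 < β) (hq : q = α ^ 2)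
    (hQ : Q = β ^ 2) (hσ : σ = 1 ∨ σ = -1) (hτ : τ = 1 ∨ τ = -1) (hw : w = α * (σ * u) - β * (τ * v))
    (hwk : wk = σ * (qk * u / (2 * α) + α * uk) - τ * (Qk * v / (2 * β) + β * vk)) :
    v * uk - u * vk = 1 / 2 * (u * v) * (Qk / Q - qk / q) +
      σ * τ * (wk * (α * (σ * u)) - σ * (qk * u / (2 * α) + α * uk) * w) / (α * β) := by
  have h1 : σ * τ * (wk * (α * (σ * u)) - σ * (qk * u / (2 * α) + α * uk) * w) =
      (qk * u / (2 * α) + α * uk) * (β * v) - (Qk * v / (2 * β) + β * vk) * (α * u) := by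
    rw [hw, hwk]
    rcases hσ with rfl | rfl <;> rcases hτ with rfl | rfl <;> ring
  rw [h1, hq, hQ]
  field_simp
  ring

lemma E_bd {u v uk vk q Q qk Qk α β σ τ w wk B ω : ℝ} (hB : 1 ≤ B) (hα : 0 < α) (hβ : 0 < β)
    (hq : q = α ^ 2) (hQ : Q = β ^ 2) (hσ : σ = 1 ∨ σ = -1) (hτ : τ = 1 ∨ τ = -1)
    (hw : w = α * (σ * u) - β * (τ * v))
    (hwk : wk = σ * (qk * u / (2 * α) + α * uk) - τ * (Qk * v / (2 * β) + β * vk))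
    (hqB : 1 ≤ B * q) (hQB : 1 ≤ B * Q) (hqB' : q ≤ B) (hu : |u| ≤ B) (huk : |uk| ≤ B)
    (hqk : |qk| ≤ B) (hω : |w| + |wk| ≤ ω) :
    ∃ E, v * uk - u * vk = 1 / 2 * (u * v) * (Qk / Q - qk / q) + E ∧ |E| ≤ 2 * B ^ 5 * ω := by
  refine ⟨_, E_dec hα hβ hq hQ hσ hτ hw hwk, ?_⟩
  have hα1 : 1 ≤ B * α := by
    have : 1 ^ 2 ≤ (B * α) ^ 2 := by
      rw [mul_pow, ← hq]; nlinarith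
    exact le_of_sq_le_sq this (by positivity) |> fun h => h
  have hβ1 : 1 ≤ B * β := by
    have : 1 ^ 2 ≤ (B * β) ^ 2 := by
      rw [mul_pow, ← hQ]; nlinarith
    exact le_of_sq_le_sq this (by positivity) |> fun h => h
  have hαB : α ≤ B := by nlinarith
  have hαi : 1 / α ≤ B := by rw [div_le_iff₀ hα]; exact hα1
  have hβi : 1 / β ≤ B := by rw [div_le_iff₀ hβ]; exact hβ1
  have hσa : |σ| = 1 := by rcases hσ with rfl | rfl <;> simp
  have hτa : |τ| = 1 := by rcases hτ with rfl | rfl <;> simp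
  have hJ : |α * (σ * u)| ≤ B ^ 2 := by
    rw [abs_mul, abs_mul, hσa, abs_of_pos hα, one_mul, sq]; gcongr
  have hJk : |σ * (qk * u / (2 * α) + α * uk)| ≤ 2 * B ^ 3 := by
    rw [abs_mul, hσa, one_mul]
    have h1 : |qk * u / (2 * α)| ≤ B ^ 3 := by
      have : qk * u / (2 * α) = qk * u * (1 / α) * (1/2) := by field_simp
      rw [this, abs_mul, abs_mul, abs_mul, abs_of_pos (by positivity : 0 < 1/α)]
      have : |qk| * |u| * (1/α) ≤ B * B * B := by gcongr
      rw [abs_of_pos (by norm_num : (0:ℝ) < 1/2)]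
      nlinarith [pow_pos (by linarith : 0 < B) 3]
    have h2 : |α * uk| ≤ B ^ 3 := by
      rw [abs_mul, abs_of_pos hα]
      calc α * |uk| ≤ B * B := by gcongr
        _ ≤ B * B * B := le_mul_of_one_le_right (by positivity) hB
        _ = B ^ 3 := by ring
    linarith [abs_add_le (qk * u / (2 * α)) (α * uk)]
  rw [abs_div, abs_mul, abs_mul, hσa, hτa, abs_of_pos (by positivity : 0 < α * β)]
  have h3 : |wk * (α * (σ * u)) - σ * (qk * u / (2 * α) + α * uk) * w| ≤ 2 * B ^ 3 * ω := by
    have e1 : |wk * (α * (σ * u))| ≤ |wk| * (2 * B ^ 3) := by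
      rw [abs_mul wk]
      have : B ^ 2 ≤ 2 * B ^ 3 := by nlinarith [pow_pos (by linarith : 0 < B) 2]
      gcongr; linarith
    have e2 : |σ * (qk * u / (2 * α) + α * uk) * w| ≤ 2 * B ^ 3 * |w| := by
      rw [abs_mul _ w]; gcongr
    have e3 := abs_sub (wk * (α * (σ * u))) (σ * (qk * u / (2 * α) + α * uk) * w)
    have e4 : 2 * B ^ 3 * (|w| + |wk|) ≤ 2 * B ^ 3 * ω := by gcongr
    linarith
  have hω0 : 0 ≤ ω := le_trans (by positivity) hω
  calc 1 * 1 * |wk * (α * (σ * u)) - σ * (qk * u / (2 * α) + α * uk) * w| / (α * β)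
      = |wk * (α * (σ * u)) - σ * (qk * u / (2 * α) + α * uk) * w| * (1 / α) * (1 / β) := by field_simp
    _ ≤ 2 * B ^ 3 * ω * B * B := by gcongr
    _ = _ := by ring

lemma gp_facts {T ε s γ : ℝ} (hε : 0 < ε) (hs : 0 < s) (hs2 : s ^ 2 = T ^ 2 + ε ^ 2) (hγ : γ = ε ^ 2 / s ^ 3) :
    0 ≤ γ ∧ γ ≤ 1 / ε ∧ γ * |T| ≤ 1 ∧ γ * T ^ 2 ≤ ε ∧ |T / s| ≤ 1 ∧ |T| - ε ≤ T / s * T := by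
  have hεs : ε ≤ s := by
    apply le_of_sq_le_sq _ hs.le; nlinarith
  have hTs : |T| ≤ s := by
    apply le_of_sq_le_sq _ hs.le; rw [sq_abs]; nlinarith
  have hs3 : 0 < s ^ 3 := by positivity
  have hγ0 : 0 ≤ γ := by rw [hγ]; positivity
  refine ⟨hγ0, ?_, ?_, ?_, ?_, ?_⟩
  · rw [hγ, div_le_div_iff₀ hs3 hε]
    calc ε ^ 2 * ε = ε ^ 3 := by ring
      _ ≤ s ^ 3 := by gcongr
      _ = _ := by ring
  · rw [hγ, div_mul_eq_mul_div, div_le_one hs3]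
    calc ε ^ 2 * |T| ≤ s ^ 2 * s := by gcongr
      _ = _ := by ring
  · rw [hγ, div_mul_eq_mul_div, div_le_iff₀ hs3]
    have : T ^ 2 ≤ s ^ 2 := by nlinarith
    calc ε ^ 2 * T ^ 2 = ε * (ε * T ^ 2) := by ring
      _ ≤ ε * (s * s ^ 2) := by gcongr
      _ = _ := by ring
  · rw [abs_div, abs_of_pos hs, div_le_one hs]; exact hTs
  · rw [div_mul_eq_mul_div, le_div_iff₀ hs]
    have hsum : s ≤ |T| + ε := by
      apply le_of_sq_le_sq _ (by positivity)
      have := sq_abs T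
      nlinarith [abs_nonneg T]
    have h2 := sq_abs T
    rcases le_total ε (|T|) with h | h
    · calc (|T| - ε) * s ≤ (|T| - ε) * (|T| + ε) := by
            apply mul_le_mul_of_nonneg_left hsum; linarith
        _ ≤ T * T := by nlinarith
    · have : (|T| - ε) * s ≤ 0 := mul_nonpos_of_nonpos_of_nonneg (by linarith) hs.le
      nlinarith [mul_self_nonneg T]

lemma alg_ne {n : ℕ} {B ω T w P R e ε s γ : ℝ} {a : Fin n → Fin n → ℝ} {t E Tk W : Fin n → ℝ}
    (hB : 1 ≤ B) (hn : (n : ℝ) ≤ B) (ha : ∀ k j, |a k j| ≤ B)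
    (hpsd : ∀ ξ : Fin n → ℝ, 0 ≤ ∑ k, ∑ j, a k j * ξ k * ξ j)
    (hW : ∀ k, W k = ∑ j, a k j * (1 / 2 * T * t j + E j))
    (ht : ∀ k, |t k| ≤ 2 * B ^ 2) (hE : ∀ k, |E k| ≤ 2 * B ^ 5 * ω) (hTk : ∀ k, |Tk k| ≤ 2 * B ^ 2)
    (hTk2 : ∀ k, Tk k ^ 2 ≤ 4 * B ^ 5 * (|T| + w ^ 2)) (hw : |w| ≤ ω) (hwB : |w| ≤ 2 * B ^ 2)
    (hP0 : 0 ≤ P) (hPB : P ≤ B ^ 2) (hR : |R| ≤ B) (hPR : 0 ≤ P ^ 2 * R) (he : 0 < e) (he1 : e ≤ 1)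
    (hε : ε = e ^ 2) (hs : 0 < s) (hs2 : s ^ 2 = T ^ 2 + ε ^ 2) (hγ : γ = ε ^ 2 / s ^ 3) :
    P ^ 2 * R * |T| ≤ (∑ k, (2 * P * t k * (T / s) * W k + P ^ 2 * γ * Tk k * W k))
      + P ^ 2 * (T / s) * (R * T) + 20 * B ^ 16 * (ω / ε + e) := by
  have hεp : 0 < ε := by rw [hε]; positivity
  have hε1 : ε ≤ 1 := by rw [hε]; exact pow_le_one₀ he.le he1
  have hεe : ε ≤ e := by rw [hε, sq]; exact mul_le_of_le_one_left he.le he1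
  obtain ⟨hγ0, hγ1, hγT, hγT2, hg1, hgT⟩ := gp_facts hεp hs hs2 hγ
  have hω0 : 0 ≤ ω := (abs_nonneg _).trans hw
  have hB0 : 0 < B := by linarith
  have pw : ∀ i j : ℕ, i ≤ j → B ^ i ≤ B ^ j := fun i j h => pow_le_pow_right₀ hB h
  have hωε : ω ≤ ω / ε := by rw [le_div_iff₀ hεp]; exact mul_le_of_le_one_right hω0 hε1
  have hωε0 : 0 ≤ ω / ε := hω0.trans hωε
  -- first term
  have h1 : -(8 * B ^ 12 * ω) ≤ ∑ k, 2 * P * t k * (T / s) * W k := by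
    have e1 : ∑ k, 2 * P * t k * (T / s) * W k = P * (T ^ 2 / s) * (∑ k, ∑ j, a k j * t k * t j)
        + 2 * P * (T / s) * ∑ k, ∑ j, t k * (a k j * E j) := by
      rw [Finset.mul_sum, Finset.mul_sum, ← Finset.sum_add_distrib]
      refine Finset.sum_congr rfl fun k _ => ?_
      rw [hW, Finset.mul_sum, Finset.mul_sum, Finset.mul_sum, ← Finset.sum_add_distrib]
      refine Finset.sum_congr rfl fun j _ => ?_
      field_simp
    have e2 : 0 ≤ P * (T ^ 2 / s) * (∑ k, ∑ j, a k j * t k * t j) :=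
      mul_nonneg (by positivity) (hpsd t)
    have e3 : |2 * P * (T / s) * ∑ k, ∑ j, t k * (a k j * E j)| ≤
        (2 * B ^ 2 * 1) * (n * (n * (2 * B ^ 2 * (B * (2 * B ^ 5 * ω))))) := by
      refine abs_mul_bd (abs_mul_bd ?_ hg1) (abs_sum_bd fun k => abs_sum_bd fun j =>
        abs_mul_bd (ht k) (abs_mul_bd (ha k j) (hE j)))
      rw [abs_of_nonneg (by positivity)]; gcongr
    have e4 : (2 * B ^ 2 * 1) * (n * (n * (2 * B ^ 2 * (B * (2 * B ^ 5 * ω))))) ≤ 8 * B ^ 12 * ω := by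
      calc _ ≤ (2 * B ^ 2 * 1) * (B * (B * (2 * B ^ 2 * (B * (2 * B ^ 5 * ω))))) := by gcongr
        _ = _ := by ring
    rw [e1]
    linarith [neg_abs_le (2 * P * (T / s) * ∑ k, ∑ j, t k * (a k j * E j))]
  -- second term
  have hWb : ∀ k, |W k| ≤ B ^ 4 * |T| + 2 * B ^ 7 * ω := by
    intro k
    rw [hW]
    have : |∑ j, a k j * (1 / 2 * T * t j + E j)| ≤ n * (B * (B ^ 2 * |T| + 2 * B ^ 5 * ω)) := by
      refine abs_sum_bd fun j => abs_mul_bd (ha k j) (abs_add_bd ?_ (hE j))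
      rw [abs_mul, abs_mul]
      have := ht j
      have h0 := abs_nonneg T
      rw [abs_of_pos (by norm_num : (0:ℝ) < 1/2)]
      calc 1 / 2 * |T| * |t j| ≤ 1 / 2 * |T| * (2 * B ^ 2) := by gcongr
        _ = _ := by ring
    refine this.trans ?_
    calc n * (B * (B ^ 2 * |T| + 2 * B ^ 5 * ω)) ≤ B * (B * (B ^ 2 * |T| + 2 * B ^ 5 * ω)) := by gcongr
      _ = _ := by ring
  have hTT : ∀ k, γ * |T| * |Tk k| ≤ 3 * B ^ 5 * e + 4 * B ^ 7 * (ω / ε) := by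
    intro k
    have f1 : |Tk k| ≤ (e + Tk k ^ 2 / e) / 2 := by
      have : (e + Tk k ^ 2 / e) / 2 = (e ^ 2 + Tk k ^ 2) / (2 * e) := by field_simp
      rw [this, le_div_iff₀ (by positivity)]
      have h0 := sq_abs (Tk k)
      nlinarith [sq_nonneg (|Tk k| - e)]
    have f2 : Tk k ^ 2 / e ≤ 4 * B ^ 5 * (|T| + w ^ 2) / e := by gcongr; exact hTk2 k
    have f3 : γ * |T| * |Tk k| ≤ γ * |T| * ((e + 4 * B ^ 5 * (|T| + w ^ 2) / e) / 2) := by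
      gcongr; linarith
    have f4 : γ * |T| * ((e + 4 * B ^ 5 * (|T| + w ^ 2) / e) / 2) =
      (γ * |T|) * e / 2 + 2 * B ^ 5 * ((γ * |T| ^ 2) / e) + 2 * B ^ 5 * ((γ * |T|) * (w ^ 2 / e)) := by
      field_simp; ring
    have f5 : (γ * |T|) * e ≤ e := mul_le_of_le_one_left he.le hγT
    have f6 : (γ * |T| ^ 2) / e ≤ e := by
      rw [sq_abs, div_le_iff₀ he]; rw [hε] at hγT2; linarith
    have f7 : w ^ 2 / e ≤ 2 * B ^ 2 * (ω / ε) := by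
      have g1 : w ^ 2 ≤ 2 * B ^ 2 * ω := by
        rw [← sq_abs, sq]; gcongr
      calc w ^ 2 / e ≤ 2 * B ^ 2 * ω / ε := by gcongr
        _ = _ := by ring
    have f8 : (γ * |T|) * (w ^ 2 / e) ≤ 2 * B ^ 2 * (ω / ε) :=
      (mul_le_of_le_one_left (by positivity) hγT).trans f7
    have f9 : 2 * B ^ 5 * ((γ * |T| ^ 2) / e) ≤ 2 * B ^ 5 * e := by gcongr
    have f10 : 2 * B ^ 5 * ((γ * |T|) * (w ^ 2 / e)) ≤ 2 * B ^ 5 * (2 * B ^ 2 * (ω / ε)) := by gcongr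
    have f11 : e ≤ B ^ 5 * e := le_mul_of_one_le_left he.le (one_le_pow₀ hB)
    have f12 : 2 * B ^ 5 * (2 * B ^ 2 * (ω / ε)) = 4 * B ^ 7 * (ω / ε) := by ring
    linarith
  have h2 : |∑ k, P ^ 2 * γ * Tk k * W k| ≤ 3 * B ^ 14 * e + 8 * B ^ 16 * (ω / ε) := by
    have e1 : ∀ k, |P ^ 2 * γ * Tk k * W k| ≤
        B ^ 4 * (B ^ 4 * (3 * B ^ 5 * e + 4 * B ^ 7 * (ω / ε)) + 4 * B ^ 9 * (ω / ε)) := by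
      intro k
      have g0 : |P ^ 2 * γ * Tk k * W k| = P ^ 2 * (γ * |Tk k| * |W k|) := by
        rw [abs_mul, abs_mul, abs_of_nonneg (by positivity)]; ring
      rw [g0]
      have g1 : γ * |Tk k| * |W k| ≤ γ * |Tk k| * (B ^ 4 * |T| + 2 * B ^ 7 * ω) := by
        gcongr; exact hWb k
      have g2 : γ * |Tk k| * (B ^ 4 * |T| + 2 * B ^ 7 * ω) =
        B ^ 4 * (γ * |T| * |Tk k|) + 2 * B ^ 7 * (γ * ω * |Tk k|) := by ring
      have g3 : γ * ω * |Tk k| ≤ 1 / ε * ω * (2 * B ^ 2) := by gcongr; exact hTk k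
      have g4 : 2 * B ^ 7 * (γ * ω * |Tk k|) ≤ 2 * B ^ 7 * (1 / ε * ω * (2 * B ^ 2)) := by gcongr
      have g5 : 2 * B ^ 7 * (1 / ε * ω * (2 * B ^ 2)) = 4 * B ^ 9 * (ω / ε) := by ring
      have g6 : B ^ 4 * (γ * |T| * |Tk k|) ≤ B ^ 4 * (3 * B ^ 5 * e + 4 * B ^ 7 * (ω / ε)) := by
        gcongr; exact hTT k
      have g7 : P ^ 2 ≤ B ^ 4 := by
        calc P ^ 2 ≤ (B ^ 2) ^ 2 := by gcongr
          _ = _ := by ring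
      have g8 : γ * |Tk k| * |W k| ≤ B ^ 4 * (3 * B ^ 5 * e + 4 * B ^ 7 * (ω / ε)) + 4 * B ^ 9 * (ω / ε) := by
        linarith
      exact mul_le_mul g7 g8 (by positivity) (by positivity)
    refine (abs_sum_bd e1).trans ?_
    calc n * (B ^ 4 * (B ^ 4 * (3 * B ^ 5 * e + 4 * B ^ 7 * (ω / ε)) + 4 * B ^ 9 * (ω / ε)))
        ≤ B * (B ^ 4 * (B ^ 4 * (3 * B ^ 5 * e + 4 * B ^ 7 * (ω / ε)) + 4 * B ^ 9 * (ω / ε))) := by gcongr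
      _ = 3 * B ^ 14 * e + 4 * B ^ 16 * (ω / ε) + 4 * B ^ 14 * (ω / ε) := by ring
      _ ≤ _ := by
        have := mul_le_mul_of_nonneg_right (pw 14 16 (by norm_num)) hωε0
        linarith
  have h3 : P ^ 2 * R * |T| - B ^ 5 * ε ≤ P ^ 2 * (T / s) * (R * T) := by
    have e1 : P ^ 2 * (T / s) * (R * T) = P ^ 2 * R * (T / s * T) := by ring
    rw [e1]
    have e2 := mul_le_mul_of_nonneg_left hgT hPR
    have e3 : P ^ 2 * R ≤ B ^ 5 := by
      have : R ≤ B := (le_abs_self _).trans hR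
      calc P ^ 2 * R ≤ P ^ 2 * B := by gcongr
        _ ≤ (B ^ 2) ^ 2 * B := by gcongr
        _ = _ := by ring
    have e4 : P ^ 2 * R * ε ≤ B ^ 5 * ε := by gcongr
    linarith
  rw [Finset.sum_add_distrib]
  have k1 := mul_le_mul_of_nonneg_right (pw 12 16 (by norm_num)) hωε0
  have k1' : 8 * B ^ 12 * ω ≤ 8 * B ^ 12 * (ω / ε) := by gcongr
  have k2 := mul_le_mul_of_nonneg_right (pw 14 16 (by norm_num)) he.le
  have k3 := mul_le_mul_of_nonneg_right (pw 5 16 (by norm_num)) he.le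
  have k4 : B ^ 5 * ε ≤ B ^ 5 * e := by gcongr
  have k5 : 0 ≤ B ^ 16 * (ω / ε) := by positivity
  have k6 : 0 ≤ B ^ 16 * e := by positivity
  linarith [neg_abs_le (∑ k, P ^ 2 * γ * Tk k * W k)]

lemma alg_zero {n : ℕ} {B ω w P e ε s γ T R : ℝ} {t Tk W : Fin n → ℝ}
    (hB : 1 ≤ B) (hn : (n : ℝ) ≤ B) (hT : T = 0)
    (hTW : ∀ k, |Tk k * W k| ≤ B ^ 5 * w ^ 2)
    (hw : |w| ≤ ω) (hwB : |w| ≤ 2 * B ^ 2) (hP0 : 0 ≤ P) (hPB : P ≤ B ^ 2)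
    (he : 0 < e) (hε : ε = e ^ 2) (hs : 0 < s) (hs2 : s ^ 2 = T ^ 2 + ε ^ 2)
    (hγ : γ = ε ^ 2 / s ^ 3) :
    P ^ 2 * R * |T| ≤ (∑ k, (2 * P * t k * (T / s) * W k + P ^ 2 * γ * Tk k * W k))
      + P ^ 2 * (T / s) * (R * T) + 20 * B ^ 16 * (ω / ε + e) := by
  have hεp : 0 < ε := by rw [hε]; positivity
  obtain ⟨hγ0, hγ1, -⟩ := gp_facts hεp hs hs2 hγ
  have hω0 : 0 ≤ ω := (abs_nonneg _).trans hw
  have hB0 : 0 < B := by linarith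
  subst hT
  simp only [abs_zero, mul_zero, zero_div, zero_mul, zero_add, add_zero]
  have h1 : |∑ k, P ^ 2 * γ * Tk k * W k| ≤ n * (B ^ 4 * (1 / ε) * (B ^ 5 * (2 * B ^ 2 * ω))) := by
    refine abs_sum_bd fun k => ?_
    rw [mul_assoc]
    have g7 : P ^ 2 ≤ B ^ 4 := by
      calc P ^ 2 ≤ (B ^ 2) ^ 2 := by gcongr
        _ = _ := by ring
    refine abs_mul_bd ?_ ((hTW k).trans ?_)
    · rw [abs_of_nonneg (by positivity)]; gcongr
    · have g1 : w ^ 2 ≤ 2 * B ^ 2 * ω := by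
        rw [← sq_abs, sq]; gcongr
      gcongr
  have h2 : n * (B ^ 4 * (1 / ε) * (B ^ 5 * (2 * B ^ 2 * ω))) ≤ 20 * B ^ 16 * (ω / ε + e) := by
    calc n * (B ^ 4 * (1 / ε) * (B ^ 5 * (2 * B ^ 2 * ω)))
        ≤ B * (B ^ 4 * (1 / ε) * (B ^ 5 * (2 * B ^ 2 * ω))) := by gcongr
      _ = 2 * B ^ 12 * (ω / ε + 0) := by ring
      _ ≤ 20 * B ^ 16 * (ω / ε + e) := by
        gcongr <;> first | exact hB | norm_num
  linarith [neg_abs_le (∑ k, P ^ 2 * γ * Tk k * W k)]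

lemma posSq_deriv (s : ℝ) : HasDerivAt (fun s : ℝ => (max s 0) ^ 2) (2 * max s 0) s := by
  rcases lt_trichotomy s 0 with h | h | h
  · rw [max_eq_right h.le, mul_zero]
    refine (hasDerivAt_const s (0:ℝ)).congr_of_eventuallyEq ?_
    filter_upwards [Iio_mem_nhds h] with y hy
    rw [max_eq_right (le_of_lt hy)]; norm_num
  · subst h
    rw [max_self, mul_zero]
    rw [hasDerivAt_iff_isLittleO_nhds_zero]
    have h1 : (fun h : ℝ => h ^ 2) =o[nhds 0] fun h : ℝ => h := by
      simpa using Asymptotics.isLittleO_pow_id (one_lt_two)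
    refine Asymptotics.IsBigO.trans_isLittleO ?_ h1
    refine Asymptotics.IsBigO.of_bound 1 (Filter.Eventually.of_forall fun y => ?_)
    simp only [zero_add, max_self, smul_zero, sub_zero, one_mul, norm_pow, Real.norm_eq_abs]
    norm_num
    rcases le_total y 0 with hy | hy
    · rw [max_eq_right hy]; simpa using sq_nonneg y
    · rw [max_eq_left hy]
  · rw [max_eq_left h.le]
    have h2 : HasDerivAt (fun s : ℝ => s ^ 2) (2 * s) s := by simpa using hasDerivAt_pow 2 s
    refine h2.congr_of_eventuallyEq ?_
    filter_upwards [Ioi_mem_nhds h] with y hy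
    rw [max_eq_left (le_of_lt hy)]

lemma g_deriv {ε : ℝ} (hε : 0 < ε) (T : ℝ) :
    HasDerivAt (fun T : ℝ => T / √(T ^ 2 + ε ^ 2)) (ε ^ 2 / √(T ^ 2 + ε ^ 2) ^ 3) T := by
  have hpos : 0 < T ^ 2 + ε ^ 2 := by positivity
  have hs : 0 < √(T ^ 2 + ε ^ 2) := Real.sqrt_pos.2 hpos
  have h1 : HasDerivAt (fun T : ℝ => T ^ 2 + ε ^ 2) (2 * T) T := by
    simpa using (hasDerivAt_pow 2 T).add_const (ε ^ 2)
  have h2 := (hasDerivAt_id T).div (h1.sqrt hpos.ne') hs.ne'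
  refine h2.congr_deriv ?_
  have hsq : √(T ^ 2 + ε ^ 2) ^ 2 = T ^ 2 + ε ^ 2 := Real.sq_sqrt hpos.le
  simp only [id]
  field_simp
  rw [hsq]; ring

/-- The vector field of the weighted identity. -/
def Wf {n : ℕ} (A : Fin n → Fin n → EuclideanSpace ℝ (Fin n) → ℝ) (u v : EuclideanSpace ℝ (Fin n) → ℝ)
    (k : Fin n) (y : EuclideanSpace ℝ (Fin n)) : ℝ :=
  ∑ j, (v y * (A k j y * pd j u y) - u y * (A k j y * pd j v y))

/-- The logarithmic ratio cut at level `δ`. -/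
def Pf {n : ℕ} (q Q : EuclideanSpace ℝ (Fin n) → ℝ) (δ : ℝ) (y : EuclideanSpace ℝ (Fin n)) : ℝ :=
  max (Real.log (Q y) - Real.log (q y) - δ) 0

/-- Regularised sign of `u v`. -/
def gf {n : ℕ} (u v : EuclideanSpace ℝ (Fin n) → ℝ) (ε : ℝ) (y : EuclideanSpace ℝ (Fin n)) : ℝ :=
  u y * v y / √((u y * v y) ^ 2 + ε ^ 2)

/-- The tested field. -/
def Ff {n : ℕ} (A : Fin n → Fin n → EuclideanSpace ℝ (Fin n) → ℝ) (q Q u v : EuclideanSpace ℝ (Fin n) → ℝ)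
    (δ ε : ℝ) (k : Fin n) (y : EuclideanSpace ℝ (Fin n)) : ℝ :=
  (Pf q Q δ y ^ 2 * gf u v ε y) * Wf A u v k y

section pt
variable {n : ℕ} {Ω : Set (EuclideanSpace ℝ (Fin n))} {A : Fin n → Fin n → EuclideanSpace ℝ (Fin n) → ℝ}
  {q Q u v : EuclideanSpace ℝ (Fin n) → ℝ} {x : EuclideanSpace ℝ (Fin n)}

lemma HG_Wf (hΩ : IsOpen Ω) (hA1 : ∀ i j, ContDiffOn ℝ 1 (A i j) Ω) (hu : ContDiffOn ℝ 2 u Ω)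
    (hv : ContDiffOn ℝ 2 v Ω) (hx : x ∈ Ω) (k : Fin n) :
    HG (Wf A u v k) (fun l => ∑ j, ((pd l v x * (A k j x * pd j u x) +
      v x * pd l (fun y => A k j y * pd j u y) x) - (pd l u x * (A k j x * pd j v x) +
      u x * pd l (fun y => A k j y * pd j v y) x))) x := by
  have hdu := ((hu.contDiffAt (hΩ.mem_nhds hx)).differentiableAt (by norm_num))
  have hdv := ((hv.contDiffAt (hΩ.mem_nhds hx)).differentiableAt (by norm_num))
  have hd : ∀ f, ContDiffOn ℝ 2 f Ω → ∀ j, DifferentiableAt ℝ (fun z => A k j z * pd j f z) x := by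
    intro f hf j
    have h1 := ((hA1 k j).contDiffAt (hΩ.mem_nhds hx)).differentiableAt (by norm_num)
    have h2 := ((pd_contDiffOn hΩ hf j).contDiffAt (hΩ.mem_nhds hx)).differentiableAt (by norm_num)
    exact h1.mul h2
  exact HG.sum Finset.univ fun j => ((HG.of_diff hdv).mul (HG.of_diff (hd u hu j))).sub
    ((HG.of_diff hdu).mul (HG.of_diff (hd v hv j)))

lemma Wf_div (hΩ : IsOpen Ω) (hA1 : ∀ i j, ContDiffOn ℝ 1 (A i j) Ω)
    (hsym : ∀ i j, ∀ x ∈ Ω, A i j x = A j i x) (hu : ContDiffOn ℝ 2 u Ω)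
    (hv : ContDiffOn ℝ 2 v Ω) (hsu : IsSolution A q u Ω) (hsv : IsSolution A Q v Ω) (hx : x ∈ Ω) :
    ∑ k, pd k (Wf A u v k) x = (Q x - q x) * (u x * v x) := by
  have h1 : ∀ k, pd k (Wf A u v k) x = _ := fun k => (HG_Wf hΩ hA1 hu hv hx k).pd_eq k
  simp only [h1]
  have e1 := hsu x hx
  have e2 := hsv x hx
  have e3 : ∑ k, ∑ j, pd k v x * (A k j x * pd j u x) = ∑ k, ∑ j, pd k u x * (A k j x * pd j v x) := by
    rw [Finset.sum_comm]
    refine Finset.sum_congr rfl fun k _ => Finset.sum_congr rfl fun j _ => ?_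
    rw [hsym j k x hx]; ring
  have e4 : ∑ k, ∑ j, ((pd k v x * (A k j x * pd j u x) +
      v x * pd k (fun y => A k j y * pd j u y) x) - (pd k u x * (A k j x * pd j v x) +
      u x * pd k (fun y => A k j y * pd j v y) x)) =
      (∑ k, ∑ j, pd k v x * (A k j x * pd j u x)) + v x * (∑ k, ∑ j, pd k (fun y => A k j y * pd j u y) x)
      - ((∑ k, ∑ j, pd k u x * (A k j x * pd j v x)) + u x * (∑ k, ∑ j, pd k (fun y => A k j y * pd j v y) x)) := by
    simp only [Finset.sum_sub_distrib, Finset.sum_add_distrib, Finset.mul_sum]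
  rw [e4, e3]
  have e5 : (∑ k, ∑ j, pd k (fun y => A k j y * pd j u y) x) = - (q x * u x) := by linarith
  have e6 : (∑ k, ∑ j, pd k (fun y => A k j y * pd j v y) x) = - (Q x * v x) := by linarith
  rw [e5, e6]; ring

lemma Ff_pd (hΩ : IsOpen Ω) (hA1 : ∀ i j, ContDiffOn ℝ 1 (A i j) Ω) (hu : ContDiffOn ℝ 2 u Ω)
    (hv : ContDiffOn ℝ 2 v Ω) (hx : x ∈ Ω) {δ ε : ℝ} (hε : 0 < ε) (hq : DifferentiableAt ℝ q x)
    (hQ : DifferentiableAt ℝ Q x) (hq0 : 0 < q x) (hQ0 : 0 < Q x) (k : Fin n) :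
    pd k (Ff A q Q u v δ ε k) x =
      2 * Pf q Q δ x * (pd k Q x / Q x - pd k q x / q x) * (u x * v x / √((u x * v x) ^ 2 + ε ^ 2)) * Wf A u v k x
      + Pf q Q δ x ^ 2 * (ε ^ 2 / √((u x * v x) ^ 2 + ε ^ 2) ^ 3) * (pd k u x * v x + u x * pd k v x) * Wf A u v k x
      + Pf q Q δ x ^ 2 * (u x * v x / √((u x * v x) ^ 2 + ε ^ 2)) * pd k (Wf A u v k) x := by
  have hdu := ((hu.contDiffAt (hΩ.mem_nhds hx)).differentiableAt (by norm_num))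
  have hdv := ((hv.contDiffAt (hΩ.mem_nhds hx)).differentiableAt (by norm_num))
  have h1 := (HG.comp (Real.hasDerivAt_log hQ0.ne') (HG.of_diff hQ)).sub
    (HG.comp (Real.hasDerivAt_log hq0.ne') (HG.of_diff hq))
  have h2 := h1.sub (HG.const δ)
  have h3 := HG.comp (posSq_deriv _) h2
  have h4 := HG.comp (g_deriv hε _) ((HG.of_diff hdu).mul (HG.of_diff hdv))
  have h5 := (h3.mul h4).mul (HG_Wf hΩ hA1 hu hv hx k)
  have h6 := h5.pd_eq k
  have h7 := (HG_Wf hΩ hA1 hu hv hx k).pd_eq k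
  rw [← h7] at h6
  refine h6.trans ?_
  unfold Pf
  ring

end pt

/-- difference of the square-root data -/
def wf {n : ℕ} (q Q u v : EuclideanSpace ℝ (Fin n) → ℝ) (y : EuclideanSpace ℝ (Fin n)) : ℝ :=
  √(q y) * |u y| - √(Q y) * |v y|

lemma HG_abs {n : ℕ} {q u : EuclideanSpace ℝ (Fin n) → ℝ} {x : EuclideanSpace ℝ (Fin n)}
    (hq : DifferentiableAt ℝ q x) (hu : DifferentiableAt ℝ u x) (hq0 : 0 < q x) (hu0 : u x ≠ 0) :
    ∃ σ : ℝ, (σ = 1 ∨ σ = -1) ∧ |u x| = σ * u x ∧ HG (fun y => √(q y) * |u y|)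
      (fun k => σ * (pd k q x * u x / (2 * √(q x)) + √(q x) * pd k u x)) x := by
  have h1 := HG.comp (Real.hasDerivAt_sqrt hq0.ne') (HG.of_diff hq)
  have key : ∀ σ : ℝ, |u x| = σ * u x → HasDerivAt (fun t : ℝ => |t|) σ (u x) →
      HG (fun y => √(q y) * |u y|)
        (fun k => σ * (pd k q x * u x / (2 * √(q x)) + √(q x) * pd k u x)) x := by
    intro σ hσ hd
    have h2 := HG.comp hd (HG.of_diff hu)
    refine (h1.mul h2).congr_grad fun k => ?_
    rw [hσ]; ring
  rcases lt_or_gt_of_ne hu0 with h | h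
  · have e : |u x| = -1 * u x := by rw [abs_of_neg h]; ring
    exact ⟨-1, Or.inr rfl, e, key (-1) e (hasDerivAt_abs_neg h)⟩
  · have e : |u x| = 1 * u x := by rw [abs_of_pos h]; ring
    exact ⟨1, Or.inl rfl, e, key 1 e (hasDerivAt_abs_pos h)⟩

set_option maxHeartbeats 1600000 in
lemma point_main {n : ℕ} {Ω : Set (EuclideanSpace ℝ (Fin n))}
    {A : Fin n → Fin n → EuclideanSpace ℝ (Fin n) → ℝ}
    {q Q u v : EuclideanSpace ℝ (Fin n) → ℝ} {x : EuclideanSpace ℝ (Fin n)} {B : ℝ}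
    (hΩ : IsOpen Ω) (hA1 : ∀ i j, ContDiffOn ℝ 1 (A i j) Ω)
    (hsym : ∀ i j, ∀ x ∈ Ω, A i j x = A j i x) (hu : ContDiffOn ℝ 2 u Ω)
    (hv : ContDiffOn ℝ 2 v Ω) (hsu : IsSolution A q u Ω) (hsv : IsSolution A Q v Ω) (hx : x ∈ Ω)
    (hB : 1 ≤ B) (hn : (n : ℝ) ≤ B) (hAB : ∀ k j, |A k j x| ≤ B)
    (hpsd : ∀ ξ : Fin n → ℝ, 0 ≤ ∑ k, ∑ j, A k j x * ξ k * ξ j)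
    (hq : DifferentiableAt ℝ q x) (hQ : DifferentiableAt ℝ Q x)
    (hq1 : 1 ≤ B * q x) (hQ1 : 1 ≤ B * Q x) (hq2 : q x ≤ B) (hQ2 : Q x ≤ B)
    (hqk : ∀ k, |pd k q x| ≤ B) (hQk : ∀ k, |pd k Q x| ≤ B)
    (hu1 : |u x| ≤ B) (hv1 : |v x| ≤ B) (huk : ∀ k, |pd k u x| ≤ B) (hvk : ∀ k, |pd k v x| ≤ B)
    {δ e ε ω : ℝ} (hδ : 0 < δ) (he : 0 < e) (he1 : e ≤ 1) (hε : ε = e ^ 2)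
    (hω : |wf q Q u v x| + ‖fderiv ℝ (wf q Q u v) x‖ ≤ ω) :
    Pf q Q δ x ^ 2 * (Q x - q x) * u x ^ 2 ≤
      B ^ 2 * (∑ k, pd k (Ff A q Q u v δ ε k) x) + 21 * B ^ 18 * (ω / ε + e) := by
  have hB0 : 0 < B := by linarith
  have hεp : 0 < ε := by rw [hε]; positivity
  have hε1 : ε ≤ 1 := by rw [hε]; exact pow_le_one₀ he.le he1
  have hq0 : 0 < q x := by
    by_contra h; push Not at h; nlinarith
  have hQ0 : 0 < Q x := by
    by_contra h; push Not at h; nlinarith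
  have hdu : DifferentiableAt ℝ u x := ((hu.contDiffAt (hΩ.mem_nhds hx)).differentiableAt (by norm_num))
  have hdv : DifferentiableAt ℝ v x := ((hv.contDiffAt (hΩ.mem_nhds hx)).differentiableAt (by norm_num))
  obtain ⟨α, hα⟩ : ∃ α, α = √(q x) := ⟨_, rfl⟩
  obtain ⟨β, hβ⟩ : ∃ β, β = √(Q x) := ⟨_, rfl⟩
  have hαp : 0 < α := by rw [hα]; exact Real.sqrt_pos.2 hq0
  have hβp : 0 < β := by rw [hβ]; exact Real.sqrt_pos.2 hQ0
  have hα2 : q x = α ^ 2 := by rw [hα, Real.sq_sqrt hq0.le]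
  have hβ2 : Q x = β ^ 2 := by rw [hβ, Real.sq_sqrt hQ0.le]
  have hBB : B ≤ B ^ 2 := by rw [sq]; exact le_mul_of_one_le_left hB0.le hB
  have hαB : α ≤ B := le_of_sq_le_sq (by linarith) hB0.le
  have hβB : β ≤ B := le_of_sq_le_sq (by linarith) hB0.le
  have hα1 : 1 ≤ B * α := by
    have : 1 ^ 2 ≤ (B * α) ^ 2 := by rw [mul_pow, ← hα2]; nlinarith
    exact le_of_sq_le_sq this (by positivity)
  obtain ⟨w, hw⟩ : ∃ w, w = wf q Q u v x := ⟨_, rfl⟩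
  have hw' : w = α * |u x| - β * |v x| := by rw [hw, wf, hα, hβ]
  rw [← hw] at hω
  have hN : 0 ≤ ‖fderiv ℝ (wf q Q u v) x‖ := norm_nonneg _
  have hwω : |w| ≤ ω := by linarith
  have hω0 : 0 ≤ ω := (abs_nonneg _).trans hwω
  have hwB : |w| ≤ 2 * B ^ 2 := by
    rw [hw']
    have h1 : |α * abs (u x)| ≤ B * B := abs_mul_bd (by rwa [abs_of_pos hαp]) (by rwa [abs_abs])
    have h2 : |β * abs (v x)| ≤ B * B := abs_mul_bd (by rwa [abs_of_pos hβp]) (by rwa [abs_abs])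
    have := abs_sub_bd h1 h2
    linarith
  obtain ⟨T, hT⟩ : ∃ T, T = u x * v x := ⟨_, rfl⟩
  have hTabs : |T| = |u x| * |v x| := by rw [hT, abs_mul]
  -- energy relation
  have huv : u x ^ 2 + v x ^ 2 ≤ B * (w ^ 2 + 2 * B ^ 2 * |T|) := by
    have e1 : u x ^ 2 ≤ B * (α * |u x|) ^ 2 := by
      rw [mul_pow, ← hα2, sq_abs]
      have := mul_le_mul_of_nonneg_right hq1 (sq_nonneg (u x)); linarith
    have e2 : v x ^ 2 ≤ B * (β * |v x|) ^ 2 := by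
      rw [mul_pow, ← hβ2, sq_abs]
      have := mul_le_mul_of_nonneg_right hQ1 (sq_nonneg (v x)); linarith
    have e3 : (α * |u x|) ^ 2 + (β * |v x|) ^ 2 = w ^ 2 + 2 * (α * β) * |T| := by
      rw [hw', hTabs]; ring
    have e4 : 2 * (α * β) * |T| ≤ 2 * B ^ 2 * |T| := by
      have : α * β ≤ B * B := mul_le_mul hαB hβB hβp.le hB0.le
      have := mul_le_mul_of_nonneg_right this (abs_nonneg T)
      linarith
    have e5 : B * ((α * |u x|) ^ 2 + (β * |v x|) ^ 2) ≤ B * (w ^ 2 + 2 * B ^ 2 * |T|) := by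
      refine mul_le_mul_of_nonneg_left ?_ hB0.le
      rw [e3]; linarith
    linarith
  obtain ⟨P, hP⟩ : ∃ P, P = Pf q Q δ x := ⟨_, rfl⟩
  have hP0 : 0 ≤ P := by rw [hP]; exact le_max_right _ _
  have hPB : P ≤ B ^ 2 := by
    rw [hP]
    refine max_le ?_ (by positivity)
    rw [← Real.log_div hQ0.ne' hq0.ne']
    have h1 := Real.log_le_sub_one_of_pos (div_pos hQ0 hq0)
    have h2 : Q x / q x ≤ B ^ 2 := by
      rw [div_le_iff₀ hq0]
      have : B * 1 ≤ B * (B * q x) := by gcongr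
      linarith
    linarith
  obtain ⟨R, hR⟩ : ∃ R, R = Q x - q x := ⟨_, rfl⟩
  have hRB : |R| ≤ B := by rw [hR, abs_le]; constructor <;> linarith
  have hPR : 0 ≤ P ^ 2 * R := by
    rcases eq_or_lt_of_le hP0 with h | h
    · rw [← h]; simp
    · have h1 : 0 < Real.log (Q x) - Real.log (q x) - δ := by
        by_contra hc; push Not at hc
        rw [hP, Pf, max_eq_right hc] at h; exact lt_irrefl _ h
      have h2 : q x < Q x := (Real.log_lt_log_iff hq0 hQ0).1 (by linarith)
      have : 0 < R := by rw [hR]; linarith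
      positivity
  obtain ⟨s, hs⟩ : ∃ s, s = √((u x * v x) ^ 2 + ε ^ 2) := ⟨_, rfl⟩
  have hspos : 0 < (u x * v x) ^ 2 + ε ^ 2 := by positivity
  have hsp : 0 < s := by rw [hs]; exact Real.sqrt_pos.2 hspos
  have hs2 : s ^ 2 = T ^ 2 + ε ^ 2 := by rw [hs, hT, Real.sq_sqrt hspos.le]
  -- the divergence
  have hdiv : ∑ k, pd k (Ff A q Q u v δ ε k) x =
      (∑ k, (2 * P * (pd k Q x / Q x - pd k q x / q x) * (T / s) * Wf A u v k x +
        P ^ 2 * (ε ^ 2 / s ^ 3) * (pd k u x * v x + u x * pd k v x) * Wf A u v k x))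
      + P ^ 2 * (T / s) * (R * T) := by
    have h1 := Wf_div hΩ hA1 hsym hu hv hsu hsv hx
    rw [← hT, ← hR] at h1
    rw [← h1, Finset.mul_sum, ← Finset.sum_add_distrib]
    refine Finset.sum_congr rfl fun k _ => ?_
    rw [Ff_pd hΩ hA1 hu hv hx hεp hq hQ hq0 hQ0 k, ← hP, ← hs, ← hT]
  -- main inequality
  have hmain : P ^ 2 * R * |T| ≤ ∑ k, pd k (Ff A q Q u v δ ε k) x + 20 * B ^ 16 * (ω / ε + e) := by
    rw [hdiv]
    have hWe : ∀ k, Wf A u v k x = ∑ j, A k j x * (v x * pd j u x - u x * pd j v x) := by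
      intro k; unfold Wf
      exact Finset.sum_congr rfl fun j _ => by ring
    by_cases hT0 : T = 0
    · refine alg_zero hB hn hT0 (fun k => ?_) hwω hwB hP0 hPB he hε hsp hs2 rfl
      rw [hWe]
      rw [hT] at hT0
      have aux : ∀ y : ℝ, ∀ a b : Fin n → ℝ, (∀ j, |a j| ≤ B) → (∀ j, |b j| ≤ B) → y ^ 2 ≤ B * w ^ 2 →
          |(y * b k) * ∑ j, A k j x * (y * a j)| ≤ B ^ 5 * w ^ 2 := by
        intro y a b ha hb hy
        have h1 : |(y * b k) * ∑ j, A k j x * (y * a j)| ≤ (|y| * B) * (n * (B * (|y| * B))) :=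
          abs_mul_bd (abs_mul_bd le_rfl (hb k)) (abs_sum_bd fun j => abs_mul_bd (hAB k j)
            (abs_mul_bd le_rfl (ha j)))
        refine h1.trans ?_
        calc (|y| * B) * (n * (B * (|y| * B))) ≤ (|y| * B) * (B * (B * (|y| * B))) := by gcongr
          _ = B ^ 4 * y ^ 2 := by rw [← sq_abs y]; ring
          _ ≤ B ^ 4 * (B * w ^ 2) := by gcongr
          _ = _ := by ring
      have hT00 : |T| = 0 := by rw [hT, hT0, abs_zero]
      rw [hT00] at huv
      rcases mul_eq_zero.1 hT0 with h | h
      · have := aux (v x) (fun j => pd j u x) (fun j => pd j u x) huk huk (by linarith [sq_nonneg (u x)])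
        simp only [h, zero_mul, sub_zero, add_zero] at this ⊢
        rwa [mul_comm (pd k u x)]
      · have := aux (u x) (fun j => -pd j v x) (fun j => pd j v x) (by simpa using hvk) hvk
          (by linarith [sq_nonneg (v x)])
        simp only [h, zero_mul, mul_zero, zero_sub, zero_add, mul_neg] at this ⊢
        exact this
    · have hu0 : u x ≠ 0 := fun h => hT0 (by rw [hT, h, zero_mul])
      have hv0 : v x ≠ 0 := fun h => hT0 (by rw [hT, h, mul_zero])
      obtain ⟨σ, hσ, hσu, hGu⟩ := HG_abs hq hdu hq0 hu0
      obtain ⟨τ, hτ, hτv, hGv⟩ := HG_abs hQ hdv hQ0 hv0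
      have hGw := hGu.sub hGv
      have hE : ∀ k, ∃ E, v x * pd k u x - u x * pd k v x =
          1 / 2 * (u x * v x) * (pd k Q x / Q x - pd k q x / q x) + E ∧ |E| ≤ 2 * B ^ 5 * ω := by
        intro k
        refine E_bd (w := w) (wk := pd k (wf q Q u v) x) hB hαp hβp hα2 hβ2 hσ hτ ?_ ?_ hq1 hQ1 hq2 hu1 (huk k) (hqk k) ?_
        · rw [hw', hσu, hτv]
        · have := hGw.pd_eq k
          rw [hα, hβ]; exact this
        · have := pd_le_fderiv (wf q Q u v) x k
          linarith
      choose E hE1 hE2 using hE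
      have htk : ∀ k, |pd k Q x / Q x - pd k q x / q x| ≤ 2 * B ^ 2 := by
        have aux : ∀ y z : ℝ, 0 < z → 1 ≤ B * z → |y| ≤ B → |y / z| ≤ B ^ 2 := by
          intro y z hz hz1 hy
          rw [abs_div, abs_of_pos hz, div_le_iff₀ hz]
          have : B * 1 ≤ B * (B * z) := by gcongr
          linarith
        intro k
        have := abs_sub_bd (aux _ _ hQ0 hQ1 (hQk k)) (aux _ _ hq0 hq1 (hqk k))
        linarith
      refine alg_ne (E := E) hB hn hAB hpsd (fun k => ?_) htk hE2 (fun k => ?_) (fun k => ?_) hwω hwB hP0 hPB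
        hRB hPR he he1 hε hsp hs2 rfl
      · rw [hWe]
        refine Finset.sum_congr rfl fun j _ => ?_
        rw [hE1, hT]
      · have := abs_add_bd (abs_mul_bd (huk k) hv1) (abs_mul_bd hu1 (hvk k))
        linarith
      · have h1 : (pd k u x * v x + u x * pd k v x) ^ 2 ≤ 2 * ((pd k u x * v x) ^ 2 + (u x * pd k v x) ^ 2) := by
          nlinarith [sq_nonneg (pd k u x * v x - u x * pd k v x)]
        have h2 : (pd k u x * v x) ^ 2 ≤ B ^ 2 * v x ^ 2 := by
          rw [mul_pow, ← sq_abs (pd k u x)]; gcongr; exact huk k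
        have h3 : (u x * pd k v x) ^ 2 ≤ B ^ 2 * u x ^ 2 := by
          rw [mul_pow, ← sq_abs (pd k v x), mul_comm]; gcongr; exact hvk k
        have h4 : 2 * B ^ 2 * (u x ^ 2 + v x ^ 2) ≤ 2 * B ^ 2 * (B * (w ^ 2 + 2 * B ^ 2 * |T|)) := by gcongr
        have h5 : 2 * B ^ 2 * (B * (w ^ 2 + 2 * B ^ 2 * |T|)) = 2 * (B ^ 3 * w ^ 2) + 4 * B ^ 5 * |T| := by ring
        have h6 : B ^ 3 * w ^ 2 ≤ B ^ 5 * w ^ 2 :=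
          mul_le_mul_of_nonneg_right (pow_le_pow_right₀ hB (by norm_num)) (sq_nonneg w)
        have h7 : 0 ≤ B ^ 5 * w ^ 2 := by positivity
        linarith
  -- conclusion
  have hu2 : u x ^ 2 ≤ B ^ 2 * (|T| + ω) := by
    have e1 : α * |u x| ^ 2 ≤ B * (|T| + ω) := by
      have : α * |u x| ^ 2 = β * |T| + |u x| * w := by rw [hw', hTabs]; ring
      rw [this]
      have h1 : β * |T| ≤ B * |T| := by gcongr
      have h2 : |u x| * w ≤ B * ω := by
        calc |u x| * w ≤ |u x| * |w| := by gcongr; exact le_abs_self _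
          _ ≤ B * ω := by gcongr
      linarith
    have e2 : u x ^ 2 ≤ B * α * |u x| ^ 2 := by
      rw [sq_abs]; exact le_mul_of_one_le_left (sq_nonneg _) hα1
    have e3 : B * (α * |u x| ^ 2) ≤ B * (B * (|T| + ω)) := by gcongr
    linarith
  rw [← hP, ← hR]
  have k1 := mul_le_mul_of_nonneg_left hu2 hPR
  have hP2 : P ^ 2 * R ≤ B ^ 5 := by
    have : R ≤ B := (le_abs_self _).trans hRB
    calc P ^ 2 * R ≤ P ^ 2 * B := by gcongr
      _ ≤ (B ^ 2) ^ 2 * B := by gcongr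
      _ = _ := by ring
  have k2 := mul_le_mul_of_nonneg_left hmain (by positivity : 0 ≤ B ^ 2)
  have hωε : ω ≤ ω / ε := by rw [le_div_iff₀ hεp]; exact mul_le_of_le_one_right hω0 hε1
  have k3 : P ^ 2 * R * (B ^ 2 * ω) ≤ B ^ 18 * (ω / ε + e) := by
    calc P ^ 2 * R * (B ^ 2 * ω) ≤ B ^ 5 * (B ^ 2 * ω) := by gcongr
      _ = B ^ 7 * ω := by ring
      _ ≤ B ^ 18 * (ω / ε + e) := by
        have : B ^ 7 ≤ B ^ 18 := pow_le_pow_right₀ hB (by norm_num)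
        gcongr; linarith
  have k4 : B ^ 2 * (20 * B ^ 16 * (ω / ε + e)) = 20 * (B ^ 18 * (ω / ε + e)) := by ring
  have k5 : P ^ 2 * R * (B ^ 2 * (|T| + ω)) = B ^ 2 * (P ^ 2 * R * |T|) + P ^ 2 * R * (B ^ 2 * ω) := by ring
  linarith

lemma log_lip {q₀ a b : ℝ} (h0 : 0 < q₀) (ha : q₀ ≤ a) (hb : q₀ ≤ b) :
    |Real.log a - Real.log b| ≤ |a - b| / q₀ := by
  have key : ∀ a b : ℝ, q₀ ≤ a → q₀ ≤ b → Real.log a - Real.log b ≤ |a - b| / q₀ := by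
    intro a b ha hb
    have ha' : 0 < a := by linarith
    have hb' : 0 < b := by linarith
    rw [← Real.log_div ha'.ne' hb'.ne']
    have h1 := Real.log_le_sub_one_of_pos (div_pos ha' hb')
    have h2 : a / b - 1 = (a - b) / b := by field_simp
    have h3 : (a - b) / b ≤ |a - b| / b := by gcongr; exact le_abs_self _
    have h4 : |a - b| / b ≤ |a - b| / q₀ := by gcongr
    linarith
  rw [abs_le]
  have h1 := key a b ha hb
  have h2 := key b a hb ha
  rw [abs_sub_comm] at h2
  constructor <;> linarith

lemma ext_log {n : ℕ} {Ω : Set (EuclideanSpace ℝ (Fin n))} {q : EuclideanSpace ℝ (Fin n) → ℝ} {M q₀ : ℝ}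
    (hq : W1InfBound Ω q M) (h0 : 0 < q₀) (hq0 : ∀ x ∈ closure Ω, q₀ ≤ q x) :
    ∃ l : EuclideanSpace ℝ (Fin n) → ℝ, ∃ K : NNReal, ∃ C : ℝ, LipschitzWith K l ∧ (∀ x, |l x| ≤ C) ∧
      ∀ x ∈ closure Ω, l x = Real.log (q x) := by
  obtain ⟨K, hK, hb⟩ := hq
  obtain ⟨g, hg, hgq⟩ := hK.extend_real
  have hg2 : LipschitzWith K (fun x => max (min (g x) M) q₀) := (hg.min_const M).max_const q₀
  refine ⟨fun x => Real.log (max (min (g x) M) q₀), (q₀⁻¹).toNNReal * K, |Real.log q₀| + |max M q₀ - q₀| / q₀, ?_, ?_, ?_⟩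
  · refine LipschitzWith.of_dist_le_mul fun x y => ?_
    rw [Real.dist_eq]
    refine (log_lip h0 (le_max_right _ _) (le_max_right _ _)).trans ?_
    have := hg2.dist_le_mul x y
    rw [Real.dist_eq] at this
    push_cast
    rw [Real.coe_toNNReal _ (by positivity), div_eq_inv_mul, mul_assoc]
    gcongr
  · intro x
    have h1 := log_lip h0 (le_max_right (min (g x) M) q₀) le_rfl
    have h2 : |max (min (g x) M) q₀ - q₀| ≤ |max M q₀ - q₀| := by
      rw [abs_of_nonneg (by simp), abs_of_nonneg (by simp)]
      gcongr; exact min_le_right _ _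
    have h3 : |max (min (g x) M) q₀ - q₀| / q₀ ≤ |max M q₀ - q₀| / q₀ := by gcongr
    have h4 := abs_sub_abs_le_abs_sub (Real.log (max (min (g x) M) q₀)) (Real.log q₀)
    linarith
  · intro x hx
    have h1 : q x ≤ M := by
      have := hb x hx
      have h2 := le_abs_self (q x)
      have h3 : (0:ℝ) ≤ K := K.2
      linarith
    simp only
    rw [← hgq hx, min_eq_left h1, max_eq_left (hq0 x hx)]

lemma lip_mul {n : ℕ} {f g : EuclideanSpace ℝ (Fin n) → ℝ} {Kf Kg : NNReal} {Cf Cg : ℝ}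
    (hf : LipschitzWith Kf f) (hg : LipschitzWith Kg g) (hCf : ∀ x, |f x| ≤ Cf) (hCg : ∀ x, |g x| ≤ Cg) :
    ∃ K : NNReal, LipschitzWith K (fun x => f x * g x) := by
  have hf0 : 0 ≤ Cf := (abs_nonneg _).trans (hCf 0)
  have hg0 : 0 ≤ Cg := (abs_nonneg _).trans (hCg 0)
  refine ⟨Cf.toNNReal * Kg + Cg.toNNReal * Kf, LipschitzWith.of_dist_le_mul fun x y => ?_⟩
  have h1 := hf.dist_le_mul x y
  have h2 := hg.dist_le_mul x y
  rw [Real.dist_eq] at h1 h2 ⊢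
  push_cast
  rw [Real.coe_toNNReal _ hf0, Real.coe_toNNReal _ hg0]
  have e : f x * g x - f y * g y = f x * (g x - g y) + g y * (f x - f y) := by ring
  rw [e]
  have := abs_add_bd (abs_mul_bd (hCf x) h2) (abs_mul_bd (hCg y) h1)
  linarith

lemma cutoff {n : ℕ} {K U : Set (EuclideanSpace ℝ (Fin n))} (hK : IsCompact K) (hU : IsOpen U)
    (hKU : K ⊆ U) : ∃ χ : EuclideanSpace ℝ (Fin n) → ℝ, ∃ K', IsCompact K' ∧ K' ⊆ U ∧ ContDiff ℝ 1 χ ∧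
      (∀ x ∈ K, χ x = 1) ∧ ∀ x, x ∉ K' → χ x = 0 := by
  obtain ⟨K', hK', h1, h2⟩ := exists_compact_between hK hU hKU
  obtain ⟨f, hf1, hf2, hf3⟩ := exists_contMDiffMap_one_nhds_of_subset_interior
    (modelWithCornersSelf ℝ (EuclideanSpace ℝ (Fin n))) (n := 1) hK.isClosed h1
  exact ⟨f, K', hK', h2, f.contMDiff.contDiff, fun x hx => hf1.self_of_nhdsSet x hx, hf2⟩

lemma Wf_C1 {n : ℕ} {Ω : Set (EuclideanSpace ℝ (Fin n))} {A : Fin n → Fin n → EuclideanSpace ℝ (Fin n) → ℝ}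
    {u v : EuclideanSpace ℝ (Fin n) → ℝ}
    (hΩ : IsOpen Ω) (hA1 : ∀ i j, ContDiffOn ℝ 1 (A i j) Ω) (hu : ContDiffOn ℝ 2 u Ω)
    (hv : ContDiffOn ℝ 2 v Ω) {ε : ℝ} (hε : 0 < ε) (k : Fin n) :
    ContDiffOn ℝ 1 (fun y => gf u v ε y * Wf A u v k y) Ω := by
  have hu1 : ContDiffOn ℝ 1 u Ω := hu.of_le (by norm_num)
  have hv1 : ContDiffOn ℝ 1 v Ω := hv.of_le (by norm_num)
  have hg : ContDiffOn ℝ 1 (gf u v ε) Ω := by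
    unfold gf
    refine (hu1.mul hv1).div (ContDiffOn.sqrt (((hu1.mul hv1).pow 2).add contDiffOn_const) ?_) ?_
    · intro x _; positivity
    · intro x _; positivity
  refine hg.mul ?_
  unfold Wf
  refine ContDiffOn.sum fun j _ => ?_
  exact (hv1.mul ((hA1 k j).mul (pd_contDiffOn hΩ hu j))).sub (hu1.mul ((hA1 k j).mul (pd_contDiffOn hΩ hv j)))

/-- The tested field integrates to zero. -/
lemma Ff_int {n : ℕ} {Ω : Set (EuclideanSpace ℝ (Fin n))} {A : Fin n → Fin n → EuclideanSpace ℝ (Fin n) → ℝ}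
    {q Q u v : EuclideanSpace ℝ (Fin n) → ℝ} {M q₀ δ ε : ℝ}
    (hΩ : IsOpen Ω) (hΩb : Bornology.IsBounded Ω) (hA1 : ∀ i j, ContDiffOn ℝ 1 (A i j) Ω) (hu : ContDiffOn ℝ 2 u Ω)
    (hv : ContDiffOn ℝ 2 v Ω) (hε : 0 < ε) (hδ : 0 < δ) (h0 : 0 < q₀) (hq : W1InfBound Ω q M)
    (hQ : W1InfBound Ω Q M) (hq0 : ∀ x ∈ closure Ω, q₀ ≤ q x) (hQ0 : ∀ x ∈ closure Ω, q₀ ≤ Q x)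
    (hb : ∀ x ∈ frontier Ω, q x = Q x) (k : Fin n) :
    IntegrableOn (pd k (Ff A q Q u v δ ε k)) Ω ∧ ∫ x in Ω, pd k (Ff A q Q u v δ ε k) x = 0 := by
  obtain ⟨l, K1, C1, hl, hlC, hlq⟩ := ext_log hq h0 hq0
  obtain ⟨L, K2, C2, hL, hLC, hLq⟩ := ext_log hQ h0 hQ0
  have hP : LipschitzWith (K2 + K1) (fun x => max (L x - l x + -δ) 0) := by
    refine LipschitzWith.max_const ?_ 0
    refine LipschitzWith.of_dist_le_mul fun x y => ?_
    have h1 := hl.dist_le_mul x y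
    have h2 := hL.dist_le_mul x y
    rw [Real.dist_eq] at h1 h2 ⊢
    have := abs_sub_bd h2 h1
    rw [show L x - l x + -δ - (L y - l y + -δ) = L x - L y - (l x - l y) by ring]
    push_cast; linarith
  have hPC : ∀ x, |max (L x - l x + -δ) 0| ≤ C2 + C1 := by
    intro x
    have h1 := abs_le.1 (hlC x)
    have h2 := abs_le.1 (hLC x)
    have h3 := (abs_nonneg _).trans (hlC x)
    have h4 := (abs_nonneg _).trans (hLC x)
    rw [abs_of_nonneg (le_max_right _ _)]
    exact max_le (by linarith) (by linarith)
  have hPf : ∀ x ∈ closure Ω, max (L x - l x + -δ) 0 = Pf q Q δ x := by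
    intro x hx; rw [hlq x hx, hLq x hx, Pf, sub_eq_add_neg (_ - _) δ]
  have hK : IsCompact (closure Ω ∩ {x | 0 ≤ L x - l x + -δ}) :=
    hΩb.isCompact_closure.inter_right
      (isClosed_le continuous_const ((hL.continuous.sub hl.continuous).add continuous_const))
  have hKU : closure Ω ∩ {x | 0 ≤ L x - l x + -δ} ⊆ Ω := by
    rintro x ⟨hx, hx2⟩
    by_contra hxo
    have hf : x ∈ frontier Ω := by rw [hΩ.frontier_eq]; exact ⟨hx, hxo⟩
    simp only [mem_setOf_eq] at hx2
    rw [hlq x hx, hLq x hx, hb x hf] at hx2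
    linarith
  obtain ⟨χ, K', hK', hK'U, hχ, hχ1, hχ0⟩ := cutoff hK hΩ hKU
  have hB1 : ContDiff ℝ 1 (fun y => χ y * (gf u v ε y * Wf A u v k y)) := by
    refine contDiff_of_vanish (m := 1) hΩ hK' hK'U (hχ.contDiffOn.mul (Wf_C1 hΩ hA1 hu hv hε k)) ?_
    intro x hx; rw [hχ0 x hx, zero_mul]
  have hBc : HasCompactSupport (fun y => χ y * (gf u v ε y * Wf A u v k y)) :=
    HasCompactSupport.intro hK' fun x hx => by rw [hχ0 x hx, zero_mul]
  obtain ⟨K3, hK3⟩ := hB1.lipschitzWith_of_hasCompactSupport hBc (by simp)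
  obtain ⟨C3, hC3⟩ := hBc.exists_bound_of_continuous hB1.continuous
  obtain ⟨K4, hK4⟩ := lip_mul hP hP hPC hPC
  obtain ⟨K5, hK5⟩ := lip_mul hK4 hK3 (fun x => abs_mul_bd (hPC x) (hPC x)) hC3
  obtain ⟨F, hF⟩ : ∃ F : EuclideanSpace ℝ (Fin n) → ℝ, F = fun x => (max (L x - l x + -δ) 0 * max (L x - l x + -δ) 0) *
    (χ x * (gf u v ε x * Wf A u v k x)) := ⟨_, rfl⟩
  rw [← hF] at hK5
  have hF0 : ∀ x, x ∉ K' → F x = 0 := fun x hx => by rw [hF]; simp only [hχ0 x hx, zero_mul, mul_zero]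
  have hFc : HasCompactSupport F := HasCompactSupport.intro hK' hF0
  have hFeq : ∀ x ∈ Ω, F x = Ff A q Q u v δ ε k x := by
    intro x hx
    have hx' := subset_closure hx
    rw [hF]; simp only [Ff]
    rw [hPf x hx']
    by_cases h : 0 ≤ L x - l x + -δ
    · rw [hχ1 x ⟨hx', h⟩]; ring
    · have : Pf q Q δ x = 0 := by rw [← hPf x hx']; exact max_eq_right (not_le.1 h).le
      rw [this]; ring
  have hpd : ∀ x ∈ Ω, pd k F x = pd k (Ff A q Q u v δ ε k) x := by
    intro x hx
    have : F =ᶠ[nhds x] Ff A q Q u v δ ε k := by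
      filter_upwards [hΩ.mem_nhds hx] with y hy using hFeq y hy
    unfold pd; rw [this.fderiv_eq]
  have hpd0 : ∀ x, x ∉ Ω → pd k F x = 0 := by
    intro x hx
    have : F =ᶠ[nhds x] fun _ => 0 := by
      filter_upwards [hK'.isClosed.isOpen_compl.mem_nhds (fun h => hx (hK'U h))] with y hy using hF0 y hy
    unfold pd; rw [this.fderiv_eq]; simp
  obtain ⟨hi, hz⟩ := integral_pd_lip hK5 hFc k
  refine ⟨(hi.integrableOn (s := Ω)).congr_fun (fun x hx => hpd x hx) hΩ.measurableSet, ?_⟩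
  rw [← setIntegral_congr_fun hΩ.measurableSet (fun x hx => hpd x hx),
    setIntegral_eq_integral_of_forall_compl_eq_zero hpd0, hz]

lemma Pf_nonneg {n : ℕ} {q Q : EuclideanSpace ℝ (Fin n) → ℝ} {δ : ℝ} (hδ : 0 < δ) {x : EuclideanSpace ℝ (Fin n)}
    (hq0 : 0 < q x) (hQ0 : 0 < Q x) : 0 ≤ Pf q Q δ x ^ 2 * (Q x - q x) := by
  have hP0 : 0 ≤ Pf q Q δ x := le_max_right _ _
  rcases eq_or_lt_of_le hP0 with h | h
  · rw [← h]; simp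
  · have h1 : 0 < Real.log (Q x) - Real.log (q x) - δ := by
      by_contra hc; push Not at hc
      rw [Pf, max_eq_right hc] at h; exact lt_irrefl _ h
    have h2 : q x < Q x := (Real.log_lt_log_iff hq0 hQ0).1 (by linarith)
    have : 0 < Q x - q x := by linarith
    positivity

lemma W1_facts {n : ℕ} {Ω : Set (EuclideanSpace ℝ (Fin n))} (hΩ : IsOpen Ω)
    {q : EuclideanSpace ℝ (Fin n) → ℝ} {M : ℝ} (hq : W1InfBound Ω q M) :
    ContinuousOn q (closure Ω) ∧ (∀ x ∈ closure Ω, |q x| ≤ M) ∧ (∀ x ∈ Ω, ∀ k, |pd k q x| ≤ M) ∧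
    (∀ᵐ x ∂(volume.restrict Ω), DifferentiableAt ℝ q x) := by
  obtain ⟨K, hK, hb⟩ := hq
  refine ⟨hK.continuousOn, fun x hx => ?_, fun x hx k => ?_, ?_⟩
  · have := hb x hx
    have h3 : (0:ℝ) ≤ K := K.2
    linarith
  · have h1 := norm_fderiv_le_of_lipschitzOn ℝ (hΩ.mem_nhds hx) (hK.mono subset_closure)
    have h2 := pd_le_fderiv q x k
    have h3 := hb x (subset_closure hx)
    have h4 := abs_nonneg (q x)
    linarith
  · obtain ⟨g, hg, hgq⟩ := hK.extend_real
    filter_upwards [ae_restrict_of_ae hg.ae_differentiableAt, ae_restrict_mem hΩ.measurableSet] with x hx hxΩ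
    refine hx.congr_of_eventuallyEq ?_
    filter_upwards [hΩ.mem_nhds hxΩ] with y hy using hgq (subset_closure hy)

/-- The integrated weighted estimate. -/
lemma int_main {n : ℕ} {Ω : Set (EuclideanSpace ℝ (Fin n))}
    {A : Fin n → Fin n → EuclideanSpace ℝ (Fin n) → ℝ} {q₀ M : ℝ}
    (hΩ : IsOpen Ω) (hΩb : Bornology.IsBounded Ω) (hA : EllipticSym Ω A) (h0 : 0 < q₀) (hM : 0 < M) :
    ∃ C > 0, ∀ q Q u v : EuclideanSpace ℝ (Fin n) → ℝ, (∀ x ∈ frontier Ω, q x = Q x) →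
      W1InfBound Ω q M → W1InfBound Ω Q M →
      (∀ x ∈ closure Ω, q₀ ≤ q x) → (∀ x ∈ closure Ω, q₀ ≤ Q x) →
      C2BoundOn Ω u M → C2BoundOn Ω v M →
      IsSolution A q u Ω → IsSolution A Q v Ω → ∀ e δ : ℝ, 0 < e → e ≤ 1 → 0 < δ →
      (∫ x in Ω, ((wf q Q u v x) ^ 2 + ‖fderiv ℝ (wf q Q u v) x‖ ^ 2)) = e ^ 6 →
      IntegrableOn (fun x => Pf q Q δ x ^ 2 * (Q x - q x) * u x ^ 2) Ω ∧
      (∀ x ∈ Ω, 0 ≤ Pf q Q δ x ^ 2 * (Q x - q x) * u x ^ 2) ∧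
      ∫ x in Ω, Pf q Q δ x ^ 2 * (Q x - q x) * u x ^ 2 ≤ C * e := by
  obtain ⟨hsym, hA1, lam, hlam, hell⟩ := hA
  have hbd : ∀ k j, ∃ C, ∀ x ∈ Ω, |A k j x| ≤ C ∧ ∀ l, |pd l (A k j) x| ≤ C := fun k j =>
    bound_C1 hΩ hΩb (hA1 k j)
  choose CA hCA using hbd
  obtain ⟨B, hBdef⟩ : ∃ B : ℝ, B = 1 + n + M + 1 / q₀ + ∑ k, ∑ j, |CA k j| := ⟨_, rfl⟩
  have hS0 : 0 ≤ ∑ k, ∑ j, |CA k j| := by positivity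
  have hn0 : (0:ℝ) ≤ n := by positivity
  have hq00 : 0 < 1 / q₀ := by positivity
  have hB1 : 1 ≤ B := by linarith
  have hBn : (n:ℝ) ≤ B := by linarith
  have hBM : M ≤ B := by linarith
  have hBq : 1 / q₀ ≤ B := by linarith
  have hBA : ∀ k j, CA k j ≤ B := by
    intro k j
    have h1 : |CA k j| ≤ ∑ j, |CA k j| :=
      Finset.single_le_sum (f := fun j => |CA k j|) (fun _ _ => abs_nonneg _) (Finset.mem_univ j)
    have h2 : ∑ j, |CA k j| ≤ ∑ k, ∑ j, |CA k j| :=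
      Finset.single_le_sum (f := fun k => ∑ j, |CA k j|) (fun _ _ => by positivity) (Finset.mem_univ k)
    have := le_abs_self (CA k j)
    linarith
  have hB0 : 0 < B := by linarith
  have hvol : volume Ω < ⊤ := hΩb.measure_lt_top
  haveI : IsFiniteMeasure (volume.restrict Ω) := ⟨by simpa using hvol⟩
  have hV0 : 0 ≤ volume.real Ω := measureReal_nonneg
  refine ⟨21 * B ^ 18 * (2 * volume.real Ω + 1), by positivity, ?_⟩
  intro q Q u v hb hq hQ hq0 hQ0 hu hv hsu hsv e δ he he1 hδ hEnergy
  obtain ⟨hqc, hqM, hqk, hqd⟩ := W1_facts hΩ hq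
  obtain ⟨hQc, hQM, hQk, hQd⟩ := W1_facts hΩ hQ
  have hqpos : ∀ x ∈ closure Ω, 0 < q x := fun x hx => h0.trans_le (hq0 x hx)
  have hQpos : ∀ x ∈ closure Ω, 0 < Q x := fun x hx => h0.trans_le (hQ0 x hx)
  have hPc : ContinuousOn (Pf q Q δ) (closure Ω) := by
    unfold Pf
    exact (((hQc.log fun x hx => (hQpos x hx).ne').sub (hqc.log fun x hx => (hqpos x hx).ne')).sub
      continuousOn_const).sup continuousOn_const
  have hcont : ContinuousOn (fun x => Pf q Q δ x ^ 2 * (Q x - q x) * u x ^ 2) (closure Ω) :=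
    ((hPc.pow 2).mul (hQc.sub hqc)).mul (hu.1.continuousOn.pow 2)
  have hI : IntegrableOn (fun x => Pf q Q δ x ^ 2 * (Q x - q x) * u x ^ 2) Ω :=
    (hcont.integrableOn_compact hΩb.isCompact_closure).mono_set subset_closure
  refine ⟨hI, fun x hx => mul_nonneg (Pf_nonneg hδ (hqpos x (subset_closure hx)) (hQpos x (subset_closure hx)))
    (sq_nonneg _), ?_⟩
  have hA1' : ∀ i j, ContDiffOn ℝ 1 (A i j) Ω := fun i j => (hA1 i j).mono subset_closure
  have hsym' : ∀ i j, ∀ x ∈ Ω, A i j x = A j i x := fun i j x hx => hsym i j x (subset_closure hx)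
  have he6 : e ^ 6 ≠ 0 := by positivity
  have hIw : IntegrableOn (fun x => (wf q Q u v x) ^ 2 + ‖fderiv ℝ (wf q Q u v) x‖ ^ 2) Ω := by
    by_contra hc
    rw [integral_undef hc] at hEnergy
    exact he6 hEnergy.symm
  have he2 : 0 < e ^ 2 := by positivity
  have hFi := fun k => Ff_int (A := A) (ε := e ^ 2) hΩ hΩb hA1' (C2_on hu) (C2_on hv) he2 hδ h0 hq hQ hq0 hQ0 hb k
  have hSi : IntegrableOn (fun x => ∑ k, pd k (Ff A q Q u v δ (e ^ 2) k) x) Ω :=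
    integrable_finsetSum _ fun k _ => (hFi k).1
  have hpt : ∀ᵐ x ∂(volume.restrict Ω), Pf q Q δ x ^ 2 * (Q x - q x) * u x ^ 2 ≤
      B ^ 2 * (∑ k, pd k (Ff A q Q u v δ (e ^ 2) k) x) + 
      (21 * B ^ 18 * (1 / e ^ 5) * ((wf q Q u v x) ^ 2 + ‖fderiv ℝ (wf q Q u v) x‖ ^ 2)
        + 42 * B ^ 18 * e) := by
    filter_upwards [hqd, hQd, ae_restrict_mem hΩ.measurableSet] with x hqx hQx hx
    have hx' := subset_closure hx
    have hmul : ∀ y : ℝ, q₀ ≤ y → 1 ≤ B * y := by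
      intro y hy
      calc (1:ℝ) = 1 / q₀ * q₀ := by field_simp
        _ ≤ B * y := by gcongr
    have hdu : ∀ f, C2BoundOn Ω f M → ∀ k, |pd k f x| ≤ B := fun f hf k =>
      ((pd_le_fderiv f x k).trans (fderiv_le_of_C2 hf hx)).trans hBM
    have := point_main (B := B) (δ := δ) (e := e) (ε := e ^ 2)
      (ω := e ^ 3 + ((wf q Q u v x) ^ 2 + ‖fderiv ℝ (wf q Q u v) x‖ ^ 2) / e ^ 3)
      hΩ hA1' hsym' (C2_on hu) (C2_on hv) hsu hsv hx hB1 hBn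
      (fun k j => ((hCA k j x hx).1).trans (hBA k j)) ?_ hqx hQx (hmul _ (hq0 x hx')) (hmul _ (hQ0 x hx'))
      ((le_abs_self _).trans ((hqM x hx').trans hBM)) ((le_abs_self _).trans ((hQM x hx').trans hBM))
      (fun k => (hqk x hx k).trans hBM) (fun k => (hQk x hx k).trans hBM)
      ((hu.2.1 x hx').trans hBM) ((hv.2.1 x hx').trans hBM) (hdu u hu) (hdu v hv) hδ he he1 rfl ?_
    · refine this.trans (le_of_eq ?_)
      field_simp
      ring
    · intro ξ
      have := hell x hx (WithLp.toLp 2 ξ)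
      refine le_trans (by positivity) this
    · have he3 : 0 < e ^ 3 := by positivity
      obtain ⟨a, ha⟩ : ∃ a, a = |wf q Q u v x| := ⟨_, rfl⟩
      obtain ⟨b, hb'⟩ : ∃ b, b = ‖fderiv ℝ (wf q Q u v) x‖ := ⟨_, rfl⟩
      rw [← sq_abs (wf q Q u v x), ← ha, ← hb']
      have : a + b - e ^ 3 ≤ (a ^ 2 + b ^ 2) / e ^ 3 := by
        rw [le_div_iff₀ he3]
        nlinarith [sq_nonneg (a - e ^ 3), sq_nonneg (b - e ^ 3), sq_nonneg a, sq_nonneg b]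
      linarith
  have hR1 : IntegrableOn (fun x => B ^ 2 * (∑ k, pd k (Ff A q Q u v δ (e ^ 2) k) x)) Ω := hSi.const_mul _
  have hR2 : IntegrableOn (fun x => 21 * B ^ 18 * (1 / e ^ 5) *
      ((wf q Q u v x) ^ 2 + ‖fderiv ℝ (wf q Q u v) x‖ ^ 2)) Ω := hIw.const_mul _
  have hR3 : IntegrableOn (fun _ : EuclideanSpace ℝ (Fin n) => 42 * B ^ 18 * e) Ω := integrable_const _
  have hle := integral_mono_ae hI (hR1.add (hR2.add hR3)) hpt
  refine hle.trans ?_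
  rw [integral_add' hR1 (hR2.add hR3), integral_add' hR2 hR3, integral_const_mul, integral_const_mul, hEnergy, integral_finsetSum _ fun k _ => (hFi k).1,
    Finset.sum_eq_zero fun k _ => (hFi k).2, setIntegral_const]
  have : 21 * B ^ 18 * (1 / e ^ 5) * e ^ 6 = 21 * B ^ 18 * e := by field_simp
  rw [this, smul_eq_mul]
  apply le_of_eq; ring

lemma vol_ball_pow {n : ℕ} {r : ℝ} (h : 0 < r) :
    volume.real (ball (0 : EuclideanSpace ℝ (Fin n)) r) =
      r ^ n * volume.real (ball (0 : EuclideanSpace ℝ (Fin n)) 1) := by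
  have := Measure.addHaar_ball_of_pos (volume : Measure (EuclideanSpace ℝ (Fin n))) 0 h
  rw [measureReal_def, this, ENNReal.toReal_mul, ENNReal.toReal_ofReal (by positivity)]
  simp [measureReal_def]

lemma dexp_le {a κ : ℝ} (ha : 0 < a) (hκ : 0 < κ) (N : ℕ) :
    Real.exp (-Real.exp (a / κ)) ≤ (N.factorial / a ^ N) * κ ^ N := by
  have h1 : Real.exp (-Real.exp (a / κ)) ≤ Real.exp (-(a / κ)) := by
    apply Real.exp_le_exp.2
    have := Real.add_one_le_exp (a / κ)
    linarith
  refine h1.trans ?_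
  have h2 := Real.pow_div_factorial_le_exp (a / κ) (by positivity) N
  rw [Real.exp_neg]
  have hpos : 0 < (a / κ) ^ N / N.factorial := by positivity
  calc (Real.exp (a / κ))⁻¹ ≤ ((a / κ) ^ N / N.factorial)⁻¹ := inv_anti₀ hpos h2
    _ = _ := by rw [div_pow]; field_simp

/-- The one-sided estimate. -/
lemma one_sided {n : ℕ} (hn : 0 < n) {Ω : Set (EuclideanSpace ℝ (Fin n))}
    (hΩo : IsOpen Ω) (hΩb : Bornology.IsBounded Ω) (hne : Ω.Nonempty)
    (hΩreg : IsC11Boundary Ω) {m : ℕ} (hbl : BrokenLineCond Ω m)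
    {A : Fin n → Fin n → EuclideanSpace ℝ (Fin n) → ℝ} (hA : EllipticSym Ω A)
    {q₀ M η : ℝ} (h0 : 0 < q₀) (hM : 0 < M) (hη : 0 < η) :
    ∃ a > 0, ∃ C > 0, ∀ q Q u v : EuclideanSpace ℝ (Fin n) → ℝ, (∀ x ∈ frontier Ω, q x = Q x) →
      W1InfBound Ω q M → W1InfBound Ω Q M →
      (∀ x ∈ closure Ω, q₀ ≤ q x) → (∀ x ∈ closure Ω, q₀ ≤ Q x) →
      C2BoundOn Ω u M → C2BoundOn Ω v M →
      IsSolution A q u Ω → IsSolution A Q v Ω → (∀ x ∈ frontier Ω, η ≤ |u x|) →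
      ∀ e : ℝ, 0 < e → e ≤ 1 →
      (∫ x in Ω, ((wf q Q u v x) ^ 2 + ‖fderiv ℝ (wf q Q u v) x‖ ^ 2)) = e ^ 6 →
      ∀ x ∈ Ω, 0 < Q x - q x → Real.exp (-Real.exp (a / (Q x - q x))) ^ (n + 3) ≤ C * e := by
  obtain ⟨c, hc, rs, hrs, hrs1, hlow⟩ := lower_bound hn hΩo hΩb hne hΩreg hbl hA hM hη
  obtain ⟨C, hC, hmain⟩ := int_main (q₀ := q₀) (M := M) hΩo hΩb hA h0 hM
  obtain ⟨c0, hc0⟩ : ∃ c0, c0 = min (1 / (8 * M)) (rs / (2 * M)) := ⟨_, rfl⟩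
  have hc0p : 0 < c0 := by rw [hc0]; apply lt_min <;> positivity
  have hc01 : c0 * (8 * M) ≤ 1 := by
    have : c0 ≤ 1 / (8 * M) := by rw [hc0]; exact min_le_left _ _
    rwa [le_div_iff₀ (by positivity)] at this
  have hc02 : c0 * (2 * M) ≤ rs := by
    have : c0 ≤ rs / (2 * M) := by rw [hc0]; exact min_le_right _ _
    rwa [le_div_iff₀ (by positivity)] at this
  obtain ⟨s, hs⟩ : ∃ s, s = min (c0 / 2) (1 / (4 * M ^ 2)) := ⟨_, rfl⟩
  have hsp : 0 < s := by rw [hs]; apply lt_min <;> positivity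
  have hs1 : s ≤ c0 / 2 := by rw [hs]; exact min_le_left _ _
  have hs2 : s * (4 * M ^ 2) ≤ 1 := by
    have : s ≤ 1 / (4 * M ^ 2) := by rw [hs]; exact min_le_right _ _
    rwa [le_div_iff₀ (by positivity)] at this
  obtain ⟨V, hV⟩ : ∃ V, V = volume.real (ball (0 : EuclideanSpace ℝ (Fin n)) 1) := ⟨_, rfl⟩
  have hVp : 0 < V := by
    rw [hV, measureReal_def]
    exact ENNReal.toReal_pos (measure_ball_pos _ _ one_pos).ne' measure_ball_lt_top.ne
  obtain ⟨a, ha⟩ : ∃ a, a = c / c0 := ⟨_, rfl⟩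
  have hap : 0 < a := by rw [ha]; positivity
  obtain ⟨F, hF⟩ : ∃ F : ℝ, F = (n + 3).factorial / a ^ (n + 3) := ⟨_, rfl⟩
  have hFp : 0 < F := by rw [hF]; positivity
  obtain ⟨g, hg⟩ : ∃ g, g = s ^ n * V / (128 * M ^ 2) := ⟨_, rfl⟩
  have hgp : 0 < g := by rw [hg]; positivity
  refine ⟨a, hap, F / g * C, by positivity, ?_⟩
  intro q Q u v hb hq hQ hq0 hQ0 hu hv hsu hsv hub e he he1 hEnergy x hx hκ0
  obtain ⟨κ, hκ⟩ : ∃ κ, κ = Q x - q x := ⟨_, rfl⟩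
  rw [← hκ] at hκ0 ⊢
  obtain ⟨-, hqM, -, -⟩ := W1_facts hΩo hq
  obtain ⟨-, hQM, -, -⟩ := W1_facts hΩo hQ
  have hx' := subset_closure hx
  have hκM : κ ≤ 2 * M := by
    have h1 := (abs_le.1 (hqM x hx')).1
    have h2 := (abs_le.1 (hQM x hx')).2
    linarith
  obtain ⟨r, hr⟩ : ∃ r, r = c0 * κ := ⟨_, rfl⟩
  have hrp : 0 < r := by rw [hr]; positivity
  have hrrs : r ≤ rs := by
    rw [hr]; exact (mul_le_mul_of_nonneg_left hκM hc0p.le).trans hc02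
  have hMr : 8 * M * r ≤ κ := by
    rw [hr]
    have := mul_le_mul_of_nonneg_right hc01 hκ0.le
    linarith
  -- values in the ball
  have hval : ∀ y ∈ closure Ω, dist y x < r → κ / 2 ≤ Q y - q y := by
    intro y hy hyr
    obtain ⟨K1, hK1, hb1⟩ := hq
    obtain ⟨K2, hK2, hb2⟩ := hQ
    have h1 := hK1.dist_le_mul y hy x hx'
    have h2 := hK2.dist_le_mul y hy x hx'
    rw [Real.dist_eq] at h1 h2
    have h3 : (K1:ℝ) ≤ M := by have := hb1 x hx'; have := abs_nonneg (q x); linarith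
    have h4 : (K2:ℝ) ≤ M := by have := hb2 x hx'; have := abs_nonneg (Q x); linarith
    have h5 : (K1:ℝ) * dist y x ≤ M * r := by gcongr
    have h6 : (K2:ℝ) * dist y x ≤ M * r := by gcongr
    have h7 := (abs_le.1 (h1.trans h5)).2
    have h8 := (abs_le.1 (h2.trans h6)).1
    linarith
  have hball : ball x r ⊆ Ω := by
    refine (convex_ball x r).isPreconnected.subset_of_closure_inter_subset hΩo
      ⟨x, mem_ball_self hrp, hx⟩ ?_
    rintro y ⟨hy, hyb⟩
    by_contra hyo
    have hf : y ∈ frontier Ω := by rw [hΩo.frontier_eq]; exact ⟨hy, hyo⟩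
    have h1 := hval y hy hyb
    rw [hb y hf] at h1
    linarith
  obtain ⟨z, hz, hzY⟩ := hlow q u (fun y hy => hqM y (subset_closure hy)) hu hsu hub r hrp hrrs x hball
  have hcr : c / r = a / κ := by rw [hr, ha]; field_simp
  rw [hcr] at hzY
  obtain ⟨Y, hY⟩ : ∃ Y, Y = Real.exp (-Real.exp (a / κ)) := ⟨_, rfl⟩
  rw [← hY] at hzY ⊢
  have hYp : 0 < Y := by rw [hY]; exact Real.exp_pos _
  have hY1 : Y ≤ 1 := by
    rw [hY]; apply Real.exp_le_one_iff.2
    have := Real.exp_pos (a / κ); linarith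
  have hYF : Y ≤ F * κ ^ (n + 3) := by rw [hY, hF]; exact dexp_le hap hκ0 _
  obtain ⟨ρ, hρ⟩ : ∃ ρ, ρ = s * κ * Y := ⟨_, rfl⟩
  have hρp : 0 < ρ := by rw [hρ]; positivity
  have hρr : ρ ≤ r / 2 := by
    calc ρ = s * κ * Y := hρ
      _ ≤ c0 / 2 * κ * 1 := by gcongr
      _ = r / 2 := by rw [hr]; ring
  have hρY : M * ρ ≤ Y / 2 := by
    have h1 : s * κ ≤ s * (2 * M) := by gcongr
    have h2 : M * (s * κ) ≤ M * (s * (2 * M)) := by gcongr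
    have h3 : M * (s * κ) ≤ 1 / 2 := by
      have : M * (s * (2 * M)) = s * (4 * M ^ 2) / 2 := by ring
      linarith
    have h4 := mul_le_mul_of_nonneg_right h3 hYp.le
    rw [hρ]; linarith
  have hzx : ball z ρ ⊆ ball x r := by
    refine ball_subset_ball' ?_
    have := mem_ball.1 hz
    linarith
  have huY : ∀ y ∈ ball z ρ, Y / 2 ≤ |u y| := by
    intro y hy
    have h1 := (convex_ball x r).norm_image_sub_le_of_norm_fderiv_le (𝕜 := ℝ) (f := u) (C := M)
      (fun y hy => C2_diff hΩo hu (hball hy)) (fun y hy => fderiv_le_of_C2 hu (hball hy))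
      (hzx hy) (hzx (mem_ball_self hρp))
    rw [Real.norm_eq_abs] at h1
    have h2 : M * ‖z - y‖ ≤ M * ρ := by
      gcongr
      have := mem_ball.1 hy
      rw [dist_comm, dist_eq_norm] at this
      exact this.le
    have h3 := abs_sub_abs_le_abs_sub (u z) (u y)
    linarith
  obtain ⟨δ, hδ⟩ : ∃ δ, δ = κ / (4 * M) := ⟨_, rfl⟩
  have hδp : 0 < δ := by rw [hδ]; positivity
  have hPδ : ∀ y ∈ ball x r, δ ≤ Pf q Q δ y := by
    intro y hy
    have hyΩ := subset_closure (hball hy)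
    have h1 := hval y hyΩ hy
    have hqp : 0 < q y := h0.trans_le (hq0 y hyΩ)
    have hQp : 0 < Q y := h0.trans_le (hQ0 y hyΩ)
    have hQle : Q y ≤ M := (abs_le.1 (hQM y hyΩ)).2
    have h2 := Real.log_le_sub_one_of_pos (div_pos hqp hQp)
    rw [Real.log_div hqp.ne' hQp.ne'] at h2
    have h3 : κ / 2 / M ≤ (Q y - q y) / Q y := by
      gcongr
      linarith
    have h4 : (Q y - q y) / Q y = 1 - q y / Q y := by field_simp
    have h5 : κ / 2 / M = 2 * δ := by rw [hδ]; field_simp; norm_num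
    refine le_trans ?_ (le_max_left _ _)
    linarith
  obtain ⟨hI, hI0, hIle⟩ := hmain q Q u v hb hq hQ hq0 hQ0 hu hv hsu hsv e δ he he1 hδp hEnergy
  have hsub : ball z ρ ⊆ Ω := hzx.trans hball
  have hmono : ∫ y in ball z ρ, Pf q Q δ y ^ 2 * (Q y - q y) * u y ^ 2 ≤
      ∫ y in Ω, Pf q Q δ y ^ 2 * (Q y - q y) * u y ^ 2 := by
    refine setIntegral_mono_set hI ?_ hsub.eventuallyLE
    filter_upwards [ae_restrict_mem hΩo.measurableSet] with y hy using hI0 y hy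
  have hlb := le_int_ball (C := δ ^ 2 * (κ / 2) * (Y / 2) ^ 2) (hI.mono_set hsub) (by
    intro y hy
    have h1 := hPδ y (hzx hy)
    have h2 := hval y (subset_closure (hsub hy)) (hzx hy)
    have h3 := huY y hy
    have h4 : (Y / 2) ^ 2 ≤ u y ^ 2 := by rw [← sq_abs (u y)]; gcongr
    have h5 : 0 ≤ Q y - q y := by linarith
    gcongr)
  rw [vol_ball_pow hρp, ← hV] at hlb
  have hfin : g * (κ ^ (n + 3) * Y ^ (n + 2)) ≤ C * e := by
    have : δ ^ 2 * (κ / 2) * (Y / 2) ^ 2 * (ρ ^ n * V) = g * (κ ^ (n + 3) * Y ^ (n + 2)) := by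
      rw [hδ, hρ, hg, mul_pow, mul_pow]
      field_simp
      ring
    linarith
  calc Y ^ (n + 3) = Y * Y ^ (n + 2) := by ring
    _ ≤ F * κ ^ (n + 3) * Y ^ (n + 2) := by gcongr
    _ = F / g * (g * (κ ^ (n + 3) * Y ^ (n + 2))) := by field_simp
    _ ≤ F / g * (C * e) := by gcongr
    _ = _ := by ring

lemma wf_swap {n : ℕ} (Ω : Set (EuclideanSpace ℝ (Fin n))) (q Q u v : EuclideanSpace ℝ (Fin n) → ℝ) :
    (∫ x in Ω, ((wf Q q v u x) ^ 2 + ‖fderiv ℝ (wf Q q v u) x‖ ^ 2)) =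
    ∫ x in Ω, ((wf q Q u v x) ^ 2 + ‖fderiv ℝ (wf q Q u v) x‖ ^ 2) := by
  have h : wf Q q v u = -wf q Q u v := by
    funext y; simp only [wf, Pi.neg_apply]; ring
  rw [h]
  simp only [fderiv_neg, Pi.neg_apply, neg_sq, norm_neg]

lemma final_step {a κ E N Cl : ℝ} (ha : 0 < a) (hN : 0 < N) (hκ : 0 < κ)
    (h : E - Cl ≤ N * Real.exp (a / κ)) (h1 : 2 * Cl ≤ E) (h2 : 2 * N < E) :
    κ ≤ a * |Real.log (E / (2 * N))|⁻¹ := by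
  have h3 : 1 < E / (2 * N) := by rw [lt_div_iff₀ (by positivity)]; linarith
  have h4 : E / (2 * N) ≤ Real.exp (a / κ) := by
    rw [div_le_iff₀ (by positivity)]; linarith
  have h5 : 0 < Real.log (E / (2 * N)) := Real.log_pos h3
  have h6 : Real.log (E / (2 * N)) ≤ a / κ := by
    rw [Real.log_le_iff_le_exp (by linarith)]; exact h4
  rw [abs_of_pos h5, ← div_eq_mul_inv, le_div_iff₀ h5]
  rw [le_div_iff₀ hκ] at h6
  linarith

theorem stmt_6 {n : ℕ} (hn : n = 2 ∨ n = 3)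
    (Ω : Set (EuclideanSpace ℝ (Fin n)))
    (hΩo : IsOpen Ω) (hΩb : Bornology.IsBounded Ω) (hΩc : IsConnected Ω)
    (hΩreg : IsC11Boundary Ω) (hcone : UniformIntConeProperty Ω)
    (m : ℕ) (hm : 0 < m) (hbl : BrokenLineCond Ω m)
    (A : Fin n → Fin n → EuclideanSpace ℝ (Fin n) → ℝ) (hA : EllipticSym Ω A)
    (q₀ M η θ : ℝ) (hq₀ : 0 < q₀) (hM : 0 < M) (hη : 0 < η)
    (hθ : 0 < θ) (hθ' : θ < 1 / 4) :
    ∃ C₀ > 0, ∃ C₁ > 0, ∀ q qt u ut : EuclideanSpace ℝ (Fin n) → ℝ,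
      (∀ x ∈ frontier Ω, q x = qt x) →
      W1InfBound Ω q M → W1InfBound Ω qt M →
      (∀ x ∈ closure Ω, q₀ ≤ q x) → (∀ x ∈ closure Ω, q₀ ≤ qt x) →
      C2BoundOn Ω u M → C2BoundOn Ω ut M →
      IsSolution A q u Ω → IsSolution A qt ut Ω →
      (∀ x ∈ frontier Ω, u x = ut x) →
      (∀ x ∈ frontier Ω, η ≤ |u x|) →
      ∀ D : ℝ,
        D = (H1Norm Ω
          (fun y => Real.sqrt (q y) * |u y| - Real.sqrt (qt y) * |ut y|)) ^ θ →
        0 < D → D < 1 →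
        ∀ x ∈ Ω, |q x - qt x| ≤ C₀ * (|Real.log (C₁ * |Real.log D|)|⁻¹ + D) := by
  have hn0 : 0 < n := by rcases hn with h | h <;> omega
  obtain ⟨a, ha, C, hC, H⟩ := one_sided (q₀ := q₀) (M := M) (η := η) hn0 hΩo hΩb hΩc.nonempty hΩreg hbl hA hq₀ hM hη
  obtain ⟨N, hN⟩ : ∃ N : ℝ, N = n + 3 := ⟨_, rfl⟩
  have hNp : 0 < N := by rw [hN]; positivity
  obtain ⟨E0, hE0⟩ : ∃ E0, E0 = max (2 * N) (2 * Real.log C) := ⟨_, rfl⟩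
  have hE1 : 2 * N ≤ E0 := by rw [hE0]; exact le_max_left _ _
  have hE2 : 2 * Real.log C ≤ E0 := by rw [hE0]; exact le_max_right _ _
  obtain ⟨D0, hD0⟩ : ∃ D0, D0 = Real.exp (-(3 * θ * E0)) := ⟨_, rfl⟩
  have hD0p : 0 < D0 := by rw [hD0]; exact Real.exp_pos _
  refine ⟨a + 2 * M / D0, by positivity, 1 / (6 * θ * N), by positivity, ?_⟩
  intro q qt u ut hb hq hqt hq0 hqt0 hu hut hsu hsut hbu hη' D hD hDp hD1 x hx
  have hbut : ∀ x ∈ frontier Ω, η ≤ |ut x| := fun x hx => by rw [← hbu x hx]; exact hη' x hx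
  obtain ⟨I, hI⟩ : ∃ I, I = ∫ x in Ω, ((wf q qt u ut x) ^ 2 + ‖fderiv ℝ (wf q qt u ut) x‖ ^ 2) := ⟨_, rfl⟩
  have hI0 : 0 ≤ I := by
    rw [hI]; exact integral_nonneg fun y => by positivity
  have hDI : D = (I ^ (1 / 2 : ℝ)) ^ θ := by rw [hD, hI]; rfl
  have hIp : 0 < I := by
    rcases eq_or_lt_of_le hI0 with h | h
    · rw [← h, Real.zero_rpow (by norm_num), Real.zero_rpow hθ.ne'] at hDI
      linarith
    · exact h
  have hlogD : Real.log D = θ * (1 / 2 * Real.log I) := by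
    rw [hDI, Real.log_rpow (by positivity), Real.log_rpow hIp]
  obtain ⟨e, he⟩ : ∃ e, e = Real.exp (Real.log I / 6) := ⟨_, rfl⟩
  have hep : 0 < e := by rw [he]; exact Real.exp_pos _
  have he6 : I = e ^ 6 := by
    rw [he, ← Real.exp_nat_mul]
    rw [show ((6:ℕ):ℝ) * (Real.log I / 6) = Real.log I by push_cast; ring, Real.exp_log hIp]
  obtain ⟨E, hE⟩ : ∃ E, E = -Real.log e := ⟨_, rfl⟩
  have hlI : Real.log I = -(6 * E) := by rw [hE, he, Real.log_exp]; ring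
  have hlD : Real.log D = -(3 * θ * E) := by rw [hlogD, hlI]; ring
  have hEp : 0 < E := by
    have h1 := Real.log_neg hDp hD1
    rw [hlD] at h1
    by_contra hc
    push Not at hc
    have : 3 * θ * E ≤ 0 := mul_nonpos_of_nonneg_of_nonpos (by positivity) hc
    linarith
  have he1 : e ≤ 1 := by
    have : Real.log e < 0 := by linarith
    exact ((Real.log_neg_iff hep).1 this).le
  have harg : 1 / (6 * θ * N) * |Real.log D| = E / (2 * N) := by
    rw [hlD, abs_neg, abs_of_pos (by positivity)]
    field_simp
    ring
  rw [harg]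
  have hx' := subset_closure hx
  have hinv : 0 ≤ |Real.log (E / (2 * N))|⁻¹ := by positivity
  have hMD : 0 ≤ 2 * M / D0 := by positivity
  have hsplit : (a + 2 * M / D0) * (|Real.log (E / (2 * N))|⁻¹ + D) =
      a * |Real.log (E / (2 * N))|⁻¹ + 2 * M / D0 * D +
        (a * D + 2 * M / D0 * |Real.log (E / (2 * N))|⁻¹) := by ring
  have hex : 0 ≤ a * D + 2 * M / D0 * |Real.log (E / (2 * N))|⁻¹ := by positivity
  have haL : 0 ≤ a * |Real.log (E / (2 * N))|⁻¹ := by positivity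
  have hDD : 0 ≤ 2 * M / D0 * D := by positivity
  rw [hsplit]
  by_cases hcase : E ≤ E0
  · have hDD0 : D0 ≤ D := by
      rw [hD0, ← Real.exp_log hDp, hlD]
      apply Real.exp_le_exp.2
      have : 3 * θ * E ≤ 3 * θ * E0 := by gcongr
      linarith
    have h1 : 2 * M ≤ 2 * M / D0 * D := by
      calc 2 * M = 2 * M / D0 * D0 := by field_simp
        _ ≤ _ := by gcongr
    have h2 := (W1_facts hΩo hq).2.1 x hx'
    have h3 := (W1_facts hΩo hqt).2.1 x hx'
    have h4 := abs_sub_bd h2 h3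
    linarith
  · push Not at hcase
    have key : ∀ κ : ℝ, 0 < κ → Real.exp (-Real.exp (a / κ)) ^ (n + 3) ≤ C * e →
        κ ≤ a * |Real.log (E / (2 * N))|⁻¹ := by
      intro κ hκ h
      refine final_step (Cl := Real.log C) ha hNp hκ ?_ (by linarith) (by linarith)
      have h1 := Real.log_le_log (by positivity) h
      rw [Real.log_mul hC.ne' hep.ne', Real.log_pow, Real.log_exp] at h1
      push_cast at h1
      rw [← hN] at h1
      linarith
    rcases lt_trichotomy (q x) (qt x) with h | h | h
    · have h1 := H q qt u ut hb hq hqt hq0 hqt0 hu hut hsu hsut hη' e hep he1 (by rw [← hI, he6]) x hx (by linarith)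
      have h2 := key _ (by linarith) h1
      rw [abs_sub_comm, abs_of_pos (by linarith)]
      linarith
    · rw [h, sub_self, abs_zero]; linarith
    · have h1 := H qt q ut u (fun x hx => (hb x hx).symm) hqt hq hqt0 hq0 hut hu hsut hsu hbut e hep he1
        (by rw [wf_swap, ← hI, he6]) x hx (by linarith)
      have h2 := key _ (by linarith) h1
      rw [abs_of_pos (by linarith)]
      linarith
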